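/- Let 0 < p, q < ∞ with q < p and 1 < p, and let u, v, w be weights on (a,b). Then there exists a finite constant C > 0 such that the inequality (∫_a^b (∫_a^x f(s) u(s) ds)^q w(x) dx)^{1/q} ≤ C (∫_a^b f(x)^p v(x) dx)^{1/p} holds for all non-decreasing f ∈ 𝔐↑(a,b) if and only if both 𝒞₃ := (∫_a^b (∫_x^b w(s) (∫_x^s u)^q ds)^{q/(p-q)} w(x) · ess sup_{t∈(a,x)} (∫_t^x u)^q (∫_t^b v)^{-q/(p-q)} dx)^{(p-q)/(pq)} < ∞ and 𝒞₅ := (∫_a^b (∫_x^b w)^{q/(p-q)} w(x) (∫_a^x (∫_t^x u)^{1/(p-1)} u(t) (∫_t^b v)^{-1/(p-1)} dt)^{q(p-1)/(p-q)} dx)^{(p-q)/(pq)} < ∞. Moreover, the best constant C in the inequality satisfies C ≈ 𝒞₃ + 𝒞₅. -/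

import Mathlib

open MeasureTheory Set ENNReal

noncomputable section

/-- The open interval `(a, b)` with extended-real endpoints, viewed as a set of reals. -/
def io (a b : EReal) : Set ℝ := {x : ℝ | a < (x : EReal) ∧ (x : EReal) < b}

/-- A weight on `(a, b)`: a measurable function which is positive and finite on `(a, b)`. -/
def IsWeight (a b : EReal) (u : ℝ → ℝ≥0∞) : Prop :=
  Measurable u ∧ ∀ x ∈ io a b, 0 < u x ∧ u x < ⊤

/-- The left-hand side of the Hardy inequality for non-decreasing functions. -/
def lhsMon (a b : EReal) (q : ℝ) (u w f : ℝ → ℝ≥0∞) : ℝ≥0∞ :=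
  (∫⁻ x in io a b, (∫⁻ s in io a x, f s * u s) ^ q * w x) ^ (1 / q)

/-- The right-hand side (without the constant) of the inequality. -/
def rhsNorm (a b : EReal) (p : ℝ) (v f : ℝ → ℝ≥0∞) : ℝ≥0∞ :=
  (∫⁻ x in io a b, f x ^ p * v x) ^ (1 / p)

/-- The best constant in the Hardy inequality restricted to non-negative
non-decreasing functions. -/
def bestMon (a b : EReal) (p q : ℝ) (u v w : ℝ → ℝ≥0∞) : ℝ≥0∞ :=
  sInf {C : ℝ≥0∞ | ∀ f : ℝ → ℝ≥0∞, Measurable f → MonotoneOn f (io a b) →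
    lhsMon a b q u w f ≤ C * rhsNorm a b p v f}

/-- The constant `𝒞₃`. -/
def CC3 (a b : EReal) (p q : ℝ) (u v w : ℝ → ℝ≥0∞) : ℝ≥0∞ :=
  (∫⁻ x in io a b,
      (∫⁻ s in io x b, w s * (∫⁻ σ in io x s, u σ) ^ q) ^ (q / (p - q)) * w x *
      essSup (fun t : ℝ =>
          (∫⁻ s in io t x, u s) ^ q * (∫⁻ s in io t b, v s) ^ (-(q / (p - q))))
        (volume.restrict (io a x))) ^ ((p - q) / (p * q))

/-- The constant `𝒞₅`. -/
def CC5 (a b : EReal) (p q : ℝ) (u v w : ℝ → ℝ≥0∞) : ℝ≥0∞ :=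
  (∫⁻ x in io a b, (∫⁻ t in io x b, w t) ^ (q / (p - q)) * w x *
      (∫⁻ t in io a x,
        (∫⁻ s in io t x, u s) ^ (1 / (p - 1)) * u t *
          (∫⁻ s in io t b, v s) ^ (-(1 / (p - 1)))) ^
        (q * (p - 1) / (p - q))) ^ ((p - q) / (p * q))

theorem measure_eq_iSup_Ici_of_isUpperSet (μ : Measure ℝ) {S : Set ℝ} (hS : IsUpperSet S) :
    μ S = ⨆ t ∈ S, μ (Ici t) := by
  set D : Set ℝ := (S ∩ range ((↑) : ℚ → ℝ)) ∪ {t | IsLeast S t} with hD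
  have hDS : D ⊆ S := by
    rintro t (ht | ht)
    · exact ht.1
    · exact ht.1
  have hDc : D.Countable := by
    refine ((countable_range _).mono inter_subset_right).union ?_
    refine Set.Subsingleton.countable ?_
    intro x hx y hy
    exact hx.unique hy
  have hU : S = ⋃ t ∈ D, Ici t := by
    apply Subset.antisymm
    · intro s hs
      simp only [mem_iUnion, mem_Ici, exists_prop]
      by_cases h : IsLeast S s
      · exact ⟨s, Or.inr h, le_rfl⟩
      · have : ∃ s' ∈ S, s' < s := by
          by_contra hcon
          push Not at hcon
          exact h ⟨hs, hcon⟩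
        obtain ⟨s', hs', hlt⟩ := this
        obtain ⟨r, hr1, hr2⟩ := exists_rat_btwn hlt
        exact ⟨r, Or.inl ⟨hS hr1.le hs', mem_range_self r⟩, hr2.le⟩
    · intro s hs
      simp only [mem_iUnion, mem_Ici, exists_prop] at hs
      obtain ⟨t, ht, hts⟩ := hs
      exact hS hts (hDS ht)
  apply le_antisymm
  · conv_lhs => rw [hU]
    rw [measure_biUnion_eq_iSup hDc]
    · exact biSup_mono hDS
    · intro x hx y hy
      rcases le_total x y with h | h
      · exact ⟨x, hx, subset_rfl, Ici_subset_Ici.2 h⟩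
      · exact ⟨y, hy, Ici_subset_Ici.2 h, subset_rfl⟩
  · exact iSup₂_le fun t ht => measure_mono fun y hy => hS hy ht

theorem measure_Ici_le_two_mul (μ : Measure ℝ) [IsFiniteMeasure μ] (s : ℝ) :
    μ (Ici s) ≤ 2 * μ {t | s ≤ t ∧ μ (Ici s) / 2 ≤ μ (Ici t)} := by
  set m := μ (Ici s) with hm
  have hmt : m ≠ ⊤ := measure_ne_top _ _
  set B : Set ℝ := {t | s ≤ t ∧ μ (Ici t) < m / 2}
  have hB : IsUpperSet B := fun x y hxy hx =>
    ⟨hx.1.trans hxy, (measure_mono (Ici_subset_Ici.2 hxy)).trans_lt hx.2⟩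
  have hBm : μ B ≤ m / 2 := by
    rw [measure_eq_iSup_Ici_of_isUpperSet μ hB]
    exact iSup₂_le fun t ht => ht.2.le
  have hcov : Ici s ⊆ {t | s ≤ t ∧ m / 2 ≤ μ (Ici t)} ∪ B := by
    intro t ht
    rcases le_or_gt (m / 2) (μ (Ici t)) with h | h
    · exact Or.inl ⟨ht, h⟩
    · exact Or.inr ⟨ht, h⟩
  have h1 : m ≤ μ {t | s ≤ t ∧ m / 2 ≤ μ (Ici t)} + m / 2 :=
    (measure_mono hcov).trans ((measure_union_le _ _).trans (add_le_add_right hBm _))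
  have h2 : m / 2 ≤ μ {t | s ≤ t ∧ m / 2 ≤ μ (Ici t)} := by
    have h3 : m / 2 + m / 2 ≤ μ {t | s ≤ t ∧ m / 2 ≤ μ (Ici t)} + m / 2 := by
      rwa [ENNReal.add_halves]
    exact (ENNReal.add_le_add_iff_right (by finiteness)).1 h3
  calc m = 2 * (m / 2) := (ENNReal.mul_div_cancel (by simp) (by simp)).symm
    _ ≤ _ := by gcongr

theorem measurable_measure_Ici (μ : Measure ℝ) : Measurable fun t => μ (Ici t) :=
  Antitone.measurable fun _ _ h => measure_mono (Ici_subset_Ici.2 h)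

theorem rpow_measure_Ici_le (μ : Measure ℝ) [IsFiniteMeasure μ] (s : ℝ) {β : ℝ} (hβ : 0 ≤ β) :
    μ (Ici s) ^ (β + 1) ≤ 2 ^ (β + 1) * ∫⁻ t in Ici s, μ (Ici t) ^ β ∂μ := by
  set m := μ (Ici s) with hm
  have hA := measure_Ici_le_two_mul μ s
  set A := {t | s ≤ t ∧ μ (Ici s) / 2 ≤ μ (Ici t)} with hAdef
  have hAs : A ⊆ Ici s := fun t ht => ht.1
  have hAm : MeasurableSet A :=
    measurableSet_Ici.inter (measurableSet_le measurable_const (measurable_measure_Ici μ))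
  have h1 : (m / 2) ^ β * μ A ≤ ∫⁻ t in Ici s, μ (Ici t) ^ β ∂μ := by
    calc (m / 2) ^ β * μ A = ∫⁻ _ in A, (m / 2) ^ β ∂μ := by simp
      _ ≤ ∫⁻ t in A, μ (Ici t) ^ β ∂μ :=
        setLIntegral_mono' hAm fun t ht => ENNReal.rpow_le_rpow ht.2 hβ
      _ ≤ _ := lintegral_mono_set hAs
  calc m ^ (β + 1) = 2 ^ β * (m / 2) ^ β * m := by
        rw [← ENNReal.mul_rpow_of_nonneg _ _ hβ, ENNReal.mul_div_cancel (by simp) (by simp),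
          ENNReal.rpow_add_of_nonneg _ _ hβ zero_le_one, ENNReal.rpow_one]
    _ ≤ 2 ^ β * (m / 2) ^ β * (2 * μ A) := by gcongr
    _ = 2 ^ (β + 1) * ((m / 2) ^ β * μ A) := by
        rw [ENNReal.rpow_add_of_nonneg _ _ hβ zero_le_one, ENNReal.rpow_one]; ring
    _ ≤ _ := by gcongr

theorem lintegral_rpow_eq_lintegral_meas_lt {α : Type*} [MeasurableSpace α] (μ : Measure α)
    {f : α → ℝ≥0∞} (hf : Measurable f) (hft : ∀ x, f x ≠ ⊤) {s : ℝ} (hs : 0 < s) :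
    ∫⁻ x, f x ^ s ∂μ = ENNReal.ofReal s *
      ∫⁻ t in Ioi (0 : ℝ), μ {x | ENNReal.ofReal t < f x} * ENNReal.ofReal (t ^ (s - 1)) := by
  have h := lintegral_rpow_eq_lintegral_meas_lt_mul μ (f := fun x => (f x).toReal)
    (ae_of_all _ fun x => ENNReal.toReal_nonneg) hf.ennreal_toReal.aemeasurable hs
  have h1 : ∫⁻ x, f x ^ s ∂μ = ∫⁻ x, ENNReal.ofReal ((f x).toReal ^ s) ∂μ := by
    refine lintegral_congr fun x => ?_
    rw [← ENNReal.ofReal_rpow_of_nonneg ENNReal.toReal_nonneg hs.le, ENNReal.ofReal_toReal (hft x)]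
  rw [h1, h]
  congr 1
  refine setLIntegral_congr_fun measurableSet_Ioi fun t ht => ?_
  congr 2
  ext x
  exact (ENNReal.ofReal_lt_iff_lt_toReal (le_of_lt ht) (hft x)).symm

theorem lintegral_mono_of_measure_Ici_le {κ ν : Measure ℝ} (h : ∀ t, κ (Ici t) ≤ ν (Ici t))
    {g : ℝ → ℝ≥0∞} (hg : Monotone g) : ∫⁻ x, g x ∂κ ≤ ∫⁻ x, g x ∂ν := by
  have hS : ∀ S : Set ℝ, IsUpperSet S → κ S ≤ ν S := fun S hS => by
    rw [measure_eq_iSup_Ici_of_isUpperSet κ hS, measure_eq_iSup_Ici_of_isUpperSet ν hS]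
    exact iSup₂_mono fun t _ => h t
  have key : ∀ n : ℕ, ∫⁻ x, min (g x) n ∂κ ≤ ∫⁻ x, min (g x) n ∂ν := by
    intro n
    have hm : Monotone fun x => min (g x) n := fun x y hxy => min_le_min_right _ (hg hxy)
    have hft : ∀ x, min (g x) (n : ℝ≥0∞) ≠ ⊤ := fun x => by simp
    have e1 := lintegral_rpow_eq_lintegral_meas_lt κ hm.measurable hft one_pos
    have e2 := lintegral_rpow_eq_lintegral_meas_lt ν hm.measurable hft one_pos
    simp only [ENNReal.rpow_one] at e1 e2
    rw [e1, e2]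
    refine mul_le_mul_right (lintegral_mono fun t => mul_le_mul_left ?_ _) _
    exact hS _ fun x y hxy hx => lt_of_lt_of_le hx (hm hxy)
  have hsup : ∀ x, g x = ⨆ n : ℕ, min (g x) n := by
    intro x
    rw [← inf_iSup_eq (g x) (fun n : ℕ => (n : ℝ≥0∞)), ENNReal.iSup_natCast, inf_top_eq]
  have hint : ∀ κ : Measure ℝ, ∫⁻ x, g x ∂κ = ⨆ n : ℕ, ∫⁻ x, min (g x) n ∂κ := by
    intro κ
    rw [← lintegral_iSup]
    · exact lintegral_congr hsup
    · exact fun n => hg.measurable.min measurable_const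
    · exact fun n m hnm x => min_le_min_left _ (by exact_mod_cast hnm)
  rw [hint κ, hint ν]
  exact iSup_mono key

/-- The least non-decreasing majorant of the ratio of the tails of two measures. -/
def tailRatioSup (μ ν : Measure ℝ) (t : ℝ) : ℝ≥0∞ := ⨆ s ∈ Iic t, μ (Ici s) / ν (Ici s)

theorem tailRatioSup_mono (μ ν : Measure ℝ) : Monotone (tailRatioSup μ ν) :=
  fun _ _ h => biSup_mono fun _ hs => le_trans hs h

theorem le_tailRatioSup (μ ν : Measure ℝ) (t : ℝ) :
    μ (Ici t) / ν (Ici t) ≤ tailRatioSup μ ν t :=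
  le_biSup (fun s => μ (Ici s) / ν (Ici s)) (mem_Iic.2 le_rfl)

theorem isUpperSet_lt_tailRatioSup (μ ν : Measure ℝ) (l : ℝ≥0∞) :
    IsUpperSet {t | l < tailRatioSup μ ν t} :=
  fun _ _ h hx => lt_of_lt_of_le hx (tailRatioSup_mono μ ν h)

theorem measure_lt_tailRatioSup_eq (μ ν κ : Measure ℝ) (l : ℝ≥0∞) :
    κ {t | l < tailRatioSup μ ν t} = ⨆ s ∈ {s | l < μ (Ici s) / ν (Ici s)}, κ (Ici s) := by
  apply le_antisymm
  · rw [measure_eq_iSup_Ici_of_isUpperSet κ (isUpperSet_lt_tailRatioSup μ ν l)]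
    refine iSup₂_le fun t ht => ?_
    simp only [mem_ofPred_eq, tailRatioSup, lt_iSup_iff, mem_Iic] at ht
    obtain ⟨s, hst, hs⟩ := ht
    exact (measure_mono (Ici_subset_Ici.2 hst)).trans
      (le_biSup (fun s => κ (Ici s)) (show s ∈ {s | l < μ (Ici s) / ν (Ici s)} from hs))
  · exact iSup₂_le fun s hs => measure_mono fun t ht =>
      lt_of_lt_of_le hs ((le_tailRatioSup μ ν s).trans (tailRatioSup_mono μ ν ht))

theorem measure_lt_tailRatioSup_le (μ ν : Measure ℝ) [IsFiniteMeasure μ] (l : ℝ≥0∞) :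
    μ {t | l < tailRatioSup μ ν t} ≤ 2 * μ {t | l < 2 * (μ (Ici t) / ν (Ici t))} := by
  rw [measure_lt_tailRatioSup_eq]
  refine iSup₂_le fun s hs => (measure_Ici_le_two_mul μ s).trans ?_
  gcongr
  rename_i t
  intro ht
  refine lt_of_lt_of_le hs ?_
  calc μ (Ici s) / ν (Ici s) ≤ 2 * (μ (Ici s) / 2) / ν (Ici s) := by
        rw [ENNReal.mul_div_cancel (by simp) (by simp)]
    _ ≤ 2 * μ (Ici t) / ν (Ici t) := by
        gcongr
        · exact ht.2
        · exact ht.1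
    _ = _ := by rw [mul_div_assoc]

theorem mul_measure_lt_tailRatioSup_le (μ ν : Measure ℝ) (l : ℝ≥0∞) :
    l * ν {t | l < tailRatioSup μ ν t} ≤ μ {t | l < tailRatioSup μ ν t} := by
  rw [measure_lt_tailRatioSup_eq, measure_lt_tailRatioSup_eq, ENNReal.mul_iSup]
  refine iSup_mono fun s => ?_
  rw [ENNReal.mul_iSup]
  refine iSup_mono fun hs => ?_
  exact ENNReal.mul_le_of_le_div (le_of_lt hs)

theorem lintegral_rpow_tailRatioSup_le (μ ν : Measure ℝ) [IsFiniteMeasure μ]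
    (hK : ∀ t, tailRatioSup μ ν t ≠ ⊤) {β : ℝ} (hβ : 0 < β) :
    ∫⁻ t, tailRatioSup μ ν t ^ β ∂μ ≤
      2 ^ (β + 1) * ∫⁻ t, (μ (Ici t) / ν (Ici t)) ^ β ∂μ := by
  have hRm : Measurable fun t => 2 * (μ (Ici t) / ν (Ici t)) :=
    ((measurable_measure_Ici μ).div (measurable_measure_Ici ν)).const_mul 2
  have hRt : ∀ t, 2 * (μ (Ici t) / ν (Ici t)) ≠ ⊤ := fun t =>
    ENNReal.mul_ne_top (by simp) (ne_top_of_le_ne_top (hK t) (le_tailRatioSup μ ν t))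
  calc ∫⁻ t, tailRatioSup μ ν t ^ β ∂μ
      ≤ 2 * ∫⁻ t, (2 * (μ (Ici t) / ν (Ici t))) ^ β ∂μ := by
        rw [lintegral_rpow_eq_lintegral_meas_lt μ (tailRatioSup_mono μ ν).measurable hK hβ,
          lintegral_rpow_eq_lintegral_meas_lt μ hRm hRt hβ, mul_left_comm,
          ← lintegral_const_mul' 2 _ (by simp)]
        refine mul_le_mul_right (lintegral_mono fun t => ?_) _
        rw [← mul_assoc]
        exact mul_le_mul_left (measure_lt_tailRatioSup_le μ ν _) _
    _ = _ := by
        simp_rw [ENNReal.mul_rpow_of_nonneg _ _ hβ.le]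
        rw [lintegral_const_mul' _ _ (by simp), ← mul_assoc,
          ENNReal.rpow_add_of_nonneg _ _ hβ.le zero_le_one, ENNReal.rpow_one, mul_comm (2 ^ β)]

theorem lintegral_rpow_add_one_tailRatioSup_le (μ ν : Measure ℝ)
    (hK : ∀ t, tailRatioSup μ ν t ≠ ⊤) {β : ℝ} (hβ : 0 < β) :
    ∫⁻ t, tailRatioSup μ ν t ^ (β + 1) ∂ν ≤
      ENNReal.ofReal ((β + 1) / β) * ∫⁻ t, tailRatioSup μ ν t ^ β ∂μ := by
  have hm := (tailRatioSup_mono μ ν).measurable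
  rw [lintegral_rpow_eq_lintegral_meas_lt μ hm hK hβ,
    lintegral_rpow_eq_lintegral_meas_lt ν hm hK (by positivity : 0 < β + 1), ← mul_assoc,
    ← ENNReal.ofReal_mul (by positivity), div_mul_cancel₀ _ hβ.ne']
  refine mul_le_mul_right ?_ _
  refine setLIntegral_mono' measurableSet_Ioi fun t (ht : 0 < t) => ?_
  have : t ^ (β + 1 - 1) = t * t ^ (β - 1) := by
    rw [← Real.rpow_one_add' ht.le (by linarith)]; congr 1; ring
  rw [this, ENNReal.ofReal_mul ht.le, ← mul_assoc, mul_comm (ν _)]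
  gcongr
  exact mul_measure_lt_tailRatioSup_le μ ν _

theorem lintegral_rpow_le_tailRatioSup {p q : ℝ} (hq : 0 < q) (hqp : q < p) (μ ν : Measure ℝ)
    [IsFiniteMeasure μ] (hK : ∀ t, tailRatioSup μ ν t ≠ ⊤) (hν : ∀ᵐ t ∂μ, ν (Ici t) ≠ ⊤)
    {g : ℝ → ℝ≥0∞} (hg : Monotone g) :
    ∫⁻ t, g t ^ q ∂μ ≤ (∫⁻ t, tailRatioSup μ ν t ^ (q / (p - q)) ∂μ) ^ ((p - q) / p) *
      (∫⁻ t, g t ^ p ∂ν) ^ (q / p) := by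
  have hp : 0 < p := hq.trans hqp
  have hpq : 0 < p - q := sub_pos.2 hqp
  set K := tailRatioSup μ ν with hKdef
  have hKm : Measurable K := (tailRatioSup_mono μ ν).measurable
  have hK0 : ∀ᵐ t ∂μ, K t ≠ 0 := by
    have h0 : ∀ᵐ t ∂μ, μ (Ici t) ≠ 0 := by
      have hup : IsUpperSet {t | μ (Ici t) = 0} := fun x y hxy hx =>
        le_antisymm ((measure_mono (Ici_subset_Ici.2 hxy)).trans (le_of_eq hx)) zero_le
      rw [ae_iff]
      simp only [ne_eq, not_not]
      rw [measure_eq_iSup_Ici_of_isUpperSet μ hup]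
      simp
    filter_upwards [h0, hν] with t h1 h2 h3
    have := le_tailRatioSup μ ν t
    rw [← hKdef, h3, nonpos_iff_eq_zero, ENNReal.div_eq_zero_iff] at this
    tauto
  have hcomp : ∫⁻ t, g t ^ p * (K t)⁻¹ ∂μ ≤ ∫⁻ t, g t ^ p ∂ν := by
    have hgp : Monotone fun t => g t ^ p := fun x y h => ENNReal.rpow_le_rpow (hg h) hp.le
    have e : ∫⁻ t, g t ^ p * (K t)⁻¹ ∂μ = ∫⁻ t, g t ^ p ∂(μ.withDensity fun t => (K t)⁻¹) := by
      rw [lintegral_withDensity_eq_lintegral_mul _ (f := fun t => (K t)⁻¹) hKm.inv hgp.measurable]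
      exact lintegral_congr fun t => mul_comm _ _
    rw [e]
    refine lintegral_mono_of_measure_Ici_le (fun t => ?_) hgp
    rw [withDensity_apply _ measurableSet_Ici]
    calc ∫⁻ s in Ici t, (K s)⁻¹ ∂μ ≤ ∫⁻ _ in Ici t, (K t)⁻¹ ∂μ :=
          setLIntegral_mono' measurableSet_Ici fun s hs =>
            ENNReal.inv_le_inv.2 (tailRatioSup_mono μ ν hs)
      _ = (K t)⁻¹ * μ (Ici t) := by simp
      _ ≤ (μ (Ici t) / ν (Ici t))⁻¹ * μ (Ici t) := by
          gcongr; exact le_tailRatioSup μ ν t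
      _ ≤ ν (Ici t) := by
          by_cases h0 : μ (Ici t) = 0
          · simp [h0]
          rw [ENNReal.inv_div (Or.inr (measure_ne_top _ _)) (Or.inr h0),
            ENNReal.div_mul_cancel h0 (measure_ne_top _ _)]
  have hc : (p / (p - q)).HolderConjugate (p / q) := by
    rw [Real.holderConjugate_iff]
    refine ⟨by rw [lt_div_iff₀ hpq]; linarith, ?_⟩
    field_simp
    ring
  have hol := ENNReal.lintegral_mul_le_Lp_mul_Lq μ hc
    (f := fun t => K t ^ (q / p)) (g := fun t => g t ^ q * K t ^ (-(q / p)))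
    (hKm.pow_const _).aemeasurable
    ((hg.measurable.pow_const _).mul (hKm.pow_const _)).aemeasurable
  have eL : ∫⁻ t, g t ^ q ∂μ = ∫⁻ t, ((fun t => K t ^ (q / p)) *
      fun t => g t ^ q * K t ^ (-(q / p))) t ∂μ := by
    refine lintegral_congr_ae ?_
    filter_upwards [hK0] with t ht
    simp only [Pi.mul_apply]
    rw [mul_left_comm, ← ENNReal.rpow_add _ _ ht (hK t), add_neg_cancel, ENNReal.rpow_zero, mul_one]
  rw [eL]
  refine hol.trans ?_
  have e1 : ∀ t, (K t ^ (q / p)) ^ (p / (p - q)) = K t ^ (q / (p - q)) := fun t => by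
    rw [← ENNReal.rpow_mul]; congr 1; field_simp
  have e2 : ∀ t, (g t ^ q * K t ^ (-(q / p))) ^ (p / q) = g t ^ p * (K t)⁻¹ := fun t => by
    rw [ENNReal.mul_rpow_of_nonneg _ _ (by positivity), ← ENNReal.rpow_mul, ← ENNReal.rpow_mul,
      ← ENNReal.rpow_neg_one]
    congr 2 <;> field_simp
  simp only [e1, e2, one_div_div]
  gcongr

theorem lintegral_rpow_tailRatioSup_le_of_embedding {p q : ℝ} (hq : 0 < q) (hqp : q < p)
    (μ ν : Measure ℝ) (hK : ∀ t, tailRatioSup μ ν t ≠ ⊤)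
    (hfin : ∫⁻ t, tailRatioSup μ ν t ^ (q / (p - q)) ∂μ ≠ ⊤) {L : ℝ≥0∞}
    (h : ∀ f : ℝ → ℝ≥0∞, Monotone f → ∫⁻ t, f t ^ q ∂μ ≤ L * (∫⁻ t, f t ^ p ∂ν) ^ (q / p)) :
    ∫⁻ t, tailRatioSup μ ν t ^ (q / (p - q)) ∂μ ≤
      ENNReal.ofReal (p / q) ^ (q / (p - q)) * L ^ (p / (p - q)) := by
  have hp : 0 < p := hq.trans hqp
  have hpq : 0 < p - q := sub_pos.2 hqp
  set X := ∫⁻ t, tailRatioSup μ ν t ^ (q / (p - q)) ∂μ with hX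
  have h1 := h (fun t => tailRatioSup μ ν t ^ (1 / (p - q)))
    fun x y hxy => ENNReal.rpow_le_rpow (tailRatioSup_mono μ ν hxy) (by positivity)
  have h2 := lintegral_rpow_add_one_tailRatioSup_le μ ν hK (β := q / (p - q)) (by positivity)
  have e1 : ∀ t, (tailRatioSup μ ν t ^ (1 / (p - q))) ^ q = tailRatioSup μ ν t ^ (q / (p - q)) :=
    fun t => by rw [← ENNReal.rpow_mul]; congr 1; field_simp
  have e2 : ∀ t, (tailRatioSup μ ν t ^ (1 / (p - q))) ^ p =
      tailRatioSup μ ν t ^ (q / (p - q) + 1) :=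
    fun t => by rw [← ENNReal.rpow_mul]; congr 1; field_simp; ring
  have e3 : (q / (p - q) + 1) / (q / (p - q)) = p / q := by field_simp; ring
  simp only [e1, e2] at h1
  rw [e3] at h2
  have h3 : X ≤ L * (ENNReal.ofReal (p / q) * X) ^ (q / p) :=
    h1.trans (by gcongr)
  by_cases hX0 : X = 0
  · rw [hX0]; exact zero_le
  rw [ENNReal.mul_rpow_of_nonneg _ _ (by positivity), ← mul_assoc] at h3
  have h4 : X ^ ((p - q) / p) ≤ L * ENNReal.ofReal (p / q) ^ (q / p) := by
    have e4 : X = X ^ ((p - q) / p) * X ^ (q / p) := by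
      rw [← ENNReal.rpow_add _ _ hX0 hfin, ← add_div, sub_add_cancel, div_self hp.ne',
        ENNReal.rpow_one]
    have h5 : X ^ ((p - q) / p) * X ^ (q / p) ≤
        L * ENNReal.ofReal (p / q) ^ (q / p) * X ^ (q / p) := e4 ▸ h3
    exact (ENNReal.mul_le_mul_iff_left (by simp [hX0, hfin]) (by simp [hX0, hfin])).1 h5
  calc X = (X ^ ((p - q) / p)) ^ (p / (p - q)) := by
        rw [← ENNReal.rpow_mul]; field_simp; simp
    _ ≤ (L * ENNReal.ofReal (p / q) ^ (q / p)) ^ (p / (p - q)) := by gcongr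
    _ = _ := by
        rw [ENNReal.mul_rpow_of_nonneg _ _ (by positivity), ← ENNReal.rpow_mul, mul_comm]
        congr 2; field_simp

theorem ENNReal.add_rpow_le_two_rpow_mul (x y : ℝ≥0∞) {s : ℝ} (hs : 0 ≤ s) :
    (x + y) ^ s ≤ 2 ^ s * (x ^ s + y ^ s) := by
  wlog h : x ≤ y generalizing x y
  · rw [add_comm x, add_comm (x ^ s)]
    exact this y x (le_of_not_ge h)
  calc (x + y) ^ s ≤ (2 * y) ^ s := by
        gcongr; rw [two_mul]; gcongr
    _ = 2 ^ s * y ^ s := ENNReal.mul_rpow_of_nonneg _ _ hs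
    _ ≤ _ := by gcongr; exact le_add_self

theorem ENNReal.tsum_mul_le_rpow_mul_rpow (a b : ℕ → ℝ≥0∞) {p q : ℝ}
    (hpq : p.HolderConjugate q) :
    ∑' k, a k * b k ≤ (∑' k, a k ^ p) ^ (1 / p) * (∑' k, b k ^ q) ^ (1 / q) := by
  have h := ENNReal.lintegral_mul_le_Lp_mul_Lq (Measure.count : Measure ℕ) hpq
    (f := a) (g := b) (measurable_of_countable a).aemeasurable
    (measurable_of_countable b).aemeasurable
  simpa [lintegral_count] using h

theorem tsum_setLIntegral_le {α : Type*} [MeasurableSpace α] (μ : Measure α) {J : ℕ → Set α}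
    (hJm : ∀ k, MeasurableSet (J k)) (hJ : Pairwise (Function.onFun Disjoint J))
    (φ : α → ℝ≥0∞) : ∑' k, ∫⁻ x in J k, φ x ∂μ ≤ ∫⁻ x, φ x ∂μ := by
  rw [← lintegral_iUnion hJm hJ]
  exact setLIntegral_le_lintegral _ _

theorem exists_measure_Iio_eq (κ : Measure ℝ) [IsFiniteMeasure κ] [NullSingletonClass κ]
    {c : ℝ≥0∞} (hc0 : 0 < c) (hc : c < κ univ) : ∃ y, κ (Iio y) = c := by
  set S : Set ℝ := {x | κ (Iio x) ≤ c} with hS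
  have hne : S.Nonempty := by
    have h := tendsto_measure_iInter_atTop (μ := κ) (s := fun n : ℕ => Iio (-(n : ℝ)))
      (fun n => measurableSet_Iio.nullMeasurableSet)
      (fun m n h => Iio_subset_Iio (by simpa using h)) ⟨0, measure_ne_top _ _⟩
    have he : ⋂ n : ℕ, Iio (-(n : ℝ)) = ∅ := by
      ext x
      simp only [mem_iInter, mem_Iio, mem_empty_iff_false, iff_false, not_forall, not_lt]
      obtain ⟨n, hn⟩ := exists_nat_ge (-x)
      exact ⟨n, by linarith⟩
    rw [he, measure_empty] at h
    obtain ⟨n, hn⟩ := (h.eventually (gt_mem_nhds hc0)).exists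
    exact ⟨_, le_of_lt hn⟩
  have hbdd : BddAbove S := by
    have h := tendsto_measure_iUnion_atTop (μ := κ) (s := fun n : ℕ => Iio (n : ℝ))
      (fun m n h => Iio_subset_Iio (by simpa using h))
    have he : ⋃ n : ℕ, Iio (n : ℝ) = univ := by
      ext x
      simpa using exists_nat_gt x
    rw [he] at h
    obtain ⟨n, hn⟩ := (h.eventually (lt_mem_nhds hc)).exists
    refine ⟨n, fun x hx => ?_⟩
    by_contra hcon
    exact absurd ((measure_mono (Iio_subset_Iio (le_of_not_ge hcon))).trans hx) (not_le.2 hn)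
  refine ⟨sSup S, le_antisymm ?_ ?_⟩
  · have h := tendsto_measure_iUnion_atTop (μ := κ)
      (s := fun n : ℕ => Iio (sSup S - 1 / ((n : ℝ) + 1)))
      (fun m n h => Iio_subset_Iio (by gcongr))
    have he : ⋃ n : ℕ, Iio (sSup S - 1 / ((n : ℝ) + 1)) = Iio (sSup S) := by
      ext x
      simp only [mem_iUnion, mem_Iio]
      constructor
      · rintro ⟨n, hn⟩
        have : 0 < 1 / ((n : ℝ) + 1) := by positivity
        linarith
      · intro hx
        obtain ⟨n, hn⟩ := exists_nat_one_div_lt (sub_pos.2 hx)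
        exact ⟨n, by linarith⟩
    rw [he] at h
    refine le_of_tendsto' h fun n => ?_
    have hn : 0 < 1 / ((n : ℝ) + 1) := by positivity
    obtain ⟨x, hx, hlt⟩ := exists_lt_of_lt_csSup hne (show sSup S - 1 / ((n : ℝ) + 1) < sSup S by
      linarith)
    exact (measure_mono (Iio_subset_Iio hlt.le)).trans hx
  · have h := tendsto_measure_iInter_atTop (μ := κ)
      (s := fun n : ℕ => Iio (sSup S + 1 / ((n : ℝ) + 1)))
      (fun n => measurableSet_Iio.nullMeasurableSet)
      (fun m n h => Iio_subset_Iio (by gcongr)) ⟨0, measure_ne_top _ _⟩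
    have he : ⋂ n : ℕ, Iio (sSup S + 1 / ((n : ℝ) + 1)) = Iic (sSup S) := by
      ext x
      simp only [mem_iInter, mem_Iio, mem_Iic]
      constructor
      · intro hx
        by_contra hcon
        obtain ⟨n, hn⟩ := exists_nat_one_div_lt (sub_pos.2 (not_le.1 hcon))
        linarith [hx n]
      · intro hx n
        have : 0 < 1 / ((n : ℝ) + 1) := by positivity
        linarith
    rw [he] at h
    rw [measure_congr (Iio_ae_eq_Iic (μ := κ))]
    refine ge_of_tendsto' h fun n => ?_
    have hn : 0 < 1 / ((n : ℝ) + 1) := by positivity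
    by_contra hcon
    have : sSup S + 1 / ((n : ℝ) + 1) ≤ sSup S := le_csSup hbdd (le_of_not_ge hcon)
    linarith

theorem exists_seq_measure_Iio_eq (κ : Measure ℝ) [IsFiniteMeasure κ] [NullSingletonClass κ]
    (h0 : κ univ ≠ 0) : ∃ y : ℕ → ℝ, StrictAnti y ∧
      ∀ k, κ (Iio (y k)) = κ univ * 2⁻¹ ^ (k + 1) := by
  have hpos : ∀ k : ℕ, (2⁻¹ : ℝ≥0∞) ^ k ≠ 0 := fun k => pow_ne_zero _ (by simp)
  have hlt : ∀ k : ℕ, κ univ * 2⁻¹ ^ (k + 1) < κ univ * 2⁻¹ ^ k := fun k => by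
    refine ENNReal.mul_lt_mul_right h0 (measure_ne_top _ _) ?_
    rw [pow_succ]
    calc (2⁻¹ : ℝ≥0∞) ^ k * 2⁻¹ < 2⁻¹ ^ k * 1 :=
          ENNReal.mul_lt_mul_right (hpos k) (by finiteness) (by simp)
      _ = _ := mul_one _
  have hanti : StrictAnti fun k : ℕ => κ univ * 2⁻¹ ^ k := strictAnti_nat_of_succ_lt hlt
  have : ∀ k : ℕ, ∃ y, κ (Iio y) = κ univ * 2⁻¹ ^ (k + 1) := fun k => by
    refine exists_measure_Iio_eq κ (pos_iff_ne_zero.2 (mul_ne_zero h0 (hpos _))) ?_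
    simpa using hanti (Nat.succ_pos k)
  choose y hy using this
  refine ⟨y, strictAnti_nat_of_succ_lt fun k => ?_, hy⟩
  by_contra hcon
  have h1 := measure_mono (μ := κ) (Iio_subset_Iio (not_lt.1 hcon))
  rw [hy, hy] at h1
  exact absurd (hlt (k + 1)) (not_lt.2 h1)

theorem exists_seq_measure_Ici_eq (κ : Measure ℝ) [IsFiniteMeasure κ] [NullSingletonClass κ]
    (h0 : κ univ ≠ 0) : ∃ x : ℕ → ℝ, StrictMono x ∧
      ∀ k, κ (Ici (x k)) = κ univ * 2⁻¹ ^ (k + 1) := by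
  have : NullSingletonClass (κ.map Neg.neg) := ⟨fun x => by
    rw [Measure.map_apply measurable_neg (measurableSet_singleton x)]
    simp⟩
  have hu : κ.map Neg.neg univ = κ univ := by
    rw [Measure.map_apply measurable_neg MeasurableSet.univ, preimage_univ]
  obtain ⟨y, hy, h⟩ := exists_seq_measure_Iio_eq (κ.map Neg.neg) (by rwa [hu])
  refine ⟨fun k => -y k, fun i j hij => neg_lt_neg (hy hij), fun k => ?_⟩
  have h1 := h k
  rw [hu, Measure.map_apply measurable_neg measurableSet_Iio] at h1
  rw [← h1, neg_preimage, neg_Iio]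
  exact measure_congr Ioi_ae_eq_Ici.symm

/-- The energy `∫ (ρ [t, ∞) / ν [t, ∞)) ^ β dρ(t)` of `ρ` relative to the tails of `ν`. -/
def tailEnergy (β : ℝ) (ρ ν : Measure ℝ) : ℝ≥0∞ := ∫⁻ t, (ρ (Ici t) / ν (Ici t)) ^ β ∂ρ

theorem tailEnergy_mono {β : ℝ} (hβ : 0 ≤ β) {ρ ρ' : Measure ℝ} (h : ρ ≤ ρ') (ν : Measure ℝ) :
    tailEnergy β ρ ν ≤ tailEnergy β ρ' ν :=
  lintegral_mono' h fun _ => ENNReal.rpow_le_rpow (ENNReal.div_le_div_right (h _) _) hβ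

/-- The tails of `ν` are at least `δ` wherever the tails of `ρ` do not vanish. -/
def TailLower (δ : ℝ≥0∞) (ρ ν : Measure ℝ) : Prop := ∀ t, ρ (Ici t) ≠ 0 → δ ≤ ν (Ici t)

theorem TailLower.mono {δ : ℝ≥0∞} {ρ ρ' ν : Measure ℝ} (h : TailLower δ ρ ν) (hρ : ρ' ≤ ρ) :
    TailLower δ ρ' ν :=
  fun t ht => h t fun h0 => ht (le_antisymm ((hρ _).trans h0.le) zero_le)

theorem TailLower.div_le {δ : ℝ≥0∞} {ρ ν : Measure ℝ} (h : TailLower δ ρ ν) (t : ℝ) :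
    ρ (Ici t) / ν (Ici t) ≤ ρ univ / δ := by
  by_cases h0 : ρ (Ici t) = 0
  · simp [h0]
  · exact ENNReal.div_le_div (measure_mono (subset_univ _)) (h t h0)

theorem TailLower.tailRatioSup_ne_top {δ : ℝ≥0∞} (hδ : δ ≠ 0) {ρ ν : Measure ℝ}
    [IsFiniteMeasure ρ] (h : TailLower δ ρ ν) (t : ℝ) : tailRatioSup ρ ν t ≠ ⊤ :=
  ne_top_of_le_ne_top (ENNReal.div_ne_top (measure_ne_top ρ univ) hδ)
    (iSup₂_le fun s _ => h.div_le s)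

theorem lintegral_rpow_le_tailEnergy {p q : ℝ} (hq : 0 < q) (hqp : q < p) {δ : ℝ≥0∞}
    (hδ : δ ≠ 0) {ρ ν : Measure ℝ} [IsFiniteMeasure ρ] (h : TailLower δ ρ ν)
    (hν : ∀ᵐ t ∂ρ, ν (Ici t) ≠ ⊤) {g : ℝ → ℝ≥0∞} (hg : Monotone g) :
    ∫⁻ t, g t ^ q ∂ρ ≤ 2 * tailEnergy (q / (p - q)) ρ ν ^ ((p - q) / p) *
      (∫⁻ t, g t ^ p ∂ν) ^ (q / p) := by
  have hp : 0 < p := hq.trans hqp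
  have hpq : 0 < p - q := sub_pos.2 hqp
  have hK := h.tailRatioSup_ne_top hδ
  refine (lintegral_rpow_le_tailRatioSup hq hqp ρ ν hK hν hg).trans ?_
  gcongr
  refine (ENNReal.rpow_le_rpow
    (lintegral_rpow_tailRatioSup_le ρ ν hK (div_pos hq hpq)) (by positivity)).trans ?_
  rw [ENNReal.mul_rpow_of_nonneg _ _ (by positivity), ← ENNReal.rpow_mul]
  have : (q / (p - q) + 1) * ((p - q) / p) = 1 := by field_simp; ring
  rw [this, ENNReal.rpow_one, tailEnergy]

theorem rpow_measure_Ici_mul_le (ρ ν : Measure ℝ) [IsFiniteMeasure ρ] (s : ℝ) {β : ℝ}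
    (hβ : 0 ≤ β) :
    ρ (Ici s) ^ (β + 1) * ν (Ici s) ^ (-β) ≤ 2 ^ (β + 1) * tailEnergy β ρ ν := by
  calc ρ (Ici s) ^ (β + 1) * ν (Ici s) ^ (-β)
      ≤ 2 ^ (β + 1) * (∫⁻ t in Ici s, ρ (Ici t) ^ β ∂ρ) * ν (Ici s) ^ (-β) := by
        gcongr; exact rpow_measure_Ici_le ρ s hβ
    _ = 2 ^ (β + 1) * ∫⁻ t in Ici s, ρ (Ici t) ^ β * ν (Ici s) ^ (-β) ∂ρ := by
        rw [lintegral_mul_const _ ((measurable_measure_Ici ρ).pow_const _), mul_assoc]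
    _ ≤ 2 ^ (β + 1) * ∫⁻ t in Ici s, (ρ (Ici t) / ν (Ici t)) ^ β ∂ρ := by
        refine mul_le_mul_right (setLIntegral_mono' measurableSet_Ici fun t ht => ?_) _
        rw [ENNReal.div_rpow_of_nonneg _ _ hβ, div_eq_mul_inv, ENNReal.rpow_neg]
        gcongr
        exact ht
    _ ≤ _ := mul_le_mul_right (setLIntegral_le_lintegral _ _) _

theorem rpow_measure_Ici_mul_le_tailEnergy_rpow {p q : ℝ} (hq : 0 < q) (hqp : q < p)
    (hp1 : 1 < p) (ρ ν : Measure ℝ) [IsFiniteMeasure ρ] (s : ℝ) :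
    ρ (Ici s) ^ (q * (q / (p - q) + 1)) * ν (Ici s) ^ (-(q / (p - q))) ≤
      2 ^ (q * (q / (p - q) + 1)) *
        tailEnergy (1 / (p - 1)) ρ ν ^ (q * (p - 1) / (p - q)) := by
  have hp : 0 < p - 1 := sub_pos.2 hp1
  have hpq : 0 < p - q := sub_pos.2 hqp
  have h := ENNReal.rpow_le_rpow (rpow_measure_Ici_mul_le ρ ν s (one_div_pos.2 hp).le)
    (by positivity : 0 ≤ q * (p - 1) / (p - q))
  have e1 : (1 / (p - 1) + 1) * (q * (p - 1) / (p - q)) = q * (q / (p - q) + 1) := by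
    field_simp; ring
  have e2 : -(1 / (p - 1)) * (q * (p - 1) / (p - q)) = -(q / (p - q)) := by field_simp
  rw [ENNReal.mul_rpow_of_nonneg _ _ (by positivity),
    ENNReal.mul_rpow_of_nonneg _ _ (by positivity),
    ← ENNReal.rpow_mul, ← ENNReal.rpow_mul, ← ENNReal.rpow_mul, e1, e2] at h
  exact h

/-- A dyadic decomposition of the line along the levels of a finite measure. -/
theorem exists_seq_lintegral_rpow_measure_Iio_le (κ : Measure ℝ) [IsFiniteMeasure κ]
    [NullSingletonClass κ] (h0 : κ univ ≠ 0) :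
    ∃ y : ℕ → ℝ, StrictAnti y ∧ (∀ k, 0 < κ (Iio (y k))) ∧ ∀ (ω : Measure ℝ) {q : ℝ}, 0 < q →
      ∫⁻ x, κ (Iio x) ^ q ∂ω ≤ 4 ^ q * ∑' k, κ (Ico (y (k + 1)) (y k)) ^ q *
        ω (disjointed (fun k => Ici (y k)) k) := by
  obtain ⟨y, hy, h⟩ := exists_seq_measure_Iio_eq κ h0
  set Z := κ univ with hZ
  have hZt : Z ≠ ⊤ := measure_ne_top _ _
  have hpos : ∀ k : ℕ, (2⁻¹ : ℝ≥0∞) ^ k ≠ 0 := fun k => pow_ne_zero _ (by simp)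
  refine ⟨y, hy, fun k => by rw [h]; exact pos_iff_ne_zero.2 (mul_ne_zero h0 (hpos _)), ?_⟩
  intro ω q hq
  set J := disjointed fun k => Ici (y k) with hJ
  have hJm : ∀ k, MeasurableSet (J k) := MeasurableSet.disjointed fun _ => measurableSet_Ici
  have hJd : Pairwise (Function.onFun Disjoint J) := disjoint_disjointed _
  have hL : ∀ k, κ (Ico (y (k + 1)) (y k)) = Z * 2⁻¹ ^ (k + 2) := fun k => by
    have e : Ico (y (k + 1)) (y k) = Iio (y k) \ Iio (y (k + 1)) := by
      ext x; simp [and_comm]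
    rw [e, measure_sdiff (Iio_subset_Iio (hy (Nat.lt_succ_self k)).le)
      measurableSet_Iio.nullMeasurableSet (measure_ne_top _ _), h, h]
    have e2 : Z * 2⁻¹ ^ (k + 1) = Z * 2⁻¹ ^ (k + 2) + Z * 2⁻¹ ^ (k + 2) := by
      rw [← mul_add, ← mul_two, pow_succ (2⁻¹ : ℝ≥0∞) (k + 1), mul_assoc,
        ENNReal.inv_mul_cancel (by simp) (by simp), mul_one]
    rw [e2, ENNReal.add_sub_cancel_right]
    finiteness
  have hJle : ∀ k, ∀ x ∈ J k, κ (Iio x) ≤ 4 * κ (Ico (y (k + 1)) (y k)) := by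
    intro k x hx
    have e4 : 4 * κ (Ico (y (k + 1)) (y k)) = Z * 2⁻¹ ^ k := by
      have h4 : (4 : ℝ≥0∞) * 2⁻¹ ^ 2 = 1 := by
        rw [← ENNReal.inv_pow, show (2 : ℝ≥0∞) ^ 2 = 4 by norm_num]
        exact ENNReal.mul_inv_cancel (by simp) (by simp)
      calc 4 * κ (Ico (y (k + 1)) (y k)) = Z * 2⁻¹ ^ k * (4 * 2⁻¹ ^ 2) := by
            rw [hL, pow_add]; ring
        _ = _ := by rw [h4, mul_one]
    rw [e4]
    cases k with
    | zero => simpa using measure_mono (subset_univ _)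
    | succ k =>
      rw [← h k]
      refine measure_mono (Iio_subset_Iio ?_)
      have := hx
      rw [hJ, Monotone.disjointed_add_one
        (fun i j hij => Ici_subset_Ici.2 (hy.antitone hij))] at this
      exact (not_le.1 this.2).le
  have hout : ∀ x, x ∉ ⋃ k, J k → κ (Iio x) = 0 := by
    intro x hx
    rw [hJ, iUnion_disjointed, mem_iUnion] at hx
    push Not at hx
    have hlim : Filter.Tendsto (fun k : ℕ => Z * 2⁻¹ ^ (k + 1)) Filter.atTop (nhds 0) := by
      have := ENNReal.Tendsto.const_mul (a := Z)
        ((ENNReal.tendsto_pow_atTop_nhds_zero_of_lt_one (r := 2⁻¹) (by simp)).comp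
          (Filter.tendsto_add_atTop_nat 1)) (Or.inr hZt)
      simpa using this
    refine le_antisymm (ge_of_tendsto' hlim fun k => ?_) zero_le
    rw [← h k]
    exact measure_mono (Iio_subset_Iio (not_le.1 (hx k)).le)
  rw [← lintegral_add_compl _ (MeasurableSet.iUnion hJm), lintegral_iUnion hJm hJd,
    setLIntegral_congr_fun (g := fun _ => 0) (MeasurableSet.iUnion hJm).compl
      (fun x hx => by simp [hout x hx, hq]), lintegral_zero, add_zero, ← ENNReal.tsum_mul_left]
  refine ENNReal.tsum_le_tsum fun k => ?_
  calc ∫⁻ x in J k, κ (Iio x) ^ q ∂ω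
      ≤ ∫⁻ _ in J k, (4 * κ (Ico (y (k + 1)) (y k))) ^ q ∂ω :=
        setLIntegral_mono' (hJm k) fun x hx => ENNReal.rpow_le_rpow (hJle k x hx) hq.le
    _ = _ := by
        rw [setLIntegral_const, ENNReal.mul_rpow_of_nonneg _ _ hq.le, mul_assoc]

/-- The energy `∫_{[x, ∞)} μ [x, s) ^ q dω(s)`. -/
def gapEnergy (q : ℝ) (μ ω : Measure ℝ) (x : ℝ) : ℝ≥0∞ := ∫⁻ s in Ici x, μ (Ico x s) ^ q ∂ω

/-- The supremum over `t < x` of `μ [t, x) ^ q * ν [t, ∞) ^ (-β)`. -/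
def gapSup (q β : ℝ) (μ ν : Measure ℝ) (x : ℝ) : ℝ≥0∞ :=
  ⨆ t ∈ Iio x, μ (Ico t x) ^ q * ν (Ici t) ^ (-β)

/-- The measure version of the integral defining `CC3`. -/
def gapConst (p q : ℝ) (μ ω ν : Measure ℝ) : ℝ≥0∞ :=
  ∫⁻ x, gapEnergy q μ ω x ^ (q / (p - q)) * gapSup q (q / (p - q)) μ ν x ∂ω

/-- The measure version of the integral defining `CC5`. -/
def tailConst (p q : ℝ) (μ ω ν : Measure ℝ) : ℝ≥0∞ :=
  ∫⁻ x, ω (Ici x) ^ (q / (p - q)) *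
    tailEnergy (1 / (p - 1)) (μ.restrict (Iio x)) ν ^ (q * (p - 1) / (p - q)) ∂ω

theorem tsum_rpow_measure_mul_le (ω : Measure ℝ) [IsFiniteMeasure ω] {J : ℕ → Set ℝ} {y : ℕ → ℝ}
    (hJm : ∀ k, MeasurableSet (J k)) (hJ : Pairwise (Function.onFun Disjoint J))
    (hJy : ∀ k, J k ⊆ Ici (y k)) {β : ℝ} (hβ : 0 ≤ β) {c : ℕ → ℝ≥0∞} {E : ℝ → ℝ≥0∞}
    (hc : ∀ k, ∀ x ∈ J k, c k ≤ E x) :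
    ∑' k, ω (J k) ^ (β + 1) * c k ≤ 2 ^ (β + 1) * ∫⁻ x, ω (Ici x) ^ β * E x ∂ω := by
  calc ∑' k, ω (J k) ^ (β + 1) * c k
      ≤ ∑' k, 2 ^ (β + 1) * ∫⁻ x in J k, ω (Ici x) ^ β * E x ∂ω := by
        refine ENNReal.tsum_le_tsum fun k => ?_
        have h := rpow_measure_Ici_le (ω.restrict (J k)) (y k) hβ
        rw [Measure.restrict_apply measurableSet_Ici, inter_eq_right.2 (hJy k)] at h
        calc ω (J k) ^ (β + 1) * c k
            ≤ 2 ^ (β + 1) * (∫⁻ x in J k, ω (Ici x) ^ β ∂ω) * c k := by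
              refine mul_le_mul_left (h.trans (mul_le_mul_right ?_ _)) _
              refine (setLIntegral_le_lintegral _ _).trans (lintegral_mono fun x => ?_)
              exact ENNReal.rpow_le_rpow (Measure.restrict_apply_le _ _) hβ
          _ = 2 ^ (β + 1) * ∫⁻ x in J k, ω (Ici x) ^ β * c k ∂ω := by
              rw [lintegral_mul_const _ ((measurable_measure_Ici ω).pow_const _), mul_assoc]
          _ ≤ _ := by
              refine mul_le_mul_right (setLIntegral_mono' (hJm k) fun x hx => ?_) _
              exact mul_le_mul_right (hc k x hx) _
    _ = 2 ^ (β + 1) * ∑' k, ∫⁻ x in J k, ω (Ici x) ^ β * E x ∂ω := ENNReal.tsum_mul_left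
    _ ≤ _ := mul_le_mul_right (tsum_setLIntegral_le ω hJm hJ _) _

theorem tsum_tailEnergy_le (p q : ℝ) (hq : 0 < q) (hqp : q < p) (hp1 : 1 < p)
    (μ ω ν : Measure ℝ) [IsFiniteMeasure ω] {y : ℕ → ℝ} :
    ∑' k, ω (disjointed (fun k => Ici (y k)) k) ^ (q / (p - q) + 1) *
        tailEnergy (1 / (p - 1)) (μ.restrict (Ico (y (k + 1)) (y k))) ν ^
          (q * (p - 1) / (p - q)) ≤
      2 ^ (q / (p - q) + 1) * tailConst p q μ ω ν := by
  have hp : 0 < p - 1 := sub_pos.2 hp1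
  have hpq : 0 < p - q := sub_pos.2 hqp
  refine tsum_rpow_measure_mul_le ω (MeasurableSet.disjointed fun _ => measurableSet_Ici)
    (disjoint_disjointed _) (disjointed_subset _) (div_pos hq hpq).le
    fun k x hx => ?_
  have hx' : y k ≤ x := disjointed_subset (fun k => Ici (y k)) k hx
  refine ENNReal.rpow_le_rpow (tailEnergy_mono (one_div_pos.2 hp).le ?_ ν) (by positivity)
  exact Measure.restrict_mono (fun t ht => lt_of_lt_of_le ht.2 hx') le_rfl

theorem sum_min_tsub_add_min_le {α : ℕ → ℝ≥0∞} (hα : Antitone α) (z : ℝ≥0∞) (n : ℕ) :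
    ∑ k ∈ Finset.range n, (min z (α k) - α (k + 1)) + min z (α n) ≤ z := by
  induction n with
  | zero => simp
  | succ n ih =>
    rw [Finset.sum_range_succ, add_assoc]
    refine le_trans (add_le_add_right ?_ _) ih
    rcases le_total (α (n + 1)) z with h | h
    · rw [min_eq_right h, tsub_add_cancel_of_le (le_min h (hα (Nat.le_succ n)))]
    · rw [min_eq_left h, min_eq_left (h.trans (hα (Nat.le_succ n))), tsub_eq_zero_of_le h, zero_add]

theorem tsum_lintegral_min_tsub_rpow_le {p : ℝ} (hp : 1 ≤ p) (ν : Measure ℝ) {f : ℝ → ℝ≥0∞}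
    (hf : Measurable f) {α : ℕ → ℝ≥0∞} (hα : Antitone α) :
    ∑' k, ∫⁻ t, (min (f t) (α k) - α (k + 1)) ^ p ∂ν ≤ ∫⁻ t, f t ^ p ∂ν := by
  have hp0 : 0 < p := by linarith
  rw [← lintegral_tsum fun k =>
    (((hf.min measurable_const).sub_const _).pow_const _).aemeasurable]
  refine lintegral_mono fun t => ENNReal.tsum_le_of_sum_range_le fun n => ?_
  have h : ∀ n : ℕ, ∑ k ∈ Finset.range n, (min (f t) (α k) - α (k + 1)) ^ p ≤
      (∑ k ∈ Finset.range n, (min (f t) (α k) - α (k + 1))) ^ p := fun n => by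
    induction n with
    | zero => simp
    | succ n ih =>
      rw [Finset.sum_range_succ, Finset.sum_range_succ]
      exact (add_le_add_left ih _).trans (ENNReal.add_rpow_le_rpow_add _ _ hp)
  exact (h n).trans (ENNReal.rpow_le_rpow
    (le_self_add.trans (sum_min_tsub_add_min_le hα (f t) n)) hp0.le)

theorem tsum_oscillation_le {p q : ℝ} (hq : 0 < q) (hqp : q < p) (hp1 : 1 < p) {δ : ℝ≥0∞}
    (hδ : δ ≠ 0) {μ ω ν : Measure ℝ} [IsFiniteMeasure μ] [IsFiniteMeasure ω]
    (hμ : TailLower δ μ ν) {y : ℕ → ℝ} (hy : Antitone y) (hν : ∀ k, ν (Ici (y k)) ≠ ⊤)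
    {f : ℝ → ℝ≥0∞} (hf : Monotone f) :
    ∑' k, (∫⁻ t in Ico (y (k + 1)) (y k), (f t - f (y (k + 1))) ∂μ) ^ q *
        ω (disjointed (fun k => Ici (y k)) k) ≤
      2 ^ q * ((2 ^ (q / (p - q) + 1) * tailConst p q μ ω ν) ^ ((p - q) / p) *
        (∫⁻ t, f t ^ p ∂ν) ^ (q / p)) := by
  have hp : 0 < p - 1 := sub_pos.2 hp1
  have hp0 : 0 < p := by linarith
  have hpq : 0 < p - q := sub_pos.2 hqp
  set J := disjointed fun k => Ici (y k) with hJ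
  set d : ℕ → ℝ≥0∞ := fun k =>
    tailEnergy (1 / (p - 1)) (μ.restrict (Ico (y (k + 1)) (y k))) ν with hd
  set G : ℕ → ℝ≥0∞ := fun k => ∫⁻ t, (min (f t) (f (y k)) - f (y (k + 1))) ^ p ∂ν with hG
  have hh : ∀ k, ∫⁻ t in Ico (y (k + 1)) (y k), (f t - f (y (k + 1))) ∂μ ≤
      2 * d k ^ ((p - 1) / p) * G k ^ (1 / p) := fun k => by
    have h1 : ∫⁻ t in Ico (y (k + 1)) (y k), (f t - f (y (k + 1))) ∂μ =
        ∫⁻ t in Ico (y (k + 1)) (y k), (min (f t) (f (y k)) - f (y (k + 1))) ^ (1 : ℝ) ∂μ := by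
      refine setLIntegral_congr_fun measurableSet_Ico fun t ht => ?_
      simp only [ENNReal.rpow_one]
      rw [min_eq_left (hf ht.2.le)]
    rw [h1]
    refine lintegral_rpow_le_tailEnergy one_pos hp1 hδ (hμ.mono Measure.restrict_le_self) ?_
      (g := fun t => min (f t) (f (y k)) - f (y (k + 1)))
      fun s t hst => tsub_le_tsub_right (min_le_min_right _ (hf hst)) _
    refine (ae_restrict_iff' measurableSet_Ico).2 (ae_of_all _ fun t ht => ?_)
    exact ne_top_of_le_ne_top (hν (k + 1)) (measure_mono (Ici_subset_Ici.2 ht.1))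
  have hc : (p / (p - q)).HolderConjugate (p / q) := by
    rw [Real.holderConjugate_iff]
    refine ⟨by rw [lt_div_iff₀ hpq]; linarith, ?_⟩
    field_simp
    ring
  have e1 : ∀ k, (ω (J k) * d k ^ (q * (p - 1) / p)) ^ (p / (p - q)) =
      ω (J k) ^ (q / (p - q) + 1) * d k ^ (q * (p - 1) / (p - q)) := fun k => by
    rw [ENNReal.mul_rpow_of_nonneg _ _ (by positivity), ← ENNReal.rpow_mul]
    congr 2
    · field_simp; ring
    · field_simp
  have e2 : ∀ k, (G k ^ (q / p)) ^ (p / q) = G k := fun k => by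
    rw [← ENNReal.rpow_mul]; field_simp; simp
  calc ∑' k, (∫⁻ t in Ico (y (k + 1)) (y k), (f t - f (y (k + 1))) ∂μ) ^ q * ω (J k)
      ≤ ∑' k, 2 ^ q * ((ω (J k) * d k ^ (q * (p - 1) / p)) * G k ^ (q / p)) := by
        refine ENNReal.tsum_le_tsum fun k => ?_
        refine (mul_le_mul_left (ENNReal.rpow_le_rpow (hh k) hq.le) _).trans (le_of_eq ?_)
        rw [ENNReal.mul_rpow_of_nonneg _ _ hq.le, ENNReal.mul_rpow_of_nonneg _ _ hq.le,
          ← ENNReal.rpow_mul, ← ENNReal.rpow_mul, div_mul_eq_mul_div, div_mul_eq_mul_div, one_mul,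
          mul_comm (p - 1) q]
        ring
    _ = 2 ^ q * ∑' k, (ω (J k) * d k ^ (q * (p - 1) / p)) * G k ^ (q / p) :=
        ENNReal.tsum_mul_left
    _ ≤ 2 ^ q * ((∑' k, ω (J k) ^ (q / (p - q) + 1) * d k ^ (q * (p - 1) / (p - q))) ^
          ((p - q) / p) * (∑' k, G k) ^ (q / p)) := by
        refine mul_le_mul_right ((ENNReal.tsum_mul_le_rpow_mul_rpow _ _ hc).trans (le_of_eq ?_)) _
        simp only [e1, e2, one_div_div]
    _ ≤ _ := by
        gcongr
        · exact tsum_tailEnergy_le p q hq hqp hp1 μ ω ν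
        · exact tsum_lintegral_min_tsub_rpow_le hp1.le ν hf.measurable
            (α := fun k => f (y k)) fun i j hij => hf (hy hij)

theorem lintegral_sum_smul_dirac (m : ℕ → ℝ≥0∞) (y : ℕ → ℝ) (F : ℝ → ℝ≥0∞) :
    ∫⁻ t, F t ∂(Measure.sum fun k => m k • Measure.dirac (y k)) = ∑' k, m k * F (y k) := by
  rw [lintegral_sum_measure]
  simp [lintegral_smul_measure, lintegral_dirac]

theorem tailLower_sum_smul_dirac {δ : ℝ≥0∞} {ν : Measure ℝ} {m : ℕ → ℝ≥0∞} {y : ℕ → ℝ}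
    (h : ∀ k, m k ≠ 0 → δ ≤ ν (Ici (y k))) :
    TailLower δ (Measure.sum fun k => m k • Measure.dirac (y k)) ν := by
  intro t ht
  rw [Measure.sum_apply _ measurableSet_Ici, ne_eq, ENNReal.tsum_eq_zero] at ht
  push Not at ht
  obtain ⟨k, hk⟩ := ht
  simp only [Measure.smul_apply, smul_eq_mul, ne_eq, mul_eq_zero, not_or] at hk
  have hty : t ≤ y k := by
    by_contra hcon
    exact hk.2 (by simp [not_le.1 hcon])
  exact (h k hk.1).trans (measure_mono (Ici_subset_Ici.2 hty))

theorem isFiniteMeasure_sum_smul_dirac {m : ℕ → ℝ≥0∞} (y : ℕ → ℝ) (h : ∑' k, m k ≠ ⊤) :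
    IsFiniteMeasure (Measure.sum fun k => m k • Measure.dirac (y k)) := by
  refine ⟨?_⟩
  have := lintegral_sum_smul_dirac m y 1
  simp only [Pi.one_apply, lintegral_one, mul_one] at this
  rw [this]
  exact h.lt_top

theorem mul_rpow_le_rpow_add_one_add (x y : ℝ≥0∞) {β : ℝ} (hβ : 0 ≤ β) :
    x * y ^ β ≤ y ^ (β + 1) + x ^ (β + 1) := by
  rw [ENNReal.rpow_add_of_nonneg _ _ hβ zero_le_one, ENNReal.rpow_one,
    ENNReal.rpow_add_of_nonneg _ _ hβ zero_le_one, ENNReal.rpow_one]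
  rcases le_total x y with h | h
  · refine le_trans ?_ le_self_add
    rw [mul_comm]; gcongr
  · refine le_trans ?_ le_add_self
    rw [mul_comm]; gcongr

theorem sum_gap_le_gapEnergy {q : ℝ} (hq : 0 < q) (μ ω : Measure ℝ) {y : ℕ → ℝ}
    (hy : Antitone y) (k : ℕ) {x : ℝ} (hx : x ∈ disjointed (fun k => Ici (y k)) k) :
    ∑ j ∈ Finset.range (k - 1), μ (Ico (y (j + 1)) (y j)) ^ q *
      ω (disjointed (fun k => Ici (y k)) j) ≤ gapEnergy q μ ω x := by
  set J := disjointed fun k => Ici (y k) with hJ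
  have hJm : ∀ k, MeasurableSet (J k) := MeasurableSet.disjointed fun _ => measurableSet_Ici
  have hJd : Pairwise (Function.onFun Disjoint J) := disjoint_disjointed _
  have hxy : ∀ j ∈ Finset.range (k - 1), x < y (j + 1) := by
    intro j hj
    rw [Finset.mem_range] at hj
    obtain ⟨k, rfl⟩ : ∃ i, k = i + 1 := ⟨k - 1, by omega⟩
    rw [hJ, Monotone.disjointed_add_one fun i j hij => Ici_subset_Ici.2 (hy hij)] at hx
    exact (not_le.1 hx.2).trans_le (hy (by omega))
  have hJx : ∀ j ∈ Finset.range (k - 1), J j ⊆ Ici x := fun j hj s hs =>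
    (hxy j hj).le.trans ((hy (Nat.le_succ j)).trans (disjointed_subset _ j hs))
  calc ∑ j ∈ Finset.range (k - 1), μ (Ico (y (j + 1)) (y j)) ^ q * ω (J j)
      ≤ ∑ j ∈ Finset.range (k - 1), ∫⁻ s in J j, μ (Ico x s) ^ q ∂ω := by
        refine Finset.sum_le_sum fun j hj => ?_
        rw [← setLIntegral_const]
        refine setLIntegral_mono' (hJm j) fun s hs => ENNReal.rpow_le_rpow (measure_mono ?_) hq.le
        exact Ico_subset_Ico (hxy j hj).le (disjointed_subset _ j hs)
    _ = ∫⁻ s in ⋃ j ∈ Finset.range (k - 1), J j, μ (Ico x s) ^ q ∂ω :=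
        (lintegral_biUnion_finset (fun i _ j _ hij => hJd hij) (fun j _ => hJm j) _).symm
    _ ≤ _ := lintegral_mono_set (iUnion₂_subset hJx)

theorem tsum_gap_mul_le_gapConst {p q : ℝ} (hq : 0 < q) (hqp : q < p) (μ ω ν : Measure ℝ)
    {y : ℕ → ℝ} (hy : StrictAnti y) :
    ∑' k, μ (Ico (y (k + 1)) (y k)) ^ q * ω (disjointed (fun k => Ici (y k)) k) *
      (∑ j ∈ Finset.range (k - 1), μ (Ico (y (j + 1)) (y j)) ^ q *
        ω (disjointed (fun k => Ici (y k)) j)) ^ (q / (p - q)) *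
      ν (Ici (y (k + 1))) ^ (-(q / (p - q))) ≤ gapConst p q μ ω ν := by
  have hpq : 0 < p - q := sub_pos.2 hqp
  refine le_trans (ENNReal.tsum_le_tsum fun k => ?_) (tsum_setLIntegral_le ω
    (MeasurableSet.disjointed fun k => measurableSet_Ici (a := y k)) (disjoint_disjointed _) _)
  rw [mul_assoc, mul_assoc, mul_left_comm, mul_comm, ← setLIntegral_const]
  refine setLIntegral_mono' (MeasurableSet.disjointed (fun _ => measurableSet_Ici) k) fun x hx => ?_
  rw [mul_left_comm]
  have hyx : y k ≤ x := disjointed_subset (fun k => Ici (y k)) k hx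
  have hlt : y (k + 1) < x := (hy (Nat.lt_succ_self k)).trans_le hyx
  refine mul_le_mul' (ENNReal.rpow_le_rpow (sum_gap_le_gapEnergy hq μ ω hy.antitone k hx)
    (by positivity)) (le_trans ?_ (le_biSup _ (mem_Iio.2 hlt)))
  gcongr

theorem tsum_rpow_mul_le_tailConst {p q : ℝ} (hq : 0 < q) (hqp : q < p) (hp1 : 1 < p)
    (μ ω ν : Measure ℝ) [IsFiniteMeasure μ] [IsFiniteMeasure ω] {y : ℕ → ℝ} :
    ∑' k, (μ (Ico (y (k + 1)) (y k)) ^ q * ω (disjointed (fun k => Ici (y k)) k)) ^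
        (q / (p - q) + 1) * ν (Ici (y (k + 1))) ^ (-(q / (p - q))) ≤
      2 ^ (q * (q / (p - q) + 1)) * (2 ^ (q / (p - q) + 1) * tailConst p q μ ω ν) := by
  have hpq : 0 < p - q := sub_pos.2 hqp
  refine le_trans ?_ (mul_le_mul_right (tsum_tailEnergy_le p q hq hqp hp1 μ ω ν (y := y)) _)
  rw [← ENNReal.tsum_mul_left]
  refine ENNReal.tsum_le_tsum fun k => ?_
  have h := rpow_measure_Ici_mul_le_tailEnergy_rpow hq hqp hp1
    (μ.restrict (Ico (y (k + 1)) (y k))) ν (y (k + 1))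
  rw [Measure.restrict_apply measurableSet_Ici, inter_eq_right.2 fun t ht => ht.1] at h
  rw [ENNReal.mul_rpow_of_nonneg _ _ (by positivity), ← ENNReal.rpow_mul, mul_left_comm _ (ω _ ^ _),
    mul_comm (_ ^ _) (ω _ ^ _), mul_assoc]
  gcongr

theorem tailEnergy_atoms_le {p q : ℝ} (hq : 0 < q) (hqp : q < p) (hp1 : 1 < p)
    (μ ω ν : Measure ℝ) [IsFiniteMeasure μ] [IsFiniteMeasure ω] {y : ℕ → ℝ} (hy : StrictAnti y) :
    tailEnergy (q / (p - q)) (Measure.sum fun k => (μ (Ico (y (k + 1)) (y k)) ^ q *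
        ω (disjointed (fun k => Ici (y k)) k)) • Measure.dirac (y (k + 1))) ν ≤
      2 ^ (q / (p - q)) * (gapConst p q μ ω ν + 2 ^ (q / (p - q)) * (3 *
        (2 ^ (q * (q / (p - q) + 1)) * (2 ^ (q / (p - q) + 1) * tailConst p q μ ω ν)))) := by
  have hpq : 0 < p - q := sub_pos.2 hqp
  set β := q / (p - q) with hβ
  have hβ0 : 0 ≤ β := by positivity
  set m : ℕ → ℝ≥0∞ := fun k => μ (Ico (y (k + 1)) (y k)) ^ q *
    ω (disjointed (fun k => Ici (y k)) k) with hm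
  set κ : Measure ℝ := Measure.sum fun k => m k • Measure.dirac (y (k + 1)) with hκ
  set V : ℕ → ℝ≥0∞ := fun k => ν (Ici (y (k + 1))) ^ (-β) with hV
  set R : ℕ → ℝ≥0∞ := fun k => ∑ j ∈ Finset.range (k - 1), m j with hR
  set r : ℕ → ℝ≥0∞ := fun k => Nat.casesOn k 0 m with hr
  have hκI : ∀ k, κ (Ici (y (k + 1))) ≤ R k + (r k + m k) := by
    intro k
    have h1 : κ (Ici (y (k + 1))) ≤ ∑ j ∈ Finset.range (k + 1), m j := by
      rw [hκ, Measure.sum_apply _ measurableSet_Ici, tsum_eq_sum (s := Finset.range (k + 1))]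
      · refine Finset.sum_le_sum fun j _ => ?_
        rw [Measure.smul_apply, smul_eq_mul]
        exact mul_le_of_le_one_right' prob_le_one
      · intro j hj
        have : y (j + 1) < y (k + 1) := hy (by simpa using hj)
        simp [Measure.smul_apply, this]
    refine h1.trans (le_of_eq ?_)
    cases k with
    | zero => simp [hR, hr]
    | succ k => simp [hR, hr, Finset.sum_range_succ, add_assoc]
  have hb : ∑' k, m k ^ (β + 1) * V k ≤
      2 ^ (q * (β + 1)) * (2 ^ (β + 1) * tailConst p q μ ω ν) :=
    tsum_rpow_mul_le_tailConst hq hqp hp1 μ ω ν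
  have ha : ∑' k, m k * R k ^ β * V k ≤ gapConst p q μ ω ν :=
    tsum_gap_mul_le_gapConst hq hqp μ ω ν hy
  have hrb : ∑' k, r k ^ (β + 1) * V k ≤ ∑' k, m k ^ (β + 1) * V k := by
    rw [tsum_eq_zero_add' ENNReal.summable]
    have h0 : r 0 ^ (β + 1) * V 0 = 0 := by
      have : 0 < β + 1 := by positivity
      simp [hr, this]
    rw [h0, zero_add]
    refine ENNReal.tsum_le_tsum fun k => mul_le_mul_right ?_ _
    rw [hV]
    simp only [ENNReal.rpow_neg]
    gcongr
    exact hy.antitone (Nat.le_succ _)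
  have hterm : ∀ k, m k * (κ (Ici (y (k + 1))) / ν (Ici (y (k + 1)))) ^ β ≤
      2 ^ β * (m k * R k ^ β * V k +
        2 ^ β * (r k ^ (β + 1) * V k + 2 * (m k ^ (β + 1) * V k))) := fun k => by
    have e : (κ (Ici (y (k + 1))) / ν (Ici (y (k + 1)))) ^ β = κ (Ici (y (k + 1))) ^ β * V k := by
      rw [ENNReal.div_rpow_of_nonneg _ _ hβ0, div_eq_mul_inv, hV]
      simp only [ENNReal.rpow_neg]
    have h1 : κ (Ici (y (k + 1))) ^ β ≤ 2 ^ β * (R k ^ β + 2 ^ β * (r k ^ β + m k ^ β)) :=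
      (ENNReal.rpow_le_rpow (hκI k) hβ0).trans
        ((ENNReal.add_rpow_le_two_rpow_mul _ _ hβ0).trans
          (by gcongr; exact ENNReal.add_rpow_le_two_rpow_mul _ _ hβ0))
    rw [e]
    calc m k * (κ (Ici (y (k + 1))) ^ β * V k)
        ≤ m k * ((2 ^ β * (R k ^ β + 2 ^ β * (r k ^ β + m k ^ β))) * V k) := by gcongr
      _ = 2 ^ β * (m k * R k ^ β * V k + 2 ^ β * (m k * r k ^ β * V k + m k * m k ^ β * V k)) := by
          ring
      _ ≤ 2 ^ β * (m k * R k ^ β * V k + 2 ^ β * ((r k ^ (β + 1) + m k ^ (β + 1)) * V k +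
            m k ^ (β + 1) * V k)) := by
          gcongr
          · exact mul_rpow_le_rpow_add_one_add _ _ hβ0
          · rw [ENNReal.rpow_add_of_nonneg _ _ hβ0 zero_le_one, ENNReal.rpow_one, mul_comm]
      _ = _ := by ring
  calc tailEnergy β κ ν = ∑' k, m k * (κ (Ici (y (k + 1))) / ν (Ici (y (k + 1)))) ^ β :=
        lintegral_sum_smul_dirac _ _ _
    _ ≤ ∑' k, 2 ^ β * (m k * R k ^ β * V k +
        2 ^ β * (r k ^ (β + 1) * V k + 2 * (m k ^ (β + 1) * V k))) :=
        ENNReal.tsum_le_tsum hterm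
    _ = 2 ^ β * (∑' k, m k * R k ^ β * V k + 2 ^ β * (∑' k, r k ^ (β + 1) * V k +
          2 * ∑' k, m k ^ (β + 1) * V k)) := by
        rw [ENNReal.tsum_mul_left, ENNReal.tsum_add, ENNReal.tsum_mul_left, ENNReal.tsum_add,
          ENNReal.tsum_mul_left]
    _ ≤ 2 ^ β * (gapConst p q μ ω ν + 2 ^ β * (∑' k, m k ^ (β + 1) * V k +
          2 * ∑' k, m k ^ (β + 1) * V k)) := by gcongr
    _ = 2 ^ β * (gapConst p q μ ω ν + 2 ^ β * (3 * ∑' k, m k ^ (β + 1) * V k)) := by ring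
    _ ≤ _ := by gcongr

theorem tsum_atoms_le {p q : ℝ} (hq : 0 < q) (hqp : q < p) {δ : ℝ≥0∞}
    (hδ : δ ≠ 0) {μ ω ν : Measure ℝ} [IsFiniteMeasure μ] [IsFiniteMeasure ω]
    (hμ : TailLower δ μ ν) {y : ℕ → ℝ} (hν : ∀ k, ν (Ici (y k)) ≠ ⊤)
    {f : ℝ → ℝ≥0∞} (hf : Monotone f) :
    ∑' k, μ (Ico (y (k + 1)) (y k)) ^ q * ω (disjointed (fun k => Ici (y k)) k) *
        f (y (k + 1)) ^ q ≤
      2 * tailEnergy (q / (p - q)) (Measure.sum fun k => (μ (Ico (y (k + 1)) (y k)) ^ q *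
          ω (disjointed (fun k => Ici (y k)) k)) • Measure.dirac (y (k + 1))) ν ^ ((p - q) / p) *
        (∫⁻ t, f t ^ p ∂ν) ^ (q / p) := by
  set J := disjointed fun k => Ici (y k) with hJ
  set κ : Measure ℝ := Measure.sum fun k => (μ (Ico (y (k + 1)) (y k)) ^ q *
    ω (J k)) • Measure.dirac (y (k + 1)) with hκ
  have hfin : IsFiniteMeasure κ := by
    refine isFiniteMeasure_sum_smul_dirac _ (ne_top_of_le_ne_top
      (b := μ univ ^ q * ω (⋃ k, J k)) ?_ ?_)
    · exact ENNReal.mul_ne_top (ENNReal.rpow_ne_top_of_nonneg hq.le (measure_ne_top _ _))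
        (measure_ne_top _ _)
    · rw [measure_iUnion (disjoint_disjointed _)
        (MeasurableSet.disjointed fun _ => measurableSet_Ici), ← ENNReal.tsum_mul_left]
      refine ENNReal.tsum_le_tsum fun k => ?_
      gcongr
      exact subset_univ _
  have hκν : TailLower δ κ ν := tailLower_sum_smul_dirac fun k hk => hμ _ fun h0 => hk <| by
    rw [measure_mono_null (fun s hs => hs.1 : Ico (y (k + 1)) (y k) ⊆ Ici (y (k + 1))) h0,
      ENNReal.zero_rpow_of_pos hq, zero_mul]
  have hκt : ∀ᵐ t ∂κ, ν (Ici t) ≠ ⊤ := by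
    rw [hκ, Measure.ae_sum_iff]
    refine fun k => Measure.ae_smul_measure ?_ _
    rw [ae_dirac_eq]
    exact hν (k + 1)
  rw [← lintegral_sum_smul_dirac _ (fun k => y (k + 1)) fun t => f t ^ q]
  exact lintegral_rpow_le_tailEnergy hq hqp hδ hκν hκt hf

/-- The Hardy inequality for non-decreasing functions with respect to finite measures. -/
theorem exists_lintegral_rpow_setLIntegral_Iio_le {p q : ℝ} (hq : 0 < q) (hqp : q < p)
    (hp1 : 1 < p) : ∃ C : ℝ≥0∞, C ≠ ⊤ ∧ ∀ (μ ω ν : Measure ℝ) [IsFiniteMeasure μ]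
      [IsFiniteMeasure ω] [NullSingletonClass μ] (δ : ℝ≥0∞), δ ≠ 0 → TailLower δ μ ν →
      ∀ f : ℝ → ℝ≥0∞, Monotone f → ∫⁻ t, f t ^ p ∂ν ≠ ⊤ →
        ∫⁻ x, (∫⁻ t in Iio x, f t ∂μ) ^ q ∂ω ≤
          C * (gapConst p q μ ω ν + tailConst p q μ ω ν) ^ ((p - q) / p) *
            (∫⁻ t, f t ^ p ∂ν) ^ (q / p) := by
  have hp0 : 0 < p := hq.trans hqp
  have hpq : 0 < p - q := sub_pos.2 hqp
  have hr : 0 ≤ (p - q) / p := by positivity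
  set β := q / (p - q) with hβ
  have hβ0 : 0 ≤ β := by positivity
  set c₁ : ℝ≥0∞ := 2 ^ β * (1 + 2 ^ β * (3 * (2 ^ (q * (β + 1)) * 2 ^ (β + 1)))) with hc₁
  have hc₁t : c₁ ≠ ⊤ := by finiteness
  refine ⟨4 ^ q * (2 ^ q * (2 * c₁ ^ ((p - q) / p) +
    2 ^ q * (2 ^ (β + 1)) ^ ((p - q) / p))), by finiteness, ?_⟩
  intro μ ω ν _ _ _ δ hδ hμ f hf hΦ
  set Φ := ∫⁻ t, f t ^ p ∂ν with hΦdef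
  set X := gapConst p q μ ω ν + tailConst p q μ ω ν with hX
  have hfV : ∀ t, f t ^ p * ν (Ici t) ≤ Φ := fun t => by
    calc f t ^ p * ν (Ici t) = ∫⁻ _ in Ici t, f t ^ p ∂ν := by simp
      _ ≤ ∫⁻ s in Ici t, f s ^ p ∂ν :=
        setLIntegral_mono' measurableSet_Ici fun s hs => ENNReal.rpow_le_rpow (hf hs) hp0.le
      _ ≤ _ := setLIntegral_le_lintegral _ _
  have hfμ : ∀ᵐ t ∂μ, f t ≤ (Φ / δ) ^ (1 / p) := by
    have h0 : ∀ᵐ t ∂μ, μ (Ici t) ≠ 0 := by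
      have hup : IsUpperSet {t | μ (Ici t) = 0} := fun x y hxy hx =>
        le_antisymm ((measure_mono (Ici_subset_Ici.2 hxy)).trans (le_of_eq hx)) zero_le
      rw [ae_iff]
      simp only [ne_eq, not_not]
      rw [measure_eq_iSup_Ici_of_isUpperSet μ hup]
      simp
    filter_upwards [h0] with t ht
    rw [one_div, ENNReal.le_rpow_inv_iff hp0]
    refine (ENNReal.le_div_iff_mul_le (Or.inl hδ) (Or.inr hΦ)).2 ((mul_le_mul_right ?_ _).trans
      (hfV t))
    exact hμ t ht
  set κ := μ.withDensity f with hκ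
  have hκI : ∀ x, κ (Iio x) = ∫⁻ t in Iio x, f t ∂μ := fun x =>
    withDensity_apply _ measurableSet_Iio
  have hκfin : IsFiniteMeasure κ := by
    refine ⟨?_⟩
    rw [hκ, withDensity_apply _ MeasurableSet.univ, Measure.restrict_univ]
    calc ∫⁻ t, f t ∂μ ≤ ∫⁻ _, (Φ / δ) ^ (1 / p) ∂μ := lintegral_mono_ae hfμ
      _ = (Φ / δ) ^ (1 / p) * μ univ := lintegral_const _
      _ < ⊤ := ENNReal.mul_lt_top (ENNReal.rpow_lt_top_of_nonneg (by positivity)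
        (ENNReal.div_ne_top hΦ hδ)) (measure_lt_top _ _)
  simp only [← hκI]
  by_cases hκ0 : κ univ = 0
  · have : ∀ x, κ (Iio x) = 0 := fun x => measure_mono_null (subset_univ _) hκ0
    simp [this, hq]
  obtain ⟨y, hy, hy0, hlev⟩ := exists_seq_lintegral_rpow_measure_Iio_le κ hκ0
  have hf0 : ∀ k, f (y k) ≠ 0 := fun k h0 => by
    refine (hy0 k).ne' ?_
    rw [hκI, setLIntegral_congr_fun (g := fun _ => 0) measurableSet_Iio fun t ht =>
      le_antisymm ((hf (le_of_lt ht)).trans h0.le) zero_le, lintegral_zero]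
  have hν : ∀ k, ν (Ici (y k)) ≠ ⊤ := fun k htop => by
    have h1 := hfV (y k)
    rw [htop, ENNReal.mul_top (by simp [hf0, hp0.le])] at h1
    exact hΦ (top_le_iff.1 h1)
  set J := disjointed fun k => Ici (y k) with hJ
  have hcell : ∀ k, κ (Ico (y (k + 1)) (y k)) ^ q * ω (J k) ≤
      2 ^ q * (μ (Ico (y (k + 1)) (y k)) ^ q * ω (J k) * f (y (k + 1)) ^ q +
        (∫⁻ t in Ico (y (k + 1)) (y k), (f t - f (y (k + 1))) ∂μ) ^ q * ω (J k)) := fun k => by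
    have h1 : κ (Ico (y (k + 1)) (y k)) ≤ f (y (k + 1)) * μ (Ico (y (k + 1)) (y k)) +
        ∫⁻ t in Ico (y (k + 1)) (y k), (f t - f (y (k + 1))) ∂μ := by
      rw [hκ, withDensity_apply _ measurableSet_Ico, ← setLIntegral_const,
        ← lintegral_add_left measurable_const]
      exact lintegral_mono fun t => le_add_tsub
    calc κ (Ico (y (k + 1)) (y k)) ^ q * ω (J k)
        ≤ 2 ^ q * ((f (y (k + 1)) * μ (Ico (y (k + 1)) (y k))) ^ q +
          (∫⁻ t in Ico (y (k + 1)) (y k), (f t - f (y (k + 1))) ∂μ) ^ q) * ω (J k) := by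
          gcongr
          exact (ENNReal.rpow_le_rpow h1 hq.le).trans (ENNReal.add_rpow_le_two_rpow_mul _ _ hq.le)
      _ = _ := by rw [ENNReal.mul_rpow_of_nonneg _ _ hq.le]; ring
  have hS1 := tsum_atoms_le hq hqp hδ (ω := ω) hμ hν hf
  have hS2 := tsum_oscillation_le hq hqp hp1 hδ (ω := ω) hμ hy.antitone hν hf
  have hT : tailConst p q μ ω ν ≤ X := le_add_self
  have hE : tailEnergy β (Measure.sum fun k => (μ (Ico (y (k + 1)) (y k)) ^ q *
      ω (J k)) • Measure.dirac (y (k + 1))) ν ≤ c₁ * X := by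
    refine (tailEnergy_atoms_le hq hqp hp1 μ ω ν hy).trans ?_
    calc 2 ^ β * (gapConst p q μ ω ν + 2 ^ β * (3 * (2 ^ (q * (β + 1)) *
          (2 ^ (β + 1) * tailConst p q μ ω ν))))
        ≤ 2 ^ β * (X + 2 ^ β * (3 * (2 ^ (q * (β + 1)) * (2 ^ (β + 1) * X)))) := by
          gcongr; exact le_self_add
      _ = _ := by rw [hc₁]; ring
  calc ∫⁻ x, κ (Iio x) ^ q ∂ω
      ≤ 4 ^ q * ∑' k, κ (Ico (y (k + 1)) (y k)) ^ q * ω (J k) := hlev ω hq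
    _ ≤ 4 ^ q * (2 ^ q * (∑' k, μ (Ico (y (k + 1)) (y k)) ^ q * ω (J k) * f (y (k + 1)) ^ q +
        ∑' k, (∫⁻ t in Ico (y (k + 1)) (y k), (f t - f (y (k + 1))) ∂μ) ^ q * ω (J k))) := by
        rw [← ENNReal.tsum_add, ← ENNReal.tsum_mul_left (a := 2 ^ q)]
        exact mul_le_mul_right (ENNReal.tsum_le_tsum hcell) _
    _ ≤ 4 ^ q * (2 ^ q * (2 * (c₁ * X) ^ ((p - q) / p) * Φ ^ (q / p) +
        2 ^ q * ((2 ^ (β + 1) * X) ^ ((p - q) / p) * Φ ^ (q / p)))) := by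
        gcongr
        · exact hS1.trans (by gcongr)
        · exact hS2.trans (by gcongr)
    _ = _ := by
        rw [ENNReal.mul_rpow_of_nonneg c₁ _ hr, ENNReal.mul_rpow_of_nonneg (2 ^ (β + 1)) _ hr]
        generalize c₁ ^ ((p - q) / p) = A
        ring

theorem ENNReal.le_rpow_of_le_mul_rpow {p q : ℝ} (hq : 0 < q) (hqp : q < p) {S L : ℝ≥0∞}
    (hS : S ≠ ⊤) (h : S ≤ L * S ^ (q / p)) : S ≤ L ^ (p / (p - q)) := by
  have hp : 0 < p := hq.trans hqp
  have hpq : 0 < p - q := sub_pos.2 hqp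
  by_cases hS0 : S = 0
  · rw [hS0]; exact zero_le
  have e : S = S ^ ((p - q) / p) * S ^ (q / p) := by
    rw [← ENNReal.rpow_add _ _ hS0 hS, ← add_div, sub_add_cancel, div_self hp.ne',
      ENNReal.rpow_one]
  have h1 : S ^ ((p - q) / p) ≤ L := by
    have h2 : S ^ ((p - q) / p) * S ^ (q / p) ≤ L * S ^ (q / p) := e ▸ h
    exact (ENNReal.mul_le_mul_iff_left (by simp [hS0, hS]) (by simp [hS0, hS])).1 h2
  calc S = (S ^ ((p - q) / p)) ^ (p / (p - q)) := by
        rw [← ENNReal.rpow_mul]; field_simp; simp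
    _ ≤ _ := by gcongr

theorem ENNReal.exists_tsum_sum_range_rpow_mul_le {q : ℝ} (hq : 0 < q) :
    ∃ c : ℝ≥0∞, c ≠ ⊤ ∧ ∀ a : ℕ → ℝ≥0∞,
      ∑' l, (∑ j ∈ Finset.range (l + 1), a j) ^ q * 2⁻¹ ^ l ≤ c * ∑' l, a l ^ q * 2⁻¹ ^ l := by
  set r : ℝ≥0∞ := 2⁻¹ ^ (1 / 2 : ℝ) with hr
  have hr1 : r < 1 := ENNReal.rpow_lt_one (by simp) (by norm_num)
  have hrr : ∀ l : ℕ, r ^ l * r ^ l = 2⁻¹ ^ l := fun l => by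
    rw [← mul_pow, hr, ← ENNReal.rpow_add_of_nonneg _ _ (by norm_num) (by norm_num)]
    norm_num
  set θ : ℝ≥0∞ := r ^ (1 / q) with hθ
  have hθ1 : θ < 1 := ENNReal.rpow_lt_one hr1 (by positivity)
  have hθr : ∀ l : ℕ, (θ ^ l) ^ q = r ^ l := fun l => by
    rw [hθ, ← ENNReal.rpow_natCast, ← ENNReal.rpow_mul, ← ENNReal.rpow_mul, ← ENNReal.rpow_natCast]
    congr 1
    field_simp
  refine ⟨((1 - θ)⁻¹) ^ q * (1 - r)⁻¹, ?_, fun a => ?_⟩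
  · have h1 : 1 - θ ≠ 0 := (tsub_pos_of_lt hθ1).ne'
    have h2 : 1 - r ≠ 0 := (tsub_pos_of_lt hr1).ne'
    finiteness
  have hpt : ∀ l, (∑ j ∈ Finset.range (l + 1), a j) ^ q * 2⁻¹ ^ l ≤
      ((1 - θ)⁻¹) ^ q * ∑' j, if j ≤ l then r ^ l * (r ^ j * a j ^ q) else 0 := fun l => by
    set B : ℝ≥0∞ := ∑ j ∈ Finset.range (l + 1), r ^ j * a j ^ q with hB
    have h1 : ∀ j ∈ Finset.range (l + 1), θ ^ j * a j ≤ B ^ (1 / q) := fun j hj => by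
      rw [one_div, ENNReal.le_rpow_inv_iff hq, ENNReal.mul_rpow_of_nonneg _ _ hq.le, hθr]
      exact Finset.single_le_sum_of_canonicallyOrdered (f := fun j => r ^ j * a j ^ q) hj
    have h2 : θ ^ l * ∑ j ∈ Finset.range (l + 1), a j ≤ (1 - θ)⁻¹ * B ^ (1 / q) := by
      calc θ ^ l * ∑ j ∈ Finset.range (l + 1), a j
          ≤ ∑ j ∈ Finset.range (l + 1), θ ^ (l - j) * B ^ (1 / q) := by
            rw [Finset.mul_sum]
            refine Finset.sum_le_sum fun j hj => ?_
            have : l = (l - j) + j := by have := Finset.mem_range.1 hj; omega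
            conv_lhs => rw [this, pow_add, mul_assoc]
            exact mul_le_mul_right (h1 j hj) _
        _ = (∑ j ∈ Finset.range (l + 1), θ ^ j) * B ^ (1 / q) := by
            rw [← Finset.sum_mul, Finset.sum_flip (fun j => θ ^ j)]
        _ ≤ _ := by
            gcongr
            rw [← ENNReal.tsum_geometric]
            exact ENNReal.sum_le_tsum _
    have h3 := ENNReal.rpow_le_rpow h2 hq.le
    rw [ENNReal.mul_rpow_of_nonneg _ _ hq.le, ENNReal.mul_rpow_of_nonneg _ _ hq.le, hθr,
      ← ENNReal.rpow_mul, one_div_mul_cancel hq.ne', ENNReal.rpow_one] at h3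
    have h4 : ∑' j, (if j ≤ l then r ^ l * (r ^ j * a j ^ q) else 0) = r ^ l * B := by
      rw [tsum_eq_sum (s := Finset.range (l + 1)), hB, Finset.mul_sum]
      · refine Finset.sum_congr rfl fun j hj => if_pos ?_
        have := Finset.mem_range.1 hj
        omega
      · intro j hj
        refine if_neg fun h => hj (Finset.mem_range.2 (by omega))
    rw [h4, ← hrr]
    calc (∑ j ∈ Finset.range (l + 1), a j) ^ q * (r ^ l * r ^ l)
        = r ^ l * (r ^ l * (∑ j ∈ Finset.range (l + 1), a j) ^ q) := by ring
      _ ≤ r ^ l * (((1 - θ)⁻¹) ^ q * B) := by gcongr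
      _ = _ := by ring
  calc ∑' l, (∑ j ∈ Finset.range (l + 1), a j) ^ q * 2⁻¹ ^ l
      ≤ ∑' l, ((1 - θ)⁻¹) ^ q * ∑' j, if j ≤ l then r ^ l * (r ^ j * a j ^ q) else 0 :=
        ENNReal.tsum_le_tsum hpt
    _ = ((1 - θ)⁻¹) ^ q * ∑' j, ∑' l, if j ≤ l then r ^ l * (r ^ j * a j ^ q) else 0 := by
        rw [ENNReal.tsum_mul_left, ENNReal.tsum_comm]
    _ = ((1 - θ)⁻¹) ^ q * ∑' j, (1 - r)⁻¹ * (a j ^ q * 2⁻¹ ^ j) := by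
        congr 1
        refine tsum_congr fun j => ?_
        rw [← Summable.sum_add_tsum_nat_add' (k := j) ENNReal.summable,
          Finset.sum_eq_zero fun l hl => if_neg (by have := Finset.mem_range.1 hl; omega), zero_add]
        simp only [le_add_iff_nonneg_left, zero_le, if_true, pow_add]
        rw [← ENNReal.tsum_geometric, ← ENNReal.tsum_mul_right, ← hrr]
        refine tsum_congr fun l => ?_
        ring
    _ = _ := by rw [ENNReal.tsum_mul_left]; ring

/-- A decomposition of the line along the dyadic levels of the tails of a finite measure. -/
theorem exists_seq_dyadic_tail (ω : Measure ℝ) [IsFiniteMeasure ω] [NullSingletonClass ω]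
    (h0 : ω univ ≠ 0) : ∃ x : ℕ → ℝ, StrictMono x ∧
      (∀ φ : ℝ → ℝ≥0∞, ∫⁻ t, φ t ∂ω ≤
        ∑' k, ∫⁻ t in disjointed (fun k => Iio (x k)) k, φ t ∂ω) ∧
      (∀ k, ∀ t ∈ disjointed (fun k => Iio (x k)) k, ω (Ici t) ≤ ω univ * 2⁻¹ ^ k) ∧
      (∀ k, ω (disjointed (fun k => Iio (x k)) k) ≤ ω univ * 2⁻¹ ^ k) ∧
      ∀ F : ℝ → ℝ≥0∞, Monotone F → ∑' k, F (x k) * (ω univ * 2⁻¹ ^ k) ≤ 4 * ∫⁻ t, F t ∂ω := by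
  obtain ⟨x, hx, h⟩ := exists_seq_measure_Ici_eq ω h0
  set W := ω univ with hW
  set P := disjointed fun k => Iio (x k) with hP
  have hPm : ∀ k, MeasurableSet (P k) := MeasurableSet.disjointed fun _ => measurableSet_Iio
  have hPd : Pairwise (Function.onFun Disjoint P) := disjoint_disjointed _
  have hPx : ∀ k, ∀ t ∈ P (k + 1), x k ≤ t := fun k t ht => by
    rw [hP, Monotone.disjointed_add_one fun i j hij => Iio_subset_Iio (hx.monotone hij)] at ht
    exact not_lt.1 ht.2
  refine ⟨x, hx, fun φ => ?_, fun k => ?_, fun k => ?_, fun F hF => ?_⟩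
  · have hnull : ω (⋃ k, P k)ᶜ = 0 := by
      have hlim : Filter.Tendsto (fun k : ℕ => W * 2⁻¹ ^ (k + 1)) Filter.atTop (nhds 0) := by
        have := ENNReal.Tendsto.const_mul (a := W)
          ((ENNReal.tendsto_pow_atTop_nhds_zero_of_lt_one (r := 2⁻¹) (by simp)).comp
            (Filter.tendsto_add_atTop_nat 1)) (Or.inr (measure_ne_top _ _))
        simpa using this
      refine le_antisymm (ge_of_tendsto' hlim fun k => ?_) zero_le
      rw [← h k]
      refine measure_mono fun t ht => ?_
      rw [hP, iUnion_disjointed, mem_compl_iff, mem_iUnion] at ht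
      push Not at ht
      exact mem_Ici.2 (not_lt.1 (ht k))
    rw [← lintegral_iUnion hPm hPd, ← lintegral_add_compl _ (MeasurableSet.iUnion hPm),
      setLIntegral_measure_zero _ _ hnull, add_zero]
  · cases k with
    | zero => exact fun t _ => by simpa using measure_mono (subset_univ _)
    | succ k =>
      intro t ht
      rw [← h k]
      exact measure_mono (Ici_subset_Ici.2 (hPx k t ht))
  · cases k with
    | zero => simpa using measure_mono (subset_univ _)
    | succ k =>
      rw [← h k]
      exact measure_mono fun t ht => hPx k t ht
  · have hI : ∀ k, W * 2⁻¹ ^ k = 4 * ω (Ico (x k) (x (k + 1))) := fun k => by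
      have e : Ico (x k) (x (k + 1)) = Ici (x k) \ Ici (x (k + 1)) := by
        ext t; simp
      have e2 : W * 2⁻¹ ^ (k + 1) = W * 2⁻¹ ^ (k + 2) + W * 2⁻¹ ^ (k + 2) := by
        rw [← mul_add, ← mul_two, pow_succ (2⁻¹ : ℝ≥0∞) (k + 1), mul_assoc,
          ENNReal.inv_mul_cancel (by simp) (by simp), mul_one]
      have h4 : (4 : ℝ≥0∞) * 2⁻¹ ^ 2 = 1 := by
        rw [← ENNReal.inv_pow, show (2 : ℝ≥0∞) ^ 2 = 4 by norm_num]
        exact ENNReal.mul_inv_cancel (by simp) (by simp)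
      rw [e, measure_sdiff (Ici_subset_Ici.2 (hx (Nat.lt_succ_self k)).le)
        measurableSet_Ici.nullMeasurableSet (measure_ne_top _ _), h, h, e2,
        ENNReal.add_sub_cancel_right (by finiteness), pow_add]
      calc W * 2⁻¹ ^ k = W * 2⁻¹ ^ k * (4 * 2⁻¹ ^ 2) := by rw [h4, mul_one]
        _ = _ := by ring
    have hd : Pairwise (Function.onFun Disjoint fun k => Ico (x k) (x (k + 1))) :=
      hx.monotone.pairwise_disjoint_on_Ico_succ
    calc ∑' k, F (x k) * (W * 2⁻¹ ^ k)
        = 4 * ∑' k, F (x k) * ω (Ico (x k) (x (k + 1))) := by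
          rw [← ENNReal.tsum_mul_left]
          exact tsum_congr fun k => by rw [hI]; ring
      _ ≤ 4 * ∑' k, ∫⁻ t in Ico (x k) (x (k + 1)), F t ∂ω := by
          refine mul_le_mul_right (ENNReal.tsum_le_tsum fun k => ?_) _
          rw [← setLIntegral_const]
          exact setLIntegral_mono' measurableSet_Ico fun t ht => hF ht.1
      _ ≤ _ := mul_le_mul_right (tsum_setLIntegral_le ω (fun k => measurableSet_Ico) hd F) _

theorem iSup_rpow_le_tsum {p : ℝ} (hp : 0 < p) (a : ℕ → ℝ≥0∞) :
    (⨆ k, a k) ^ p ≤ ∑' k, a k ^ p := by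
  rw [← ENNReal.le_rpow_inv_iff hp]
  refine iSup_le fun k => (ENNReal.le_rpow_inv_iff hp).2 ?_
  exact ENNReal.le_tsum k

theorem tsum_mul_two_inv_pow (W : ℝ≥0∞) : ∑' k : ℕ, W * 2⁻¹ ^ k = 2 * W := by
  rw [ENNReal.tsum_mul_left, ENNReal.tsum_geometric, ENNReal.one_sub_inv_two, inv_inv, mul_comm]

theorem tsum_rpow_mul_tailEnergy_rpow_le {p q : ℝ} (hq : 0 < q) (hqp : q < p) (hp1 : 1 < p)
    {μ ω ν : Measure ℝ} [IsFiniteMeasure μ] [IsFiniteMeasure ω] {δ Λ : ℝ≥0∞} (hδ : δ ≠ 0)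
    (hμ : TailLower δ μ ν) (H : ∀ f : ℝ → ℝ≥0∞, Monotone f →
      ∫⁻ x, (∫⁻ t in Iio x, f t ∂μ) ^ q ∂ω ≤ Λ * (∫⁻ t, f t ^ p ∂ν) ^ (q / p)) {x : ℕ → ℝ}
    (hx : ∀ F : ℝ → ℝ≥0∞, Monotone F →
      ∑' k, F (x k) * (ω univ * 2⁻¹ ^ k) ≤ 4 * ∫⁻ t, F t ∂ω) :
    ∑' k, (ω univ * 2⁻¹ ^ k) ^ (q / (p - q) + 1) *
      tailEnergy (1 / (p - 1)) (μ.restrict (Iio (x k))) ν ^ (q * (p - 1) / (p - q)) ≤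
      (4 * Λ * ENNReal.ofReal p ^ (q / p)) ^ (p / (p - q)) := by
  have hp : 0 < p - 1 := sub_pos.2 hp1
  have hp0 : 0 < p := hq.trans hqp
  have hpq : 0 < p - q := sub_pos.2 hqp
  set b := 1 / (p - 1) with hb
  set β := q / (p - q) with hβ
  set γ := q * (p - 1) / (p - q) with hγ
  have hb0 : 0 < b := by positivity
  have hβ0 : 0 < β := by positivity
  have hγ0 : 0 < γ := by positivity
  set W := ω univ with hW
  have hWt : W ≠ ⊤ := measure_ne_top _ _
  set K : ℕ → ℝ → ℝ≥0∞ := fun k => tailRatioSup (μ.restrict (Iio (x k))) ν with hK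
  have hKlow : ∀ k, TailLower δ (μ.restrict (Iio (x k))) ν := fun k =>
    hμ.mono Measure.restrict_le_self
  have hKt : ∀ k t, K k t ≠ ⊤ := fun k => (hKlow k).tailRatioSup_ne_top hδ
  set X : ℕ → ℝ≥0∞ := fun k => ∫⁻ t in Iio (x k), K k t ^ b ∂μ with hX
  have heX : ∀ k, tailEnergy b (μ.restrict (Iio (x k))) ν ≤ X k := fun k =>
    lintegral_mono fun t => ENNReal.rpow_le_rpow (le_tailRatioSup _ _ t) hb0.le
  have hKX : ∀ k, ∫⁻ t, K k t ^ (b + 1) ∂ν ≤ ENNReal.ofReal p * X k := fun k => by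
    have h := lintegral_rpow_add_one_tailRatioSup_le (μ.restrict (Iio (x k))) ν (hKt k) hb0
    have e : (b + 1) / b = p := by rw [hb]; field_simp; ring
    rwa [e] at h
  set M : ℝ≥0∞ := (μ univ / δ) ^ b * μ univ with hM
  have hMt : M ≠ ⊤ := ENNReal.mul_ne_top
    (ENNReal.rpow_ne_top_of_nonneg hb0.le (ENNReal.div_ne_top (measure_ne_top _ _) hδ))
    (measure_ne_top _ _)
  have hXM : ∀ k, X k ≤ M := fun k => by
    calc X k ≤ ∫⁻ t in Iio (x k), (μ univ / δ) ^ b ∂μ := by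
          refine lintegral_mono fun t => ENNReal.rpow_le_rpow (iSup₂_le fun s _ => ?_) hb0.le
          refine ((hKlow k).div_le s).trans (ENNReal.div_le_div_right ?_ _)
          exact Measure.restrict_le_self _
      _ ≤ M := by
          rw [setLIntegral_const]
          exact mul_le_mul_right (measure_mono (subset_univ _)) _
  set l : ℕ → ℝ≥0∞ := fun k =>
    if X k = 0 then 0 else (W * 2⁻¹ ^ k) ^ (1 / (p - q)) * X k ^ ((γ - 1) / p) with hl
  set S := ∑' k, (W * 2⁻¹ ^ k) ^ (β + 1) * X k ^ γ with hS
  have hlp : ∀ k, l k ^ p * X k = (W * 2⁻¹ ^ k) ^ (β + 1) * X k ^ γ := fun k => by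
    by_cases h0 : X k = 0
    · simp [h0, hγ0]
    have hXt : X k ≠ ⊤ := ne_top_of_le_ne_top hMt (hXM k)
    simp only [hl, h0, if_false]
    rw [ENNReal.mul_rpow_of_nonneg _ _ hp0.le, ← ENNReal.rpow_mul, ← ENNReal.rpow_mul, mul_assoc]
    have e1 : 1 / (p - q) * p = β + 1 := by rw [hβ]; field_simp; ring
    have e2 : (γ - 1) / p * p = γ - 1 := by field_simp
    rw [e1, e2]
    congr 1
    nth_rewrite 2 [← ENNReal.rpow_one (X k)]
    rw [← ENNReal.rpow_add _ _ h0 hXt, sub_add_cancel]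
  have hlq : ∀ k, (l k * X k) ^ q * (W * 2⁻¹ ^ k) = (W * 2⁻¹ ^ k) ^ (β + 1) * X k ^ γ := fun k => by
    by_cases h0 : X k = 0
    · simp [h0, hγ0, hq]
    have hXt : X k ≠ ⊤ := ne_top_of_le_ne_top hMt (hXM k)
    simp only [hl, h0, if_false]
    have e0 : X k ^ ((γ - 1) / p) * X k = X k ^ ((γ - 1) / p + 1) := by
      rw [ENNReal.rpow_add _ _ h0 hXt, ENNReal.rpow_one]
    rw [mul_assoc, e0, ENNReal.mul_rpow_of_nonneg _ _ hq.le, ← ENNReal.rpow_mul,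
      ← ENNReal.rpow_mul, ENNReal.rpow_add_of_nonneg _ _ hβ0.le zero_le_one, ENNReal.rpow_one]
    have e1 : 1 / (p - q) * q = β := by rw [hβ]; field_simp
    have e2 : ((γ - 1) / p + 1) * q = γ := by rw [hγ]; field_simp; ring
    rw [e1, e2]
    exact mul_right_comm _ _ _
  set f : ℝ → ℝ≥0∞ := fun t => ⨆ k, l k * K k t ^ b with hf
  have hKm : ∀ k, Monotone (K k) := fun k => tailRatioSup_mono _ _
  have hfm : Monotone f := fun s t hst => iSup_mono fun k =>
    mul_le_mul_right (ENNReal.rpow_le_rpow (hKm k hst) hb0.le) _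
  have hfp : ∫⁻ t, f t ^ p ∂ν ≤ ENNReal.ofReal p * S := by
    have e : b * p = b + 1 := by rw [hb]; field_simp; ring
    calc ∫⁻ t, f t ^ p ∂ν ≤ ∫⁻ t, ∑' k, l k ^ p * K k t ^ (b + 1) ∂ν := by
          refine lintegral_mono fun t => (iSup_rpow_le_tsum hp0 _).trans (le_of_eq ?_)
          refine tsum_congr fun k => ?_
          rw [ENNReal.mul_rpow_of_nonneg _ _ hp0.le, ← ENNReal.rpow_mul, e]
      _ = ∑' k, l k ^ p * ∫⁻ t, K k t ^ (b + 1) ∂ν := by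
          rw [lintegral_tsum fun k =>
            (((hKm k).measurable.pow_const _).const_mul _).aemeasurable]
          exact tsum_congr fun k => lintegral_const_mul _ ((hKm k).measurable.pow_const _)
      _ ≤ ∑' k, l k ^ p * (ENNReal.ofReal p * X k) :=
          ENNReal.tsum_le_tsum fun k => mul_le_mul_right (hKX k) _
      _ = _ := by
          rw [hS, ← ENNReal.tsum_mul_left]
          exact tsum_congr fun k => by rw [← hlp, mul_left_comm]
  have hSF : S ≤ 4 * Λ * ENNReal.ofReal p ^ (q / p) * S ^ (q / p) := by
    calc S = ∑' k, (l k * X k) ^ q * (W * 2⁻¹ ^ k) := tsum_congr fun k => (hlq k).symm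
      _ ≤ ∑' k, (∫⁻ t in Iio (x k), f t ∂μ) ^ q * (W * 2⁻¹ ^ k) := by
          refine ENNReal.tsum_le_tsum fun k => mul_le_mul_left (ENNReal.rpow_le_rpow ?_ hq.le) _
          rw [hX, ← lintegral_const_mul _ ((hKm k).measurable.pow_const _)]
          exact lintegral_mono fun t => le_iSup (fun k => l k * K k t ^ b) k
      _ ≤ 4 * ∫⁻ x, (∫⁻ t in Iio x, f t ∂μ) ^ q ∂ω :=
          hx (fun x => (∫⁻ t in Iio x, f t ∂μ) ^ q) fun s t hst =>
            ENNReal.rpow_le_rpow (lintegral_mono_set (Iio_subset_Iio hst)) hq.le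
      _ ≤ 4 * (Λ * (ENNReal.ofReal p * S) ^ (q / p)) := by
          gcongr
          exact (H f hfm).trans (by gcongr)
      _ = _ := by rw [ENNReal.mul_rpow_of_nonneg _ _ (by positivity)]; ring
  have hSt : S ≠ ⊤ := by
    have hle : S ≤ W ^ β * M ^ γ * (2 * W) := by
      rw [← tsum_mul_two_inv_pow, ← ENNReal.tsum_mul_left]
      refine ENNReal.tsum_le_tsum fun k => ?_
      have h1 : W * 2⁻¹ ^ k ≤ W := mul_le_of_le_one_right' (pow_le_one₀ zero_le (by simp))
      calc (W * 2⁻¹ ^ k) ^ (β + 1) * X k ^ γ = (W * 2⁻¹ ^ k) ^ β * X k ^ γ * (W * 2⁻¹ ^ k) := by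
            rw [ENNReal.rpow_add_of_nonneg _ _ hβ0.le zero_le_one, ENNReal.rpow_one]
            exact mul_right_comm _ _ _
        _ ≤ _ := by gcongr; exact hXM k
    exact ne_top_of_le_ne_top (by finiteness) hle
  refine le_trans ?_ (ENNReal.le_rpow_of_le_mul_rpow hq hqp hSt hSF)
  exact ENNReal.tsum_le_tsum fun k => mul_le_mul_right (ENNReal.rpow_le_rpow (heX k) hγ0.le) _

theorem TailLower.add {δ : ℝ≥0∞} {ρ ρ' ν : Measure ℝ} (h : TailLower δ ρ ν)
    (h' : TailLower δ ρ' ν) : TailLower δ (ρ + ρ') ν := fun t ht => by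
  rw [Measure.add_apply, ne_eq, add_eq_zero, not_and_or] at ht
  exact ht.elim (h t) (h' t)

theorem gapSup_mono {q β : ℝ} (hq : 0 ≤ q) (μ ν : Measure ℝ) : Monotone (gapSup q β μ ν) :=
  fun x y hxy => iSup₂_le fun t ht => le_trans (by gcongr)
    (le_biSup (fun t => μ (Ico t y) ^ q * ν (Ici t) ^ (-β)) (mem_Iio.2 (ht.trans_le hxy)))

theorem TailLower.exists_gapSup_le {δ : ℝ≥0∞} (hδ : δ ≠ 0) {μ ν : Measure ℝ} [IsFiniteMeasure μ]
    (hμ : TailLower δ μ ν) {q β : ℝ} (hq : 0 < q) (hβ : 0 ≤ β) (x : ℝ) :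
    ∃ t < x, gapSup q β μ ν x ≤ 2 * (μ (Ico t x) ^ q * ν (Ici t) ^ (-β)) := by
  have hfin : gapSup q β μ ν x ≠ ⊤ := by
    refine ne_top_of_le_ne_top (b := μ univ ^ q * (δ ^ β)⁻¹) ?_ (iSup₂_le fun t ht => ?_)
    · have : δ ^ β ≠ 0 := by simp [hδ, hβ]
      finiteness
    · by_cases h0 : μ (Ico t x) = 0
      · simp [h0, hq]
      have h1 : δ ≤ ν (Ici t) := hμ t fun h => h0 (measure_mono_null (fun s hs => hs.1) h)
      rw [ENNReal.rpow_neg]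
      gcongr
      exact subset_univ _
  by_cases h0 : gapSup q β μ ν x = 0
  · exact ⟨x - 1, by linarith, by rw [h0]; exact zero_le⟩
  obtain ⟨t, ht⟩ := lt_iSup_iff.1 (ENNReal.half_lt_self h0 hfin)
  obtain ⟨htx, ht⟩ := lt_iSup_iff.1 ht
  refine ⟨t, htx, ?_⟩
  rw [mul_comm]
  exact (ENNReal.div_le_iff (by simp) (by simp)).1 ht.le

theorem measure_Ico_le_sum (μ : Measure ℝ) (x : ℕ → ℝ) (l : ℕ) :
    μ (Ico (x 0) (x (l + 1))) ≤ ∑ j ∈ Finset.range (l + 1), μ (Ico (x j) (x (j + 1))) := by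
  induction l with
  | zero => simp
  | succ l ih =>
    rw [Finset.sum_range_succ]
    exact (measure_mono Ico_subset_Ico_union_Ico).trans
      ((measure_union_le _ _).trans (add_le_add_left ih _))

theorem exists_gapEnergy_le_tsum {q : ℝ} (hq : 0 < q) : ∃ c : ℝ≥0∞, c ≠ ⊤ ∧
    ∀ (μ ω : Measure ℝ) (x : ℕ → ℝ), StrictMono x →
      (∀ φ : ℝ → ℝ≥0∞, ∫⁻ t, φ t ∂ω ≤
        ∑' k, ∫⁻ t in disjointed (fun k => Iio (x k)) k, φ t ∂ω) →
      (∀ k, ω (disjointed (fun k => Iio (x k)) k) ≤ ω univ * 2⁻¹ ^ k) →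
      ∀ k, gapEnergy q μ ω (x k) ≤
        c * ∑' l, ω univ * 2⁻¹ ^ (k + l + 1) * μ (Ico (x (k + l)) (x (k + l + 1))) ^ q := by
  obtain ⟨c, hc, h⟩ := ENNReal.exists_tsum_sum_range_rpow_mul_le hq
  refine ⟨c, hc, fun μ ω x hx hdec hmass k => ?_⟩
  set W := ω univ
  have hPm : ∀ i, MeasurableSet (disjointed (fun k => Iio (x k)) i) :=
    MeasurableSet.disjointed fun _ => measurableSet_Iio
  calc gapEnergy q μ ω (x k) ≤ ∫⁻ s, μ (Ico (x k) s) ^ q ∂ω := setLIntegral_le_lintegral _ _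
    _ ≤ ∑' i, ∫⁻ s in disjointed (fun k => Iio (x k)) i, μ (Ico (x k) s) ^ q ∂ω := hdec _
    _ ≤ ∑' i, μ (Ico (x k) (x i)) ^ q * (W * 2⁻¹ ^ i) := by
        refine ENNReal.tsum_le_tsum fun i => ?_
        refine le_trans ?_ (mul_le_mul_right (hmass i) _)
        rw [← setLIntegral_const]
        refine setLIntegral_mono' (hPm i) fun s hs => ?_
        have hs' : s < x i := disjointed_subset (fun k => Iio (x k)) i hs
        gcongr
    _ = ∑' l, μ (Ico (x k) (x (l + (k + 1)))) ^ q * (W * 2⁻¹ ^ (l + (k + 1))) := by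
        rw [← Summable.sum_add_tsum_nat_add' (k := k + 1) ENNReal.summable, Finset.sum_eq_zero,
          zero_add]
        intro i hi
        rw [Ico_eq_empty (not_lt.2 (hx.monotone (Nat.lt_succ_iff.1 (Finset.mem_range.1 hi))))]
        simp [hq]
    _ ≤ ∑' l, W * 2⁻¹ ^ (k + 1) *
        ((∑ j ∈ Finset.range (l + 1), μ (Ico (x (k + j)) (x (k + j + 1)))) ^ q * 2⁻¹ ^ l) := by
        refine ENNReal.tsum_le_tsum fun l => ?_
        have h1 := measure_Ico_le_sum μ (fun j => x (k + j)) l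
        rw [pow_add, mul_left_comm, ← mul_assoc, ← mul_assoc, ← mul_assoc]
        rw [show l + (k + 1) = k + (l + 1) by ring]
        calc W * μ (Ico (x k) (x (k + (l + 1)))) ^ q * 2⁻¹ ^ l * 2⁻¹ ^ (k + 1)
            = W * 2⁻¹ ^ (k + 1) * μ (Ico (x k) (x (k + (l + 1)))) ^ q * 2⁻¹ ^ l := by ring
          _ ≤ _ := by gcongr; exact h1
    _ ≤ W * 2⁻¹ ^ (k + 1) * (c * ∑' l, μ (Ico (x (k + l)) (x (k + l + 1))) ^ q * 2⁻¹ ^ l) := by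
        rw [ENNReal.tsum_mul_left]
        exact mul_le_mul_right (h _) _
    _ = _ := by
        rw [mul_left_comm, ← ENNReal.tsum_mul_left]
        congr 1
        exact tsum_congr fun l => by ring

theorem exists_tsum_gapEnergy_rpow_mul_gapSup_le {p q : ℝ} (hq : 0 < q) (hqp : q < p) :
    ∃ c : ℝ≥0∞, c ≠ ⊤ ∧ ∀ (μ ω ν : Measure ℝ) [IsFiniteMeasure μ] [IsFiniteMeasure ω]
      (δ Λ : ℝ≥0∞), δ ≠ 0 → TailLower δ μ ν → (∀ f : ℝ → ℝ≥0∞, Monotone f →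
        ∫⁻ x, (∫⁻ t in Iio x, f t ∂μ) ^ q ∂ω ≤ Λ * (∫⁻ t, f t ^ p ∂ν) ^ (q / p)) →
      ∀ x : ℕ → ℝ, StrictMono x →
      (∀ φ : ℝ → ℝ≥0∞, ∫⁻ t, φ t ∂ω ≤
        ∑' k, ∫⁻ t in disjointed (fun k => Iio (x k)) k, φ t ∂ω) →
      (∀ k, ω (disjointed (fun k => Iio (x k)) k) ≤ ω univ * 2⁻¹ ^ k) →
      (∀ F : ℝ → ℝ≥0∞, Monotone F →
        ∑' k, F (x k) * (ω univ * 2⁻¹ ^ k) ≤ 4 * ∫⁻ t, F t ∂ω) →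
      ∑' k, gapEnergy q μ ω (x k) ^ (q / (p - q)) * gapSup q (q / (p - q)) μ ν (x k) *
        (ω univ * 2⁻¹ ^ k) ≤ c * Λ ^ (p / (p - q)) := by
  have hp0 : 0 < p := hq.trans hqp
  have hpq : 0 < p - q := sub_pos.2 hqp
  obtain ⟨c, hc, hgap⟩ := exists_gapEnergy_le_tsum hq
  set β := q / (p - q) with hβ
  have hβ0 : 0 < β := by positivity
  refine ⟨2 * c ^ β * (ENNReal.ofReal (p / q) ^ β * 8 ^ (p / (p - q))), by finiteness, ?_⟩
  intro μ ω ν _ _ δ Λ hδ hμ H x hx hdec hmass hsum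
  set W := ω univ with hW
  have hWt : W ≠ ⊤ := measure_ne_top _ _
  choose t ht hN using fun k => hμ.exists_gapSup_le hδ hq hβ0.le (x k)
  set m : ℕ → ℝ≥0∞ := fun k => W * 2⁻¹ ^ k * μ (Ico (t k) (x k)) ^ q with hm
  set n : ℕ → ℝ≥0∞ := fun k => W * 2⁻¹ ^ (k + 1) * μ (Ico (x k) (x (k + 1))) ^ q with hn
  set κ : Measure ℝ := Measure.sum fun k => m k • Measure.dirac (t k) with hκ
  set η : Measure ℝ := Measure.sum fun k => n k • Measure.dirac (x k) with hη
  have hkey : ∀ s y z : ℝ, ∀ A : ℝ≥0∞, s ≤ y → A * μ (Ico y z) ^ q ≠ 0 → δ ≤ ν (Ici y) := by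
    intro s y z A _ h
    refine hμ y fun h0 => h ?_
    rw [measure_mono_null (fun r hr => hr.1 : Ico y z ⊆ Ici y) h0, ENNReal.zero_rpow_of_pos hq,
      mul_zero]
  have hlow : TailLower δ (κ + η) ν :=
    (tailLower_sum_smul_dirac fun k => hkey (t k) (t k) _ _ le_rfl).add
      (tailLower_sum_smul_dirac fun k => hkey (x k) (x k) _ _ le_rfl)
  have hMt : μ univ ^ q ≠ ⊤ := ENNReal.rpow_ne_top_of_nonneg hq.le (measure_ne_top _ _)
  have hfinsum : ∑' k : ℕ, W * 2⁻¹ ^ k * μ univ ^ q ≠ ⊤ := by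
    rw [ENNReal.tsum_mul_right, tsum_mul_two_inv_pow]
    finiteness
  have hκfin : IsFiniteMeasure κ := by
    refine isFiniteMeasure_sum_smul_dirac _ (ne_top_of_le_ne_top hfinsum ?_)
    refine ENNReal.tsum_le_tsum fun k => ?_
    simp only [hm]
    gcongr
    exact subset_univ _
  have hηfin : IsFiniteMeasure η := by
    refine isFiniteMeasure_sum_smul_dirac _ (ne_top_of_le_ne_top hfinsum ?_)
    refine (ENNReal.tsum_le_tsum fun k => ?_).trans (ENNReal.tsum_comp_le_tsum_of_injective
      (f := fun k : ℕ => k + 1) (add_left_injective 1) fun k : ℕ => W * 2⁻¹ ^ k * μ univ ^ q)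
    simp only [hn]
    gcongr
    exact subset_univ _
  have hG : ∀ k, gapEnergy q μ ω (x k) ≤ c * (κ + η) (Ici (t k)) := fun k => by
    refine (hgap μ ω x hx hdec hmass k).trans (mul_le_mul_right ?_ _)
    calc ∑' l, W * 2⁻¹ ^ (k + l + 1) * μ (Ico (x (k + l)) (x (k + l + 1))) ^ q
        = ∑' l, n (k + l) * Measure.dirac (x (k + l)) (Ici (t k)) := by
          refine tsum_congr fun l => ?_
          have : x (k + l) ∈ Ici (t k) := (ht k).le.trans (hx.monotone (Nat.le_add_right k l))
          rw [Measure.dirac_apply' _ measurableSet_Ici, indicator_of_mem this]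
          simp [hn]
      _ ≤ ∑' i, n i * Measure.dirac (x i) (Ici (t k)) :=
          ENNReal.tsum_comp_le_tsum_of_injective (add_right_injective k)
            fun i => n i * Measure.dirac (x i) (Ici (t k))
      _ = η (Ici (t k)) := by
          rw [hη, Measure.sum_apply _ measurableSet_Ici]
          simp only [Measure.smul_apply, smul_eq_mul]
      _ ≤ _ := by rw [Measure.add_apply]; exact le_add_self
  have hK := hlow.tailRatioSup_ne_top hδ
  have hKfin : ∫⁻ s, tailRatioSup (κ + η) ν s ^ β ∂(κ + η) ≠ ⊤ := by
    refine ne_top_of_le_ne_top (b := ((κ + η) univ / δ) ^ β * (κ + η) univ) ?_ ?_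
    · exact ENNReal.mul_ne_top (ENNReal.rpow_ne_top_of_nonneg hβ0.le
        (ENNReal.div_ne_top (measure_ne_top _ _) hδ)) (measure_ne_top _ _)
    · rw [← lintegral_const]
      exact lintegral_mono fun s => ENNReal.rpow_le_rpow (iSup₂_le fun r _ => hlow.div_le r) hβ0.le
  have hemb : ∀ f : ℝ → ℝ≥0∞, Monotone f →
      ∫⁻ s, f s ^ q ∂(κ + η) ≤ 8 * Λ * (∫⁻ s, f s ^ p ∂ν) ^ (q / p) := fun f hf => by
    set F : ℝ → ℝ≥0∞ := fun y => (∫⁻ s in Iio y, f s ∂μ) ^ q with hF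
    have hFm : Monotone F := fun y z hyz =>
      ENNReal.rpow_le_rpow (lintegral_mono_set (Iio_subset_Iio hyz)) hq.le
    have hcell : ∀ y z, μ (Ico y z) ^ q * f y ^ q ≤ F z := fun y z => by
      rw [← ENNReal.mul_rpow_of_nonneg _ _ hq.le, mul_comm, ← setLIntegral_const]
      refine ENNReal.rpow_le_rpow ?_ hq.le
      refine (setLIntegral_mono' measurableSet_Ico fun s hs => hf hs.1).trans ?_
      exact lintegral_mono_set fun s hs => hs.2
    have h1 : ∫⁻ s, f s ^ q ∂κ ≤ ∑' k, F (x k) * (W * 2⁻¹ ^ k) := by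
      rw [hκ, lintegral_sum_smul_dirac]
      refine ENNReal.tsum_le_tsum fun k => ?_
      rw [hm, mul_assoc, mul_comm]
      exact mul_le_mul_left (hcell _ _) _
    have h2 : ∫⁻ s, f s ^ q ∂η ≤ ∑' k, F (x k) * (W * 2⁻¹ ^ k) := by
      rw [hη, lintegral_sum_smul_dirac]
      refine (ENNReal.tsum_le_tsum fun k => ?_).trans (ENNReal.tsum_comp_le_tsum_of_injective
        (f := fun k : ℕ => k + 1) (add_left_injective 1) fun k : ℕ => F (x k) * (W * 2⁻¹ ^ k))
      rw [hn, mul_assoc, mul_comm]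
      exact mul_le_mul_left (hcell _ _) _
    rw [lintegral_add_measure]
    calc ∫⁻ s, f s ^ q ∂κ + ∫⁻ s, f s ^ q ∂η
        ≤ 4 * ∫⁻ y, F y ∂ω + 4 * ∫⁻ y, F y ∂ω :=
          add_le_add (h1.trans (hsum F hFm)) (h2.trans (hsum F hFm))
      _ = 8 * ∫⁻ y, F y ∂ω := by rw [← add_mul]; norm_num
      _ ≤ 8 * (Λ * (∫⁻ s, f s ^ p ∂ν) ^ (q / p)) := by gcongr; exact H f hf
      _ = _ := (mul_assoc _ _ _).symm
  have hmain := lintegral_rpow_tailRatioSup_le_of_embedding hq hqp (κ + η) ν hK hKfin hemb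
  calc ∑' k, gapEnergy q μ ω (x k) ^ β * gapSup q β μ ν (x k) * (W * 2⁻¹ ^ k)
      ≤ ∑' k, 2 * c ^ β * (m k * ((κ + η) (Ici (t k)) / ν (Ici (t k))) ^ β) := by
        refine ENNReal.tsum_le_tsum fun k => ?_
        rw [ENNReal.div_rpow_of_nonneg _ _ hβ0.le, div_eq_mul_inv, ← ENNReal.rpow_neg]
        calc gapEnergy q μ ω (x k) ^ β * gapSup q β μ ν (x k) * (W * 2⁻¹ ^ k)
            ≤ (c * (κ + η) (Ici (t k))) ^ β *
              (2 * (μ (Ico (t k) (x k)) ^ q * ν (Ici (t k)) ^ (-β))) * (W * 2⁻¹ ^ k) := by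
              gcongr
              · exact hG k
              · exact hN k
          _ = _ := by
              rw [ENNReal.mul_rpow_of_nonneg _ _ hβ0.le, hm]
              ring
    _ = 2 * c ^ β * ∫⁻ s, ((κ + η) (Ici s) / ν (Ici s)) ^ β ∂κ := by
        rw [ENNReal.tsum_mul_left, hκ, lintegral_sum_smul_dirac]
    _ ≤ 2 * c ^ β * ∫⁻ s, tailRatioSup (κ + η) ν s ^ β ∂(κ + η) := by
        refine mul_le_mul_right (lintegral_mono' (Measure.le_add_right le_rfl) fun s => ?_) _
        exact ENNReal.rpow_le_rpow (le_tailRatioSup _ _ s) hβ0.le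
    _ ≤ 2 * c ^ β * (ENNReal.ofReal (p / q) ^ β * (8 * Λ) ^ (p / (p - q))) := by gcongr
    _ = _ := by
        rw [ENNReal.mul_rpow_of_nonneg _ _ (by positivity)]
        ring

theorem setLIntegral_gapEnergy_rpow_mul_gapSup_le {p q : ℝ} (hq : 0 < q) (hqp : q < p)
    (hp1 : 1 < p) (μ ω ν : Measure ℝ) [IsFiniteMeasure μ] {P : Set ℝ} (hP : MeasurableSet P)
    {z : ℝ} {M : ℝ≥0∞} (hPz : P ⊆ Iio z) (hM : ∀ t ∈ P, ω (Ici t) ≤ M) (hPM : ω P ≤ M) :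
    ∫⁻ y in P, gapEnergy q μ ω y ^ (q / (p - q)) * gapSup q (q / (p - q)) μ ν y ∂ω ≤
      (2 ^ q * 2) ^ (q / (p - q)) * (2 ^ (q * (q / (p - q) + 1)) * (M ^ (q / (p - q) + 1) *
        tailEnergy (1 / (p - 1)) (μ.restrict (Iio z)) ν ^ (q * (p - 1) / (p - q))) +
        gapEnergy q μ ω z ^ (q / (p - q)) * gapSup q (q / (p - q)) μ ν z * M) := by
  have hpq : 0 < p - q := sub_pos.2 hqp
  set β := q / (p - q) with hβ
  have hβ0 : 0 < β := by positivity
  set E := tailEnergy (1 / (p - 1)) (μ.restrict (Iio z)) ν ^ (q * (p - 1) / (p - q)) with hE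
  have hsup : ∀ y ∈ P, μ (Ico y z) ^ (q * β) * gapSup q β μ ν y ≤ 2 ^ (q * (β + 1)) * E := by
    intro y hy
    have hyz : y < z := hPz hy
    rw [gapSup, ENNReal.mul_iSup]
    refine iSup_le fun t => ?_
    rw [ENNReal.mul_iSup]
    refine iSup_le fun hty => ?_
    have h := rpow_measure_Ici_mul_le_tailEnergy_rpow hq hqp hp1 (μ.restrict (Iio z)) ν t
    rw [Measure.restrict_apply measurableSet_Ici, Ici_inter_Iio] at h
    refine le_trans ?_ h
    rw [← mul_assoc]
    refine mul_le_mul_left ?_ _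
    rw [mul_add, mul_one, ENNReal.rpow_add_of_nonneg _ _ (by positivity) hq.le]
    have h1 : t ≤ y := (mem_Iio.1 hty).le
    gcongr
  have hgap : ∀ y ∈ P, gapEnergy q μ ω y ≤ 2 ^ q * (μ (Ico y z) ^ q * M + gapEnergy q μ ω z) := by
    intro y hy
    have hyz : y < z := hPz hy
    calc gapEnergy q μ ω y
        ≤ ∫⁻ s in Ici y, 2 ^ q * (μ (Ico y z) ^ q + μ (Ico z s) ^ q) ∂ω := by
          refine lintegral_mono fun s => ?_
          refine le_trans (ENNReal.rpow_le_rpow ?_ hq.le)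
            (ENNReal.add_rpow_le_two_rpow_mul _ _ hq.le)
          exact (measure_mono Ico_subset_Ico_union_Ico).trans (measure_union_le _ _)
      _ = 2 ^ q * (μ (Ico y z) ^ q * ω (Ici y) + ∫⁻ s in Ici y, μ (Ico z s) ^ q ∂ω) := by
          rw [lintegral_const_mul' _ _ (by finiteness), lintegral_add_left measurable_const,
            setLIntegral_const]
      _ ≤ _ := by
          gcongr
          · exact hM y hy
          · rw [gapEnergy, ← lintegral_indicator (s := Ici z) measurableSet_Ici]
            refine (setLIntegral_le_lintegral _ _).trans (lintegral_mono fun s => ?_)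
            by_cases hs : s ∈ Ici z
            · rw [indicator_of_mem hs]
            · rw [Ico_eq_empty (not_lt.2 (not_le.1 hs).le)]
              simp [hq]
  calc ∫⁻ y in P, gapEnergy q μ ω y ^ β * gapSup q β μ ν y ∂ω
      ≤ ∫⁻ y in P, (2 ^ q * 2) ^ β * (M ^ β * (2 ^ (q * (β + 1)) * E) +
          gapEnergy q μ ω z ^ β * gapSup q β μ ν z) ∂ω := by
        refine setLIntegral_mono' hP fun y hy => ?_
        have h1 : gapEnergy q μ ω y ^ β ≤ (2 ^ q * 2) ^ β *
            (μ (Ico y z) ^ (q * β) * M ^ β + gapEnergy q μ ω z ^ β) := by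
          refine (ENNReal.rpow_le_rpow (hgap y hy) hβ0.le).trans ?_
          rw [ENNReal.mul_rpow_of_nonneg _ _ hβ0.le, ENNReal.mul_rpow_of_nonneg _ _ hβ0.le,
            ENNReal.rpow_mul _ q β, ← ENNReal.mul_rpow_of_nonneg _ M hβ0.le, mul_assoc]
          exact mul_le_mul_right (ENNReal.add_rpow_le_two_rpow_mul _ _ hβ0.le) _
        have h2 : gapSup q β μ ν y ≤ gapSup q β μ ν z := gapSup_mono hq.le μ ν (hPz hy).le
        calc gapEnergy q μ ω y ^ β * gapSup q β μ ν y
            ≤ (2 ^ q * 2) ^ β * (μ (Ico y z) ^ (q * β) * M ^ β + gapEnergy q μ ω z ^ β) *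
              gapSup q β μ ν y := by gcongr
          _ = (2 ^ q * 2) ^ β * (M ^ β * (μ (Ico y z) ^ (q * β) * gapSup q β μ ν y) +
              gapEnergy q μ ω z ^ β * gapSup q β μ ν y) := by ring
          _ ≤ _ := by gcongr _ * (_ * ?_ + _ * ?_); exact hsup y hy
    _ ≤ (2 ^ q * 2) ^ β * (M ^ β * (2 ^ (q * (β + 1)) * E) +
          gapEnergy q μ ω z ^ β * gapSup q β μ ν z) * M := by
        rw [setLIntegral_const]
        exact mul_le_mul_right hPM _
    _ = _ := by
        rw [ENNReal.rpow_add_of_nonneg _ _ hβ0.le zero_le_one, ENNReal.rpow_one]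
        ring

/-- The Hardy inequality for non-decreasing functions bounds the constants from above. -/
theorem exists_gapConst_add_tailConst_le {p q : ℝ} (hq : 0 < q) (hqp : q < p) (hp1 : 1 < p) :
    ∃ c : ℝ≥0∞, c ≠ ⊤ ∧ ∀ (μ ω ν : Measure ℝ) [IsFiniteMeasure μ] [IsFiniteMeasure ω]
      [NullSingletonClass ω] (δ Λ : ℝ≥0∞), δ ≠ 0 → TailLower δ μ ν →
      (∀ f : ℝ → ℝ≥0∞, Monotone f →
        ∫⁻ x, (∫⁻ t in Iio x, f t ∂μ) ^ q ∂ω ≤ Λ * (∫⁻ t, f t ^ p ∂ν) ^ (q / p)) →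
      gapConst p q μ ω ν + tailConst p q μ ω ν ≤ c * Λ ^ (p / (p - q)) := by
  have hp : 0 < p - 1 := sub_pos.2 hp1
  have hp0 : 0 < p := hq.trans hqp
  have hpq : 0 < p - q := sub_pos.2 hqp
  obtain ⟨c, hc, hS3⟩ := exists_tsum_gapEnergy_rpow_mul_gapSup_le hq hqp
  set β := q / (p - q) with hβ
  set γ := q * (p - 1) / (p - q) with hγ
  have hβ0 : 0 < β := by positivity
  have hγ0 : 0 < γ := by positivity
  have hr0 : 0 ≤ p / (p - q) := by positivity
  set d : ℝ≥0∞ := (4 * ENNReal.ofReal p ^ (q / p)) ^ (p / (p - q)) with hd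
  have hdt : d ≠ ⊤ := by finiteness
  refine ⟨(2 ^ q * 2) ^ β * (2 ^ (q * (β + 1)) * d + c) + d, by finiteness, ?_⟩
  intro μ ω ν _ _ _ δ Λ hδ hμ H
  by_cases h0 : ω univ = 0
  · rw [Measure.measure_univ_eq_zero.1 h0]
    simp [gapConst, tailConst]
  obtain ⟨x, hx, hdec, hIci, hmass, hsum⟩ := exists_seq_dyadic_tail ω h0
  have hPm : ∀ i, MeasurableSet (disjointed (fun k => Iio (x k)) i) :=
    MeasurableSet.disjointed fun _ => measurableSet_Iio
  have hPx : ∀ i, disjointed (fun k => Iio (x k)) i ⊆ Iio (x i) := fun i y hy =>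
    disjointed_subset (fun k => Iio (x k)) i hy
  have hT := tsum_rpow_mul_tailEnergy_rpow_le hq hqp hp1 hδ hμ H hsum
  have hT' : (4 * Λ * ENNReal.ofReal p ^ (q / p)) ^ (p / (p - q)) = d * Λ ^ (p / (p - q)) := by
    rw [hd, ← ENNReal.mul_rpow_of_nonneg _ _ hr0]
    congr 1
    ring
  rw [hT'] at hT
  have htail : tailConst p q μ ω ν ≤ d * Λ ^ (p / (p - q)) := by
    refine (hdec _).trans (le_trans (ENNReal.tsum_le_tsum fun k => ?_) hT)
    set E := tailEnergy (1 / (p - 1)) (μ.restrict (Iio (x k))) ν ^ γ with hE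
    calc ∫⁻ y in disjointed (fun k => Iio (x k)) k, ω (Ici y) ^ β *
          tailEnergy (1 / (p - 1)) (μ.restrict (Iio y)) ν ^ γ ∂ω
        ≤ ∫⁻ y in disjointed (fun k => Iio (x k)) k, (ω univ * 2⁻¹ ^ k) ^ β * E ∂ω := by
          refine setLIntegral_mono' (hPm k) fun y hy => ?_
          gcongr
          · exact hIci k y hy
          · refine ENNReal.rpow_le_rpow (tailEnergy_mono (by positivity) ?_ ν) hγ0.le
            exact Measure.restrict_mono (Iio_subset_Iio (mem_Iio.1 (hPx k hy)).le) le_rfl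
      _ ≤ (ω univ * 2⁻¹ ^ k) ^ β * E * (ω univ * 2⁻¹ ^ k) := by
          rw [setLIntegral_const]
          exact mul_le_mul_right (hmass k) _
      _ = _ := by
          rw [ENNReal.rpow_add_of_nonneg _ _ hβ0.le zero_le_one, ENNReal.rpow_one]
          exact mul_right_comm _ _ _
  have hgap : gapConst p q μ ω ν ≤ (2 ^ q * 2) ^ β * (2 ^ (q * (β + 1)) * d + c) *
      Λ ^ (p / (p - q)) := by
    calc gapConst p q μ ω ν
        ≤ ∑' k, ∫⁻ y in disjointed (fun k => Iio (x k)) k,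
          gapEnergy q μ ω y ^ β * gapSup q β μ ν y ∂ω := hdec _
      _ ≤ ∑' k, (2 ^ q * 2) ^ β * (2 ^ (q * (β + 1)) * ((ω univ * 2⁻¹ ^ k) ^ (β + 1) *
          tailEnergy (1 / (p - 1)) (μ.restrict (Iio (x k))) ν ^ γ) +
          gapEnergy q μ ω (x k) ^ β * gapSup q β μ ν (x k) * (ω univ * 2⁻¹ ^ k)) :=
          ENNReal.tsum_le_tsum fun k => setLIntegral_gapEnergy_rpow_mul_gapSup_le hq hqp hp1 μ ω ν
            (hPm k) (hPx k) (hIci k) (hmass k)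
      _ ≤ (2 ^ q * 2) ^ β * (2 ^ (q * (β + 1)) * (d * Λ ^ (p / (p - q))) +
          c * Λ ^ (p / (p - q))) := by
          rw [ENNReal.tsum_mul_left, ENNReal.tsum_add, ENNReal.tsum_mul_left]
          gcongr
          exact hS3 μ ω ν δ Λ hδ hμ H x hx hdec hmass hsum
      _ = _ := by ring
  calc gapConst p q μ ω ν + tailConst p q μ ω ν
      ≤ (2 ^ q * 2) ^ β * (2 ^ (q * (β + 1)) * d + c) * Λ ^ (p / (p - q)) +
        d * Λ ^ (p / (p - q)) := add_le_add hgap htail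
    _ = _ := by ring

theorem iSup_mul_iSup_of_monotone_nat {f g : ℕ → ℝ≥0∞} (hf : Monotone f) (hg : Monotone g) :
    (⨆ n, f n) * ⨆ n, g n = ⨆ n, f n * g n := by
  refine le_antisymm ?_ (iSup_le fun n => mul_le_mul' (le_iSup f n) (le_iSup g n))
  rw [ENNReal.iSup_mul]
  refine iSup_le fun i => ?_
  rw [ENNReal.mul_iSup]
  refine iSup_le fun j => le_trans ?_ (le_iSup _ (max i j))
  exact mul_le_mul' (hf (le_max_left i j)) (hg (le_max_right i j))

theorem iSup_rpow_eq {q : ℝ} (hq : 0 < q) {ι : Sort*} (f : ι → ℝ≥0∞) :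
    (⨆ n, f n) ^ q = ⨆ n, f n ^ q :=
  (ENNReal.orderIsoRpow q hq).map_iSup f

/-- The measure `μ'` is the increasing setwise limit of the sequence `μ`. -/
structure IsMonotoneLimit (μ : ℕ → Measure ℝ) (μ' : Measure ℝ) : Prop where
  mono : Monotone μ
  apply_eq : ∀ s, MeasurableSet s → μ' s = ⨆ n, μ n s

namespace IsMonotoneLimit

variable {μ ω : ℕ → Measure ℝ} {μ' ω' : Measure ℝ}

theorem le (h : IsMonotoneLimit μ μ') (n : ℕ) : μ n ≤ μ' :=
  Measure.le_iff.2 fun s hs => (le_iSup (fun n => μ n s) n).trans_eq (h.apply_eq s hs).symm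

theorem restrict (h : IsMonotoneLimit μ μ') {A : Set ℝ} (hA : MeasurableSet A) :
    IsMonotoneLimit (fun n => (μ n).restrict A) (μ'.restrict A) where
  mono _ _ hmn := Measure.restrict_mono le_rfl (h.mono hmn)
  apply_eq s hs := by
    simp only [Measure.restrict_apply hs]
    exact h.apply_eq _ (hs.inter hA)

theorem lintegral_eq (h : IsMonotoneLimit μ μ') (g : ℝ → ℝ≥0∞) :
    ∫⁻ t, g t ∂μ' = ⨆ n, ∫⁻ t, g t ∂μ n := by
  refine le_antisymm ?_ (iSup_le fun n => lintegral_mono' (h.le n) le_rfl)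
  rw [lintegral]
  refine iSup₂_le fun φ hφ => ?_
  have e : φ.lintegral μ' = ⨆ n, φ.lintegral (μ n) := by
    simp only [SimpleFunc.lintegral]
    rw [← ENNReal.finsetSum_iSup_of_monotone]
    · refine Finset.sum_congr rfl fun c _ => ?_
      rw [h.apply_eq _ (φ.measurableSet_preimage _), ENNReal.mul_iSup]
    · exact fun c m n hmn => mul_le_mul_right (h.mono hmn _) _
  rw [e]
  refine iSup_mono fun n => ?_
  rw [← SimpleFunc.lintegral_eq_lintegral]
  exact lintegral_mono hφ

theorem lintegral_iSup_eq (h : IsMonotoneLimit μ μ') {g : ℕ → ℝ → ℝ≥0∞}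
    (hg : ∀ n, Measurable (g n)) (hgm : Monotone g) :
    ∫⁻ t, ⨆ n, g n t ∂μ' = ⨆ n, ∫⁻ t, g n t ∂μ n := by
  rw [lintegral_iSup hg hgm]
  refine le_antisymm (iSup_le fun m => ?_) (iSup_le fun n => ?_)
  · rw [h.lintegral_eq]
    refine iSup_le fun n => le_trans ?_ (le_iSup _ (max m n))
    exact lintegral_mono' (h.mono (le_max_right m n)) (hgm (le_max_left m n))
  · exact (lintegral_mono' (h.le n) le_rfl).trans (le_iSup (fun n => ∫⁻ t, g n t ∂μ') n)

theorem gapEnergy_eq (h : IsMonotoneLimit μ μ') (h' : IsMonotoneLimit ω ω') {q : ℝ} (hq : 0 < q)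
    (x : ℝ) : gapEnergy q μ' ω' x = ⨆ n, gapEnergy q (μ n) (ω n) x := by
  simp only [gapEnergy]
  rw [← (h'.restrict measurableSet_Ici).lintegral_iSup_eq]
  · refine lintegral_congr fun s => ?_
    rw [h.apply_eq _ measurableSet_Ico, iSup_rpow_eq hq]
  · intro n
    have : Monotone fun s => μ n (Ico x s) ^ q := fun s s' hs =>
      ENNReal.rpow_le_rpow (measure_mono (Ico_subset_Ico_right hs)) hq.le
    exact this.measurable
  · exact fun m n hmn s => ENNReal.rpow_le_rpow (h.mono hmn _) hq.le

theorem gapSup_eq (h : IsMonotoneLimit μ μ') {q β : ℝ} (hq : 0 < q) (ν : Measure ℝ) (x : ℝ) :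
    gapSup q β μ' ν x = ⨆ n, gapSup q β (μ n) ν x := by
  simp only [gapSup]
  rw [iSup_comm]
  refine iSup_congr fun t => ?_
  rw [iSup_comm]
  refine iSup_congr fun ht => ?_
  rw [h.apply_eq _ measurableSet_Ico, iSup_rpow_eq hq, ENNReal.iSup_mul]

theorem tailEnergy_eq (h : IsMonotoneLimit μ μ') {b : ℝ} (hb : 0 < b) (ν : Measure ℝ) :
    tailEnergy b μ' ν = ⨆ n, tailEnergy b (μ n) ν := by
  simp only [tailEnergy]
  rw [← h.lintegral_iSup_eq]
  · refine lintegral_congr fun s => ?_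
    rw [h.apply_eq _ measurableSet_Ici, div_eq_mul_inv, ENNReal.iSup_mul, iSup_rpow_eq hb]
    simp only [div_eq_mul_inv]
  · exact fun n => ((measurable_measure_Ici _).div (measurable_measure_Ici _)).pow_const _
  · exact fun m n hmn s => ENNReal.rpow_le_rpow (ENNReal.div_le_div_right (h.mono hmn _) _) hb.le

theorem gapConst_eq (h : IsMonotoneLimit μ μ') (h' : IsMonotoneLimit ω ω') {p q : ℝ} (hq : 0 < q)
    (hqp : q < p) (ν : Measure ℝ) :
    gapConst p q μ' ω' ν = ⨆ n, gapConst p q (μ n) (ω n) ν := by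
  have hβ : 0 < q / (p - q) := div_pos hq (sub_pos.2 hqp)
  have hE : ∀ x, Monotone fun n => gapEnergy q (μ n) (ω n) x := fun x m n hmn =>
    lintegral_mono' (Measure.restrict_mono le_rfl (h'.mono hmn))
      fun s => ENNReal.rpow_le_rpow (h.mono hmn _) hq.le
  have hS : ∀ x, Monotone fun n => gapSup q (q / (p - q)) (μ n) ν x := fun x m n hmn =>
    iSup₂_mono fun t ht => mul_le_mul_left (ENNReal.rpow_le_rpow (h.mono hmn _) hq.le) _
  simp only [gapConst]
  rw [← h'.lintegral_iSup_eq]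
  · refine lintegral_congr fun x => ?_
    rw [h.gapEnergy_eq h' hq, h.gapSup_eq hq, iSup_rpow_eq hβ,
      iSup_mul_iSup_of_monotone_nat _ (hS x)]
    exact fun m n hmn => ENNReal.rpow_le_rpow (hE x hmn) hβ.le
  · intro n
    have hanti : Antitone (gapEnergy q (μ n) (ω n)) := fun x y hxy =>
      (lintegral_mono_set (Ici_subset_Ici.2 hxy)).trans (lintegral_mono fun s => by gcongr)
    exact (hanti.measurable.pow_const _).mul (gapSup_mono hq.le _ _).measurable
  · exact fun m n hmn x =>
      mul_le_mul' (ENNReal.rpow_le_rpow (hE x hmn) hβ.le) (hS x hmn)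

theorem tailConst_eq (h : IsMonotoneLimit μ μ') (h' : IsMonotoneLimit ω ω') {p q : ℝ} (hq : 0 < q)
    (hqp : q < p) (hp1 : 1 < p) (ν : Measure ℝ) :
    tailConst p q μ' ω' ν = ⨆ n, tailConst p q (μ n) (ω n) ν := by
  have hpq : 0 < p - q := sub_pos.2 hqp
  have hp : 0 < p - 1 := sub_pos.2 hp1
  have hβ : 0 < q / (p - q) := by positivity
  have hγ : 0 < q * (p - 1) / (p - q) := by positivity
  have hb : 0 < 1 / (p - 1) := by positivity
  have hE : ∀ x, Monotone fun n => tailEnergy (1 / (p - 1)) ((μ n).restrict (Iio x)) ν :=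
    fun x m n hmn => tailEnergy_mono hb.le (Measure.restrict_mono le_rfl (h.mono hmn)) ν
  simp only [tailConst]
  rw [← h'.lintegral_iSup_eq]
  · refine lintegral_congr fun x => ?_
    rw [h'.apply_eq _ measurableSet_Ici, (h.restrict measurableSet_Iio).tailEnergy_eq hb,
      iSup_rpow_eq hβ, iSup_rpow_eq hγ, iSup_mul_iSup_of_monotone_nat]
    · exact fun m n hmn => ENNReal.rpow_le_rpow (h'.mono hmn _) hβ.le
    · exact fun m n hmn => ENNReal.rpow_le_rpow (hE x hmn) hγ.le
  · intro n
    have hmono : Monotone fun x => tailEnergy (1 / (p - 1)) ((μ n).restrict (Iio x)) ν :=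
      fun x y hxy => tailEnergy_mono hb.le (Measure.restrict_mono (Iio_subset_Iio hxy) le_rfl) ν
    exact ((measurable_measure_Ici _).pow_const _).mul (hmono.measurable.pow_const _)
  · exact fun m n hmn x => mul_le_mul' (ENNReal.rpow_le_rpow (h'.mono hmn _) hβ.le)
      (ENNReal.rpow_le_rpow (hE x hmn) hγ.le)

theorem lintegral_rpow_setLIntegral_eq (h : IsMonotoneLimit μ μ') (h' : IsMonotoneLimit ω ω')
    {q : ℝ} (hq : 0 < q) (f : ℝ → ℝ≥0∞) :
    ∫⁻ x, (∫⁻ t in Iio x, f t ∂μ') ^ q ∂ω' = ⨆ n, ∫⁻ x, (∫⁻ t in Iio x, f t ∂μ n) ^ q ∂ω n := by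
  rw [← h'.lintegral_iSup_eq]
  · refine lintegral_congr fun x => ?_
    rw [(h.restrict measurableSet_Iio).lintegral_eq, iSup_rpow_eq hq]
  · intro n
    have hmono : Monotone fun x => (∫⁻ t in Iio x, f t ∂μ n) ^ q := fun x y hxy =>
      ENNReal.rpow_le_rpow (lintegral_mono_set (Iio_subset_Iio hxy)) hq.le
    exact hmono.measurable
  · exact fun m n hmn x => ENNReal.rpow_le_rpow
      (lintegral_mono' (Measure.restrict_mono le_rfl (h.mono hmn)) le_rfl) hq.le

end IsMonotoneLimit

theorem exists_lintegral_rpow_setLIntegral_Iio_le_of_isMonotoneLimit {p q : ℝ} (hq : 0 < q)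
    (hqp : q < p) (hp1 : 1 < p) : ∃ C : ℝ≥0∞, C ≠ ⊤ ∧
      ∀ (μ ω : ℕ → Measure ℝ) (μ' ω' ν : Measure ℝ), IsMonotoneLimit μ μ' →
      IsMonotoneLimit ω ω' → (∀ n, IsFiniteMeasure (μ n)) → (∀ n, IsFiniteMeasure (ω n)) →
      (∀ n, NullSingletonClass (μ n)) → (∀ n, ∃ δ ≠ 0, TailLower δ (μ n) ν) →
      ∀ f : ℝ → ℝ≥0∞, Monotone f → ∫⁻ t, f t ^ p ∂ν ≠ ⊤ →
        ∫⁻ x, (∫⁻ t in Iio x, f t ∂μ') ^ q ∂ω' ≤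
          C * (gapConst p q μ' ω' ν + tailConst p q μ' ω' ν) ^ ((p - q) / p) *
            (∫⁻ t, f t ^ p ∂ν) ^ (q / p) := by
  obtain ⟨C, hC, h⟩ := exists_lintegral_rpow_setLIntegral_Iio_le hq hqp hp1
  refine ⟨C, hC, fun μ ω μ' ω' ν hμ hω hμfin hωfin hμ0 hlow f hf hfin => ?_⟩
  have hr : 0 ≤ (p - q) / p := div_nonneg (sub_pos.2 hqp).le (hq.trans hqp).le
  rw [hμ.lintegral_rpow_setLIntegral_eq hω hq]
  refine iSup_le fun n => ?_
  obtain ⟨δ, hδ, hδn⟩ := hlow n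
  refine (h (μ n) (ω n) ν δ hδ hδn f hf hfin).trans ?_
  gcongr
  · rw [hμ.gapConst_eq hω hq hqp]
    exact le_iSup (fun n => gapConst p q (μ n) (ω n) ν) n
  · rw [hμ.tailConst_eq hω hq hqp hp1]
    exact le_iSup (fun n => tailConst p q (μ n) (ω n) ν) n

theorem exists_gapConst_le_and_tailConst_le_of_isMonotoneLimit {p q : ℝ} (hq : 0 < q)
    (hqp : q < p) (hp1 : 1 < p) : ∃ c : ℝ≥0∞, c ≠ ⊤ ∧
      ∀ (μ ω : ℕ → Measure ℝ) (μ' ω' ν : Measure ℝ), IsMonotoneLimit μ μ' →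
      IsMonotoneLimit ω ω' → (∀ n, IsFiniteMeasure (μ n)) → (∀ n, IsFiniteMeasure (ω n)) →
      (∀ n, NullSingletonClass (ω n)) → (∀ n, ∃ δ ≠ 0, TailLower δ (μ n) ν) →
      ∀ Λ : ℝ≥0∞, (∀ f : ℝ → ℝ≥0∞, Monotone f →
        ∫⁻ x, (∫⁻ t in Iio x, f t ∂μ') ^ q ∂ω' ≤ Λ * (∫⁻ t, f t ^ p ∂ν) ^ (q / p)) →
      gapConst p q μ' ω' ν ≤ c * Λ ^ (p / (p - q)) ∧
        tailConst p q μ' ω' ν ≤ c * Λ ^ (p / (p - q)) := by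
  obtain ⟨c, hc, h⟩ := exists_gapConst_add_tailConst_le hq hqp hp1
  refine ⟨c, hc, fun μ ω μ' ω' ν hμ hω hμfin hωfin hω0 hlow Λ H => ?_⟩
  have hn : ∀ n, gapConst p q (μ n) (ω n) ν + tailConst p q (μ n) (ω n) ν ≤
      c * Λ ^ (p / (p - q)) := fun n => by
    obtain ⟨δ, hδ, hδn⟩ := hlow n
    refine h (μ n) (ω n) ν δ Λ hδ hδn fun f hf => le_trans ?_ (H f hf)
    rw [hμ.lintegral_rpow_setLIntegral_eq hω hq]
    exact le_iSup (fun n => ∫⁻ x, (∫⁻ t in Iio x, f t ∂μ n) ^ q ∂ω n) n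
  rw [hμ.gapConst_eq hω hq hqp, hμ.tailConst_eq hω hq hqp hp1]
  exact ⟨iSup_le fun n => le_self_add.trans (hn n), iSup_le fun n => le_add_self.trans (hn n)⟩

theorem exists_isMonotoneLimit_withDensity {u : ℝ → ℝ≥0∞} (hu : Measurable u) {D : Set ℝ}
    (hD : MeasurableSet D) {ν : Measure ℝ} (hν : ∀ t ∈ D, ν (Ici t) ≠ 0) :
    ∃ μ : ℕ → Measure ℝ, IsMonotoneLimit μ (volume.withDensity (D.indicator u)) ∧
      (∀ n, IsFiniteMeasure (μ n)) ∧ (∀ n, NullSingletonClass (μ n)) ∧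
      ∀ n, ∃ δ ≠ 0, TailLower δ (μ n) ν := by
  set T : ℕ → Set ℝ := fun n =>
    D ∩ (Icc (-(n : ℝ)) n ∩ (fun t => ν (Ici t)) ⁻¹' Ici (n : ℝ≥0∞)⁻¹) with hT
  have hTm : ∀ n, MeasurableSet (T n) := fun n => hD.inter (measurableSet_Icc.inter
    (measurable_measure_Ici ν measurableSet_Ici))
  have hTiff : ∀ n t, t ∈ T n ↔ t ∈ D ∧ (-(n : ℝ) ≤ t ∧ t ≤ n) ∧ (n : ℝ≥0∞)⁻¹ ≤ ν (Ici t) :=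
    fun n t => by simp only [hT, mem_inter_iff, mem_Icc, mem_preimage, mem_Ici]
  have hTmono : Monotone T := fun m n hmn t ht => by
    have hmn' : (m : ℝ) ≤ n := Nat.cast_le.2 hmn
    rw [hTiff] at ht ⊢
    refine ⟨ht.1, ⟨by linarith [ht.2.1.1], by linarith [ht.2.1.2]⟩, le_trans ?_ ht.2.2⟩
    exact ENNReal.inv_le_inv.2 (Nat.cast_le.2 hmn)
  set g : ℕ → ℝ → ℝ≥0∞ := fun n => (T n).indicator fun t => min (u t) n with hg
  have hgm : ∀ n, Measurable (g n) := fun n => (hu.min measurable_const).indicator (hTm n)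
  have hgmono : Monotone g := fun m n hmn t => by
    refine (indicator_le_indicator_of_subset (hTmono hmn) (fun _ => zero_le) t).trans ?_
    exact indicator_le_indicator (min_le_min_left _ (Nat.cast_le.2 hmn))
  have hsup : ∀ t, D.indicator u t = ⨆ n, g n t := fun t => by
    by_cases ht : t ∈ D
    · rw [indicator_of_mem ht]
      refine le_antisymm (le_of_forall_lt fun c hc => ?_) (iSup_le fun n => ?_)
      · obtain ⟨n₁, h₁⟩ := exists_nat_ge |t|
        obtain ⟨n₂, h₂⟩ := ENNReal.exists_inv_nat_lt (hν t ht)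
        obtain ⟨n₃, h₃⟩ := ENNReal.exists_nat_gt hc.ne_top
        set N := max n₁ (max n₂ n₃) with hN
        have hN₁ : (n₁ : ℝ) ≤ N := Nat.cast_le.2 (le_max_left _ _)
        have hN₂ : (n₂ : ℝ≥0∞) ≤ N :=
          Nat.cast_le.2 ((le_max_left n₂ n₃).trans (le_max_right _ _))
        have hN₃ : (n₃ : ℝ≥0∞) ≤ N :=
          Nat.cast_le.2 ((le_max_right n₂ n₃).trans (le_max_right _ _))
        have hmem : t ∈ T N := (hTiff N t).2 ⟨ht, abs_le.1 (h₁.trans hN₁),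
          (ENNReal.inv_le_inv.2 hN₂).trans h₂.le⟩
        refine lt_of_lt_of_le ?_ (le_iSup _ N)
        rw [hg]
        simp only [indicator_of_mem hmem]
        exact lt_min hc (h₃.trans_le hN₃)
      · exact indicator_apply_le fun _ => min_le_left _ _
    · rw [indicator_of_notMem ht]
      exact (ENNReal.iSup_eq_zero.2 fun n =>
        indicator_of_notMem (fun h => ht ((hTiff n t).1 h).1) _).symm
  refine ⟨fun n => volume.withDensity (g n), ⟨fun m n hmn => ?_, fun s hs => ?_⟩, fun n => ?_,
    fun n => ?_, fun n => ⟨(n : ℝ≥0∞)⁻¹, by simp, fun t ht => ?_⟩⟩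
  · exact withDensity_mono (Filter.Eventually.of_forall (hgmono hmn))
  · rw [withDensity_apply _ hs, lintegral_congr hsup, lintegral_iSup hgm hgmono]
    exact iSup_congr fun n => (withDensity_apply _ hs).symm
  · refine isFiniteMeasure_withDensity (ne_top_of_le_ne_top
      (b := (n : ℝ≥0∞) * volume (Icc (-(n : ℝ)) n)) ?_ ?_)
    · rw [Real.volume_Icc]; finiteness
    · rw [← setLIntegral_const, ← lintegral_indicator measurableSet_Icc]
      refine lintegral_mono fun t => indicator_apply_le fun h => ?_
      rw [indicator_of_mem (show t ∈ Icc (-(n : ℝ)) n from ((hTiff n t).1 h).2.1)]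
      exact min_le_right _ _
  · infer_instance
  · rw [withDensity_apply _ measurableSet_Ici] at ht
    by_contra hcon
    refine ht (setLIntegral_eq_zero measurableSet_Ici fun s hs => indicator_of_notMem ?_ _)
    exact fun h => hcon (((hTiff n s).1 h).2.2.trans (measure_mono (Ici_subset_Ici.2 hs)))

theorem io_coe_coe (s t : ℝ) : io s t = Ioo s t := by
  ext x; simp only [io, mem_ofPred_eq, mem_Ioo, EReal.coe_lt_coe_iff]

theorem mem_io {a b : EReal} {x : ℝ} : x ∈ io a b ↔ a < (x : EReal) ∧ (x : EReal) < b := by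
  rw [io, mem_ofPred_eq]

theorem measurableSet_io (a b : EReal) : MeasurableSet (io a b) :=
  measurable_coe_real_ereal (measurableSet_Ioo (a := a) (b := b))

theorem isOpen_io (a b : EReal) : IsOpen (io a b) :=
  (isOpen_Ioo (a := a) (b := b)).preimage continuous_coe_real_ereal

theorem io_left_coe {a b : EReal} {x : ℝ} (hx : x ∈ io a b) : io a x = io a b ∩ Iio x := by
  ext s
  simp only [mem_io, mem_inter_iff, mem_Iio, EReal.coe_lt_coe_iff] at hx ⊢
  exact ⟨fun h => ⟨⟨h.1, (EReal.coe_lt_coe_iff.2 h.2).trans hx.2⟩, h.2⟩, fun h => ⟨h.1.1, h.2⟩⟩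

theorem io_right_coe {a b : EReal} {x : ℝ} (hx : x ∈ io a b) : io x b = io a b ∩ Ioi x := by
  ext s
  simp only [mem_io, mem_inter_iff, mem_Ioi, EReal.coe_lt_coe_iff] at hx ⊢
  exact ⟨fun h => ⟨⟨hx.1.trans (EReal.coe_lt_coe_iff.2 h.1), h.2⟩, h.1⟩, fun h => ⟨h.2, h.1.2⟩⟩

/-- The part of Lebesgue measure with density `u` that lives on `D`. -/
def densityOn (D : Set ℝ) (u : ℝ → ℝ≥0∞) : Measure ℝ := volume.withDensity (D.indicator u)

theorem densityOn_apply {D S : Set ℝ} (hD : MeasurableSet D) (u : ℝ → ℝ≥0∞)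
    (hS : MeasurableSet S) : densityOn D u S = ∫⁻ s in D ∩ S, u s := by
  rw [densityOn, withDensity_apply _ hS, lintegral_indicator hD, Measure.restrict_restrict hD]

theorem setLIntegral_densityOn {D S : Set ℝ} (hD : MeasurableSet D) {u : ℝ → ℝ≥0∞}
    (hu : Measurable u) (hfin : ∀ x ∈ D, u x < ⊤) (hS : MeasurableSet S) (g : ℝ → ℝ≥0∞) :
    ∫⁻ s in S, g s ∂densityOn D u = ∫⁻ s in D ∩ S, u s * g s := by
  rw [densityOn, setLIntegral_withDensity_eq_setLIntegral_mul_non_measurable _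
    (hu.indicator hD) g hS, ← Measure.restrict_restrict hD, ← lintegral_indicator hD]
  · refine lintegral_congr fun x => ?_
    by_cases hx : x ∈ D <;> simp [hx]
  · refine Filter.Eventually.of_forall fun x => ?_
    by_cases hx : x ∈ D
    · simpa [hx] using hfin x hx
    · simp [hx]

theorem lintegral_densityOn {D : Set ℝ} (hD : MeasurableSet D) {u : ℝ → ℝ≥0∞}
    (hu : Measurable u) (hfin : ∀ x ∈ D, u x < ⊤) (g : ℝ → ℝ≥0∞) :
    ∫⁻ s, g s ∂densityOn D u = ∫⁻ s in D, u s * g s := by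
  have h := setLIntegral_densityOn hD hu hfin MeasurableSet.univ g
  rwa [Measure.restrict_univ, inter_univ] at h

theorem densityOn_Ici {a b : EReal} (v : ℝ → ℝ≥0∞) {t : ℝ} (ht : t ∈ io a b) :
    densityOn (io a b) v (Ici t) = ∫⁻ s in io t b, v s := by
  rw [densityOn_apply (measurableSet_io a b) v measurableSet_Ici, io_right_coe ht]
  exact setLIntegral_congr ((Filter.EventuallyEq.refl _ _).inter Ioi_ae_eq_Ici.symm)

theorem densityOn_Ici_ne_zero {a b : EReal} {v : ℝ → ℝ≥0∞} (hv : IsWeight a b v) {t : ℝ}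
    (ht : t ∈ io a b) : densityOn (io a b) v (Ici t) ≠ 0 := by
  rw [densityOn_Ici v ht]
  intro h
  obtain ⟨s, hs₁, hs₂⟩ := EReal.lt_iff_exists_real_btwn.1 (mem_io.1 ht).2
  have hpos : 0 < volume (io t b) := (isOpen_io t b).measure_pos volume ⟨s, mem_io.2 ⟨hs₁, hs₂⟩⟩
  rw [lintegral_eq_zero_iff hv.1, Filter.EventuallyEq, ae_restrict_iff' (measurableSet_io _ _)] at h
  refine hpos.ne' (measure_mono_null (fun x hx => ?_) h)
  intro hcon
  rw [io_right_coe ht] at hx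
  exact (hv.2 x hx.1).1.ne' (hcon (by rw [io_right_coe ht]; exact hx))

/-- The points of `(a, b)` whose right tail has finite `v`-mass. -/
def finiteTail (a b : EReal) (v : ℝ → ℝ≥0∞) : Set ℝ :=
  io a b ∩ (fun t => densityOn (io a b) v (Ici t)) ⁻¹' Iio ⊤

theorem mem_finiteTail {a b : EReal} {v : ℝ → ℝ≥0∞} {t : ℝ} :
    t ∈ finiteTail a b v ↔ t ∈ io a b ∧ densityOn (io a b) v (Ici t) < ⊤ := by
  rw [finiteTail, mem_inter_iff, mem_preimage, mem_Iio]

theorem measurableSet_finiteTail (a b : EReal) (v : ℝ → ℝ≥0∞) :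
    MeasurableSet (finiteTail a b v) :=
  (measurableSet_io a b).inter (measurable_measure_Ici _ measurableSet_Iio)

theorem finiteTail_inter_Ioi {a b : EReal} {v : ℝ → ℝ≥0∞} {t : ℝ}
    (ht : densityOn (io a b) v (Ici t) < ⊤) : finiteTail a b v ∩ Ioi t = io a b ∩ Ioi t := by
  ext s
  simp only [mem_inter_iff, mem_finiteTail, mem_Ioi]
  exact ⟨fun h => ⟨h.1.1, h.2⟩, fun h =>
    ⟨⟨h.1, (measure_mono (Ici_subset_Ici.2 h.2.le)).trans_lt ht⟩, h.2⟩⟩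

theorem densityOn_finiteTail_Ici {a b : EReal} {v : ℝ → ℝ≥0∞} (w : ℝ → ℝ≥0∞) {x : ℝ}
    (hx : x ∈ finiteTail a b v) :
    densityOn (finiteTail a b v) w (Ici x) = ∫⁻ s in io x b, w s := by
  rw [mem_finiteTail] at hx
  rw [densityOn_apply (measurableSet_finiteTail a b v) w measurableSet_Ici, io_right_coe hx.1,
    ← finiteTail_inter_Ioi hx.2]
  exact setLIntegral_congr ((Filter.EventuallyEq.refl _ _).inter Ioi_ae_eq_Ici.symm)

theorem densityOn_finiteTail_Ico {a b : EReal} {v : ℝ → ℝ≥0∞} (u : ℝ → ℝ≥0∞) {x s : ℝ}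
    (hx : x ∈ finiteTail a b v) (hs : (s : EReal) < b) :
    densityOn (finiteTail a b v) u (Ico x s) = ∫⁻ σ in io x s, u σ := by
  rw [mem_finiteTail] at hx
  rw [densityOn_apply (measurableSet_finiteTail a b v) u measurableSet_Ico, io_coe_coe]
  have h : finiteTail a b v ∩ Ioo x s = Ioo x s := by
    refine inter_eq_right.2 fun σ hσ => ?_
    rw [mem_finiteTail, mem_io]
    exact ⟨⟨(mem_io.1 hx.1).1.trans (EReal.coe_lt_coe_iff.2 hσ.1),
      (EReal.coe_lt_coe_iff.2 hσ.2).trans hs⟩,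
      (measure_mono (Ici_subset_Ici.2 hσ.1.le)).trans_lt hx.2⟩
  rw [← h]
  exact setLIntegral_congr ((Filter.EventuallyEq.refl _ _).inter Ioo_ae_eq_Ico.symm)

theorem gapEnergy_densityOn_finiteTail {a b : EReal} {u v w : ℝ → ℝ≥0∞} (hw : IsWeight a b w)
    (q : ℝ) {x : ℝ} (hx : x ∈ finiteTail a b v) :
    gapEnergy q (densityOn (finiteTail a b v) u) (densityOn (finiteTail a b v) w) x =
      ∫⁻ s in io x b, w s * (∫⁻ σ in io x s, u σ) ^ q := by
  have hx' := mem_finiteTail.1 hx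
  rw [gapEnergy, setLIntegral_densityOn (measurableSet_finiteTail a b v) hw.1
    (fun y hy => (hw.2 y (mem_finiteTail.1 hy).1).2) measurableSet_Ici, io_right_coe hx'.1,
    ← finiteTail_inter_Ioi hx'.2]
  refine (setLIntegral_congr
    ((Filter.EventuallyEq.refl _ _).inter Ioi_ae_eq_Ici.symm)).trans ?_
  refine setLIntegral_congr_fun ((measurableSet_finiteTail a b v).inter measurableSet_Ioi)
    fun s hs => ?_
  rw [densityOn_finiteTail_Ico u hx (mem_io.1 (mem_finiteTail.1 hs.1).1).2]

theorem gapSup_densityOn_finiteTail {a b : EReal} {u v : ℝ → ℝ≥0∞} {q β : ℝ} (hq : 0 < q)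
    (hβ : 0 < β) {x : ℝ} (hx : x ∈ finiteTail a b v) :
    gapSup q β (densityOn (finiteTail a b v) u) (densityOn (io a b) v) x =
      essSup (fun t : ℝ => (∫⁻ s in io t x, u s) ^ q * (∫⁻ s in io t b, v s) ^ (-β))
        (volume.restrict (io a x)) := by
  have hx' := mem_finiteTail.1 hx
  have hxi := mem_io.1 hx'.1
  refine le_antisymm ?_ ?_
  · set F : ℝ → ℝ≥0∞ :=
      fun t => (∫⁻ s in io t x, u s) ^ q * (∫⁻ s in io t b, v s) ^ (-β) with hF
    set e := essSup F (volume.restrict (io a x)) with he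
    have hae := ENNReal.ae_le_essSup (μ := volume.restrict (io a x)) F
    refine iSup₂_le fun t ht => ?_
    by_cases hfin : densityOn (io a b) v (Ici t) < ⊤
    swap
    · rw [not_lt_top_iff.1 hfin, ENNReal.top_rpow_of_neg (neg_neg_of_pos hβ), mul_zero]
      exact zero_le
    obtain ⟨m, hm⟩ : ∃ m : ℝ, (m : EReal) = max (t : EReal) a := by
      refine ⟨(max (t : EReal) a).toReal, EReal.coe_toReal ?_ ?_⟩
      · exact ((max_lt (EReal.coe_lt_coe_iff.2 ht) hxi.1).trans (EReal.coe_lt_top x)).ne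
      · exact ((EReal.bot_lt_coe t).trans_le (le_max_left _ _)).ne'
    have hma : a ≤ m := hm ▸ le_max_right _ _
    have htm : t ≤ m := EReal.coe_le_coe_iff.1 (hm ▸ le_max_left _ _)
    have hmx : m < x :=
      EReal.coe_lt_coe_iff.1 (hm ▸ max_lt (EReal.coe_lt_coe_iff.2 ht) hxi.1)
    have key : ∀ r, m < r → r < x →
        densityOn (finiteTail a b v) u (Ico r x) ^ q * densityOn (io a b) v (Ici t) ^ (-β) ≤ e := by
      intro r hmr hrx
      rw [ae_restrict_iff' (measurableSet_io _ _)] at hae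
      obtain ⟨s, hs, hsF⟩ : ∃ s ∈ Ioo m r, F s ≤ e := by
        by_contra! hcon
        refine (isOpen_Ioo.measure_pos volume (nonempty_Ioo.2 hmr)).ne'
          (measure_mono_null (fun s hs => ?_) (ae_iff.1 hae))
        rw [mem_ofPred_eq]
        refine fun himp => (hcon s hs).not_ge (himp (mem_io.2 ?_))
        exact ⟨hma.trans_lt (EReal.coe_lt_coe_iff.2 hs.1),
          EReal.coe_lt_coe_iff.2 (hs.2.trans hrx)⟩
      refine le_trans ?_ hsF
      have hsi : s ∈ io a b := mem_io.2 ⟨hma.trans_lt (EReal.coe_lt_coe_iff.2 hs.1),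
        (EReal.coe_lt_coe_iff.2 (hs.2.trans hrx)).trans hxi.2⟩
      have hst : densityOn (io a b) v (Ici s) ≤ densityOn (io a b) v (Ici t) :=
        measure_mono (Ici_subset_Ici.2 (htm.trans hs.1.le))
      have hsD : s ∈ finiteTail a b v := mem_finiteTail.2 ⟨hsi, hst.trans_lt hfin⟩
      simp only [hF]
      rw [← densityOn_Ici v hsi, ← densityOn_finiteTail_Ico u hsD hxi.2,
        ENNReal.rpow_neg, ENNReal.rpow_neg]
      refine mul_le_mul' ?_ ?_
      · exact ENNReal.rpow_le_rpow (measure_mono (Ico_subset_Ico_left hs.2.le)) hq.le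
      · exact ENNReal.inv_le_inv.2 (ENNReal.rpow_le_rpow hst hβ.le)
    obtain ⟨r, hr, hrm, hrl⟩ := exists_seq_strictAnti_tendsto' hmx
    have hset : finiteTail a b v ∩ Ico t x ⊆ {m} ∪ ⋃ n, finiteTail a b v ∩ Ico (r n) x := by
      intro s hs
      have hms : m ≤ s := by
        rw [← EReal.coe_le_coe_iff, hm]
        exact max_le (EReal.coe_le_coe_iff.2 hs.2.1) (mem_io.1 (mem_finiteTail.1 hs.1).1).1.le
      rcases hms.eq_or_lt with h | h
      · exact Or.inl h.symm
      · obtain ⟨n, hn⟩ := (hrl.eventually_lt_const h).exists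
        exact Or.inr (mem_iUnion.2 ⟨n, hs.1, hn.le, hs.2.2⟩)
    have hle : densityOn (finiteTail a b v) u (Ico t x) ≤
        ⨆ n, densityOn (finiteTail a b v) u (Ico (r n) x) := by
      have hmono : Monotone fun n => Ico (r n) x :=
        fun i j hij => Ico_subset_Ico_left (hr.antitone hij)
      rw [← hmono.measure_iUnion, densityOn_apply (measurableSet_finiteTail a b v) u
        measurableSet_Ico, densityOn_apply (measurableSet_finiteTail a b v) u
        (MeasurableSet.iUnion fun n => measurableSet_Ico), inter_iUnion]
      refine (lintegral_mono_set hset).trans ((lintegral_union_le _ _ _).trans ?_)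
      simp
    calc densityOn (finiteTail a b v) u (Ico t x) ^ q * densityOn (io a b) v (Ici t) ^ (-β)
        ≤ (⨆ n, densityOn (finiteTail a b v) u (Ico (r n) x)) ^ q *
            densityOn (io a b) v (Ici t) ^ (-β) := by gcongr
      _ ≤ e := by
          rw [iSup_rpow_eq hq, ENNReal.iSup_mul]
          exact iSup_le fun n => key _ (hrm n).1 (hrm n).2
  · refine essSup_le_of_ae_le _ ?_
    filter_upwards [ae_restrict_mem (measurableSet_io a x)] with t ht
    have hti : t ∈ io a b := by
      rw [io_left_coe hx'.1] at ht
      exact ht.1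
    have htx : t < x := EReal.coe_lt_coe_iff.1 (mem_io.1 ht).2
    rw [← densityOn_Ici v hti]
    by_cases hfin : densityOn (io a b) v (Ici t) < ⊤
    · rw [← densityOn_finiteTail_Ico u (mem_finiteTail.2 ⟨hti, hfin⟩) hxi.2]
      exact le_iSup₂ (f := fun t (_ : t ∈ Iio x) => densityOn (finiteTail a b v) u (Ico t x) ^ q *
        densityOn (io a b) v (Ici t) ^ (-β)) t htx
    · rw [not_lt_top_iff.1 hfin, ENNReal.top_rpow_of_neg (neg_neg_of_pos hβ), mul_zero]
      exact zero_le

theorem setLIntegral_eq_of_subset_of_eq_zero {D I : Set ℝ} (hD : MeasurableSet D)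
    (hI : MeasurableSet I) (hDI : D ⊆ I) {F : ℝ → ℝ≥0∞} (h : ∀ x ∈ I, x ∉ D → F x = 0) :
    ∫⁻ x in I, F x = ∫⁻ x in D, F x := by
  rw [← lintegral_indicator hD, ← lintegral_indicator hI]
  refine lintegral_congr fun x => ?_
  by_cases hx : x ∈ D
  · rw [indicator_of_mem hx, indicator_of_mem (hDI hx)]
  · rw [indicator_of_notMem hx]
    exact indicator_apply_eq_zero.2 fun hxI => h x hxI hx

theorem finiteTail_subset_io (a b : EReal) (v : ℝ → ℝ≥0∞) : finiteTail a b v ⊆ io a b :=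
  fun _ h => (mem_finiteTail.1 h).1

theorem notMem_finiteTail_of_lt {a b : EReal} {v : ℝ → ℝ≥0∞} {t x : ℝ} (hx : x ∈ io a b)
    (hxD : x ∉ finiteTail a b v) (htx : t < x) : t ∉ finiteTail a b v := fun ht =>
  hxD (mem_finiteTail.2 ⟨hx,
    (measure_mono (Ici_subset_Ici.2 htx.le)).trans_lt (mem_finiteTail.1 ht).2⟩)

theorem setLIntegral_io_eq_top_of_notMem_finiteTail {a b : EReal} {v : ℝ → ℝ≥0∞} {t : ℝ}
    (ht : t ∈ io a b) (htD : t ∉ finiteTail a b v) : ∫⁻ s in io t b, v s = ⊤ := by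
  rw [← densityOn_Ici v ht]
  by_contra h
  exact htD (mem_finiteTail.2 ⟨ht, lt_top_iff_ne_top.2 h⟩)

theorem tailEnergy_densityOn_finiteTail {a b : EReal} {u v : ℝ → ℝ≥0∞} (hu : IsWeight a b u)
    {β : ℝ} (hβ : 0 < β) {x : ℝ} (hx : x ∈ io a b) :
    tailEnergy β ((densityOn (finiteTail a b v) u).restrict (Iio x)) (densityOn (io a b) v) =
      ∫⁻ t in io a x, (∫⁻ s in io t x, u s) ^ β * u t * (∫⁻ s in io t b, v s) ^ (-β) := by
  have hxi := mem_io.1 hx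
  rw [tailEnergy, setLIntegral_densityOn (measurableSet_finiteTail a b v) hu.1
    (fun y hy => (hu.2 y (mem_finiteTail.1 hy).1).2) measurableSet_Iio, io_left_coe hx,
    setLIntegral_eq_of_subset_of_eq_zero
      ((measurableSet_finiteTail a b v).inter measurableSet_Iio)
      ((measurableSet_io a b).inter measurableSet_Iio)
      (inter_subset_inter_left _ (finiteTail_subset_io a b v))]
  · refine setLIntegral_congr_fun ((measurableSet_finiteTail a b v).inter measurableSet_Iio)
      fun t ht => ?_
    have hti := (mem_finiteTail.1 ht.1).1
    rw [Measure.restrict_apply measurableSet_Ici, Ici_inter_Iio,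
      densityOn_finiteTail_Ico u ht.1 hxi.2, densityOn_Ici v hti, div_eq_mul_inv,
      ENNReal.mul_rpow_of_nonneg _ _ hβ.le, ENNReal.inv_rpow, ENNReal.rpow_neg]
    ring
  · intro t ht htD
    rw [setLIntegral_io_eq_top_of_notMem_finiteTail ht.1 fun h => htD ⟨h, ht.2⟩,
      ENNReal.top_rpow_of_neg (neg_neg_of_pos hβ), mul_zero]

theorem CC3_eq {a b : EReal} {p q : ℝ} (hq : 0 < q) (hqp : q < p) {u v w : ℝ → ℝ≥0∞}
    (hw : IsWeight a b w) :
    CC3 a b p q u v w = gapConst p q (densityOn (finiteTail a b v) u)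
      (densityOn (finiteTail a b v) w) (densityOn (io a b) v) ^ ((p - q) / (p * q)) := by
  have hβ : 0 < q / (p - q) := div_pos hq (sub_pos.2 hqp)
  rw [CC3, gapConst, lintegral_densityOn (measurableSet_finiteTail a b v) hw.1
    (fun y hy => (hw.2 y (mem_finiteTail.1 hy).1).2)]
  congr 1
  rw [setLIntegral_eq_of_subset_of_eq_zero (measurableSet_finiteTail a b v)
    (measurableSet_io a b) (finiteTail_subset_io a b v)]
  · refine setLIntegral_congr_fun (measurableSet_finiteTail a b v) fun x hx => ?_
    rw [← gapEnergy_densityOn_finiteTail hw q hx, ← gapSup_densityOn_finiteTail hq hβ hx]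
    ring
  · intro x hx hxD
    refine mul_eq_zero_of_right _ (le_antisymm (essSup_le_of_ae_le _ ?_) zero_le)
    filter_upwards [ae_restrict_mem (measurableSet_io a x)] with t ht
    rw [io_left_coe hx] at ht
    rw [setLIntegral_io_eq_top_of_notMem_finiteTail ht.1 (notMem_finiteTail_of_lt hx hxD ht.2),
      ENNReal.top_rpow_of_neg (neg_neg_of_pos hβ), mul_zero]

theorem CC5_eq {a b : EReal} {p q : ℝ} (hq : 0 < q) (hqp : q < p) (hp1 : 1 < p)
    {u v w : ℝ → ℝ≥0∞} (hu : IsWeight a b u) (hw : IsWeight a b w) :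
    CC5 a b p q u v w = tailConst p q (densityOn (finiteTail a b v) u)
      (densityOn (finiteTail a b v) w) (densityOn (io a b) v) ^ ((p - q) / (p * q)) := by
  have hβ : 0 < 1 / (p - 1) := one_div_pos.2 (sub_pos.2 hp1)
  have hγ : 0 < q * (p - 1) / (p - q) :=
    div_pos (mul_pos hq (sub_pos.2 hp1)) (sub_pos.2 hqp)
  rw [CC5, tailConst, lintegral_densityOn (measurableSet_finiteTail a b v) hw.1
    (fun y hy => (hw.2 y (mem_finiteTail.1 hy).1).2)]
  congr 1
  rw [setLIntegral_eq_of_subset_of_eq_zero (measurableSet_finiteTail a b v)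
    (measurableSet_io a b) (finiteTail_subset_io a b v)]
  · refine setLIntegral_congr_fun (measurableSet_finiteTail a b v) fun x hx => ?_
    rw [densityOn_finiteTail_Ici w hx,
      tailEnergy_densityOn_finiteTail hu hβ (finiteTail_subset_io a b v hx)]
    ring
  · intro x hx hxD
    refine mul_eq_zero_of_right _ ((ENNReal.rpow_eq_zero_iff_of_pos hγ).2 ?_)
    refine (setLIntegral_congr_fun (measurableSet_io a x) fun t ht => ?_).trans
      (lintegral_zero (μ := volume.restrict (io a x)))
    rw [io_left_coe hx] at ht
    rw [setLIntegral_io_eq_top_of_notMem_finiteTail ht.1 (notMem_finiteTail_of_lt hx hxD ht.2),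
      ENNReal.top_rpow_of_neg (neg_neg_of_pos hβ), mul_zero]

theorem exists_monotone_eqOn {I : Set ℝ} {f : ℝ → ℝ≥0∞} (hf : MonotoneOn f I) :
    ∃ g : ℝ → ℝ≥0∞, Monotone g ∧ EqOn g f I := by
  refine ⟨fun x => ⨆ s ∈ I ∩ Iic x, f s, fun x y hxy => ?_, fun x hx => ?_⟩
  · exact biSup_mono fun s hs => ⟨hs.1, le_trans hs.2 hxy⟩
  · exact le_antisymm (iSup₂_le fun s hs => hf hs.1 hx hs.2)
      (le_iSup₂ (f := fun s (_ : s ∈ I ∩ Iic x) => f s) x ⟨hx, self_mem_Iic⟩)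

theorem rhsNorm_congr {a b : EReal} {p : ℝ} {v f g : ℝ → ℝ≥0∞} (h : EqOn g f (io a b)) :
    rhsNorm a b p v g = rhsNorm a b p v f := by
  rw [rhsNorm, rhsNorm]
  congr 1
  exact setLIntegral_congr_fun (measurableSet_io a b) fun x hx => by simp only [h hx]

theorem lhsMon_congr {a b : EReal} {q : ℝ} {u w f g : ℝ → ℝ≥0∞} (h : EqOn g f (io a b)) :
    lhsMon a b q u w g = lhsMon a b q u w f := by
  rw [lhsMon, lhsMon]
  congr 1
  refine setLIntegral_congr_fun (measurableSet_io a b) fun x hx => ?_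
  have hs : ∫⁻ s in io a x, g s * u s = ∫⁻ s in io a x, f s * u s :=
    setLIntegral_congr_fun (measurableSet_io a x) fun s hs => by
      rw [io_left_coe hx] at hs
      simp only [h hs.1]
  simp only [hs]

theorem rhsNorm_eq {a b : EReal} {p : ℝ} {v : ℝ → ℝ≥0∞} (hv : IsWeight a b v) (f : ℝ → ℝ≥0∞) :
    rhsNorm a b p v f = (∫⁻ t, f t ^ p ∂densityOn (io a b) v) ^ (1 / p) := by
  rw [rhsNorm, lintegral_densityOn (measurableSet_io a b) hv.1 fun y hy => (hv.2 y hy).2]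
  simp only [mul_comm]

theorem lintegral_rpow_setLIntegral_densityOn_finiteTail {a b : EReal} {u v w : ℝ → ℝ≥0∞}
    (hu : IsWeight a b u) (hw : IsWeight a b w) (q : ℝ) (f : ℝ → ℝ≥0∞) :
    ∫⁻ x, (∫⁻ t in Iio x, f t ∂densityOn (finiteTail a b v) u) ^ q
        ∂densityOn (finiteTail a b v) w =
      ∫⁻ x in finiteTail a b v,
        (∫⁻ s in finiteTail a b v ∩ Iio x, f s * u s) ^ q * w x := by
  rw [lintegral_densityOn (measurableSet_finiteTail a b v) hw.1
    (fun y hy => (hw.2 y (mem_finiteTail.1 hy).1).2)]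
  refine lintegral_congr fun x => ?_
  rw [setLIntegral_densityOn (measurableSet_finiteTail a b v) hu.1
    (fun y hy => (hu.2 y (mem_finiteTail.1 hy).1).2) measurableSet_Iio]
  simp only [mul_comm]

theorem lintegral_rpow_setLIntegral_le_lhsMon_rpow {a b : EReal} {q : ℝ} (hq : 0 < q)
    {u v w : ℝ → ℝ≥0∞} (hu : IsWeight a b u) (hw : IsWeight a b w) (f : ℝ → ℝ≥0∞) :
    ∫⁻ x, (∫⁻ t in Iio x, f t ∂densityOn (finiteTail a b v) u) ^ q
        ∂densityOn (finiteTail a b v) w ≤ lhsMon a b q u w f ^ q := by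
  rw [lintegral_rpow_setLIntegral_densityOn_finiteTail hu hw, lhsMon, one_div,
    ENNReal.rpow_inv_rpow hq.ne']
  refine (setLIntegral_mono' (measurableSet_finiteTail a b v) fun x hx => ?_).trans
    (lintegral_mono_set (finiteTail_subset_io a b v))
  rw [io_left_coe (finiteTail_subset_io a b v hx)]
  gcongr
  exact finiteTail_subset_io a b v

theorem eq_zero_of_notMem_finiteTail {a b : EReal} {p : ℝ} (hp : 0 < p) {v f : ℝ → ℝ≥0∞}
    (hf : Monotone f) (hfin : ∫⁻ t, f t ^ p ∂densityOn (io a b) v ≠ ⊤) {t : ℝ}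
    (ht : t ∈ io a b) (htD : t ∉ finiteTail a b v) : f t = 0 := by
  have htop : densityOn (io a b) v (Ici t) = ⊤ := by
    rw [densityOn_Ici v ht, setLIntegral_io_eq_top_of_notMem_finiteTail ht htD]
  have hle : f t ^ p * densityOn (io a b) v (Ici t) ≤ ∫⁻ t, f t ^ p ∂densityOn (io a b) v := by
    rw [← setLIntegral_const]
    refine (setLIntegral_mono' measurableSet_Ici fun s hs => ?_).trans
      (setLIntegral_le_lintegral _ _)
    exact ENNReal.rpow_le_rpow (hf hs) hp.le
  rw [htop] at hle
  by_contra h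
  have h0 : f t ^ p ≠ 0 := fun h0 => h ((ENNReal.rpow_eq_zero_iff_of_pos hp).1 h0)
  rw [ENNReal.mul_top h0] at hle
  exact hfin (top_le_iff.1 hle)

theorem lhsMon_rpow_eq {a b : EReal} {p q : ℝ} (hp : 0 < p) (hq : 0 < q)
    {u v w f : ℝ → ℝ≥0∞} (hu : IsWeight a b u) (hw : IsWeight a b w) (hf : Monotone f)
    (hfin : ∫⁻ t, f t ^ p ∂densityOn (io a b) v ≠ ⊤) :
    lhsMon a b q u w f ^ q = ∫⁻ x, (∫⁻ t in Iio x, f t ∂densityOn (finiteTail a b v) u) ^ q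
        ∂densityOn (finiteTail a b v) w := by
  have hinner : ∀ x ∈ io a b, ∫⁻ s in io a x, f s * u s =
      ∫⁻ s in finiteTail a b v ∩ Iio x, f s * u s := fun x hx => by
    rw [io_left_coe hx, setLIntegral_eq_of_subset_of_eq_zero
      ((measurableSet_finiteTail a b v).inter measurableSet_Iio)
      ((measurableSet_io a b).inter measurableSet_Iio)
      (inter_subset_inter_left _ (finiteTail_subset_io a b v))]
    intro s hs hsD
    rw [eq_zero_of_notMem_finiteTail hp hf hfin hs.1 fun h => hsD ⟨h, hs.2⟩, zero_mul]
  rw [lintegral_rpow_setLIntegral_densityOn_finiteTail hu hw, lhsMon, one_div,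
    ENNReal.rpow_inv_rpow hq.ne', setLIntegral_eq_of_subset_of_eq_zero
      (measurableSet_finiteTail a b v) (measurableSet_io a b) (finiteTail_subset_io a b v)]
  · refine setLIntegral_congr_fun (measurableSet_finiteTail a b v) fun x hx => ?_
    rw [hinner x (finiteTail_subset_io a b v hx)]
  · intro x hx hxD
    have hempty : finiteTail a b v ∩ Iio x = ∅ :=
      eq_empty_of_forall_notMem fun s hs => notMem_finiteTail_of_lt hx hxD hs.2 hs.1
    rw [hinner x hx, hempty, Measure.restrict_empty, lintegral_zero_measure,
      ENNReal.zero_rpow_of_pos hq, zero_mul]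

theorem exists_isMonotoneLimit_densityOn_finiteTail {a b : EReal} {u v : ℝ → ℝ≥0∞}
    (hu : IsWeight a b u) (hv : IsWeight a b v) :
    ∃ μ : ℕ → Measure ℝ, IsMonotoneLimit μ (densityOn (finiteTail a b v) u) ∧
      (∀ n, IsFiniteMeasure (μ n)) ∧ (∀ n, NullSingletonClass (μ n)) ∧
      ∀ n, ∃ δ ≠ 0, TailLower δ (μ n) (densityOn (io a b) v) :=
  exists_isMonotoneLimit_withDensity hu.1 (measurableSet_finiteTail a b v) fun _ ht =>
    densityOn_Ici_ne_zero hv (finiteTail_subset_io a b v ht)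

theorem exists_mul_CC3_add_CC5_le {p q : ℝ} (hq : 0 < q) (hqp : q < p) (hp1 : 1 < p) :
    ∃ c : ℝ≥0∞, c ≠ ⊤ ∧ ∀ (a b : EReal) (u v w : ℝ → ℝ≥0∞), IsWeight a b u → IsWeight a b v →
      IsWeight a b w → ∀ C : ℝ≥0∞, (∀ f : ℝ → ℝ≥0∞, Measurable f → MonotoneOn f (io a b) →
        lhsMon a b q u w f ≤ C * rhsNorm a b p v f) →
      CC3 a b p q u v w + CC5 a b p q u v w ≤ c * C := by
  obtain ⟨c, hc, h⟩ := exists_gapConst_le_and_tailConst_le_of_isMonotoneLimit hq hqp hp1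
  have hp : 0 < p := hq.trans hqp
  have hr : 0 < p - q := sub_pos.2 hqp
  have hθ : 0 < (p - q) / (p * q) := div_pos hr (mul_pos hp hq)
  refine ⟨2 * c ^ ((p - q) / (p * q)), ENNReal.mul_ne_top ENNReal.ofNat_ne_top
    (ENNReal.rpow_ne_top_of_nonneg hθ.le hc), fun a b u v w hu hv hw C hC => ?_⟩
  obtain ⟨μ, hμ, hμfin, -, hlow⟩ := exists_isMonotoneLimit_densityOn_finiteTail hu hv
  obtain ⟨ω, hω, hωfin, hω0, -⟩ := exists_isMonotoneLimit_densityOn_finiteTail hw hv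
  obtain ⟨hG, hT⟩ := h μ ω _ _ _ hμ hω hμfin hωfin hω0 hlow (C ^ q) fun f hf => by
    refine (lintegral_rpow_setLIntegral_le_lhsMon_rpow hq hu hw f).trans ?_
    refine (ENNReal.rpow_le_rpow (hC f hf.measurable (hf.monotoneOn _)) hq.le).trans_eq ?_
    rw [rhsNorm_eq hv, ENNReal.mul_rpow_of_nonneg _ _ hq.le, ← ENNReal.rpow_mul]
    congr 2
    ring
  have hscale : ∀ G : ℝ≥0∞, G ≤ c * (C ^ q) ^ (p / (p - q)) →
      G ^ ((p - q) / (p * q)) ≤ c ^ ((p - q) / (p * q)) * C := fun G hG => by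
    refine (ENNReal.rpow_le_rpow hG hθ.le).trans_eq ?_
    rw [ENNReal.mul_rpow_of_nonneg _ _ hθ.le, ← ENNReal.rpow_mul, ← ENNReal.rpow_mul,
      show q * (p / (p - q) * ((p - q) / (p * q))) = 1 by field_simp, ENNReal.rpow_one]
  rw [CC3_eq hq hqp hw, CC5_eq hq hqp hp1 hu hw, mul_assoc, two_mul]
  exact add_le_add (hscale _ hG) (hscale _ hT)

theorem exists_lhsMon_le {p q : ℝ} (hq : 0 < q) (hqp : q < p) (hp1 : 1 < p) :
    ∃ c : ℝ≥0∞, c ≠ ⊤ ∧ ∀ (a b : EReal) (u v w : ℝ → ℝ≥0∞), IsWeight a b u → IsWeight a b v →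
      IsWeight a b w → ∀ C : ℝ≥0∞, c * (CC3 a b p q u v w + CC5 a b p q u v w) ≤ C → C ≠ 0 →
      ∀ f : ℝ → ℝ≥0∞, MonotoneOn f (io a b) → lhsMon a b q u w f ≤ C * rhsNorm a b p v f := by
  obtain ⟨c, hc, h⟩ := exists_lintegral_rpow_setLIntegral_Iio_le_of_isMonotoneLimit hq hqp hp1
  have hp : 0 < p := hq.trans hqp
  have hr : 0 < p - q := sub_pos.2 hqp
  have hθ : 0 < (p - q) / (p * q) := div_pos hr (mul_pos hp hq)
  have hq' : 0 < 1 / q := one_div_pos.2 hq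
  refine ⟨c ^ (1 / q) * 2 ^ ((p - q) / (p * q)), ENNReal.mul_ne_top
    (ENNReal.rpow_ne_top_of_nonneg hq'.le hc)
    (ENNReal.rpow_ne_top_of_nonneg hθ.le ENNReal.ofNat_ne_top),
    fun a b u v w hu hv hw C hC hC0 f hf => ?_⟩
  obtain ⟨g, hg, hgf⟩ := exists_monotone_eqOn hf
  rw [← lhsMon_congr hgf, ← rhsNorm_congr hgf, rhsNorm_eq hv]
  by_cases hfin : ∫⁻ t, g t ^ p ∂densityOn (io a b) v = ⊤
  · rw [hfin, ENNReal.top_rpow_of_pos (one_div_pos.2 hp), ENNReal.mul_top hC0]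
    exact le_top
  obtain ⟨μ, hμ, hμfin, hμ0, hlow⟩ := exists_isMonotoneLimit_densityOn_finiteTail hu hv
  obtain ⟨ω, hω, hωfin, -, -⟩ := exists_isMonotoneLimit_densityOn_finiteTail hw hv
  have hmain := h μ ω _ _ _ hμ hω hμfin hωfin hμ0 hlow g hg hfin
  rw [← lhsMon_rpow_eq hp hq hu hw hg hfin] at hmain
  have hroot := ENNReal.rpow_le_rpow hmain hq'.le
  rw [ENNReal.mul_rpow_of_nonneg _ _ hq'.le, ENNReal.mul_rpow_of_nonneg _ _ hq'.le,
    one_div, ENNReal.rpow_rpow_inv hq.ne', ← ENNReal.rpow_mul, ← ENNReal.rpow_mul,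
    show (p - q) / p * q⁻¹ = (p - q) / (p * q) by field_simp,
    show q / p * q⁻¹ = 1 / p by field_simp, ← one_div] at hroot
  refine hroot.trans (mul_le_mul_left (le_trans ?_ hC) _)
  rw [CC3_eq hq hqp hw, CC5_eq hq hqp hp1 hu hw, mul_assoc]
  exact mul_le_mul_right (ENNReal.add_rpow_le_two_rpow_mul _ _ hθ.le) _

theorem monotone_hardy_case_iv (p q : ℝ) (hq : 0 < q)
    (hqp : q < p) (hp1 : 1 < p) :
    ∃ c₁ c₂ : ℝ≥0∞, 0 < c₁ ∧ c₂ < ⊤ ∧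
      ∀ (a b : EReal), a < b → ∀ u v w : ℝ → ℝ≥0∞,
        IsWeight a b u → IsWeight a b v → IsWeight a b w →
        ((∃ C : ℝ≥0∞, 0 < C ∧ C < ⊤ ∧ ∀ f : ℝ → ℝ≥0∞,
            Measurable f → MonotoneOn f (io a b) →
            lhsMon a b q u w f ≤ C * rhsNorm a b p v f) ↔
          (CC3 a b p q u v w < ⊤ ∧ CC5 a b p q u v w < ⊤)) ∧
        c₁ * (CC3 a b p q u v w + CC5 a b p q u v w) ≤ bestMon a b p q u v w ∧
        bestMon a b p q u v w ≤ c₂ * (CC3 a b p q u v w + CC5 a b p q u v w) := by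
  obtain ⟨c₁, hc₁, hlower⟩ := exists_mul_CC3_add_CC5_le hq hqp hp1
  obtain ⟨c₂, hc₂, hupper⟩ := exists_lhsMon_le hq hqp hp1
  refine ⟨(c₁ + 1)⁻¹, c₂, ENNReal.inv_pos.2 (by finiteness), lt_top_iff_ne_top.2 hc₂,
    fun a b _ u v w hu hv hw => ⟨⟨?_, ?_⟩, ?_, ?_⟩⟩
  · rintro ⟨C, -, hC, h⟩
    rw [← ENNReal.add_lt_top]
    exact (hlower a b u v w hu hv hw C h).trans_lt
      (ENNReal.mul_lt_top (lt_top_iff_ne_top.2 hc₁) hC)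
  · rintro ⟨h₃, h₅⟩
    refine ⟨c₂ * (CC3 a b p q u v w + CC5 a b p q u v w) + 1, by simp, ?_, fun f _ hf =>
      hupper a b u v w hu hv hw _ le_self_add (by simp) f hf⟩
    finiteness
  · refine le_sInf fun C hC => ?_
    rw [mem_ofPred_eq] at hC
    rw [ENNReal.inv_mul_le_iff (by simp) (by finiteness)]
    exact (hlower a b u v w hu hv hw C hC).trans (mul_le_mul_left le_self_add _)
  · refine le_of_forall_gt_imp_ge_of_dense fun C hC => sInf_le ?_
    rw [mem_ofPred_eq]
    exact fun f _ hf => hupper a b u v w hu hv hw C hC.le (zero_le.trans_lt hC).ne' f hf
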